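/- Let α, β > −1 and let N ≥ 1 be odd. Then for every f ∈ C_c^∞(0,π) and every θ ∈ (0,π), the principal value pv ∫₀^π R_N(θ,φ) f(φ) dμ(φ) exists and equals R_N f(θ). -/

import Mathlib

open MeasureTheory Real Set Filter
open scoped Classical

noncomputable section

/-- The Jacobi measure dμ_{α,β} on (0,π). -/
def jacobiMeasure (α β : ℝ) : Measure ℝ :=
  (volume.restrict (Set.Ioo 0 π)).withDensity
    (fun θ => ENNReal.ofReal ((Real.sin (θ/2)) ^ (2*α+1) * (Real.cos (θ/2)) ^ (2*β+1)))

/-- The classical Jacobi polynomial `P_n^{(α,β)}`. -/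
def jacobiPoly (α β : ℝ) (n : ℕ) (x : ℝ) : ℝ :=
  ∑ k ∈ Finset.range (n+1),
    (Real.Gamma ((n:ℝ)+α+1) / (Real.Gamma (α+(k:ℝ)+1) * (Nat.factorial (n-k)))) *
    (Real.Gamma ((n:ℝ)+β+1) / (Real.Gamma ((n:ℝ)+β-(k:ℝ)+1) * (Nat.factorial k))) *
    ((x-1)/2)^k * ((x+1)/2)^(n-k)

/-- Normalized trigonometric Jacobi polynomial `𝒫_n(θ) = c_n P_n^{(α,β)}(cos θ)`. -/
def nJacobi (α β : ℝ) (c : ℕ → ℝ) (n : ℕ) (θ : ℝ) : ℝ :=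
  c n * jacobiPoly α β n (Real.cos θ)

def jacobiTau (α β : ℝ) : ℝ := (α + β + 1) / 2

/-- `c` is an admissible sequence of (positive) normalizing constants. -/
def JacobiNormalized (α β : ℝ) (c : ℕ → ℝ) : Prop :=
  (∀ n, 0 < c n) ∧
  ∀ n, ∫ θ, (nJacobi α β c n θ)^2 ∂(jacobiMeasure α β) = 1

/-- The Jacobi-Poisson kernel. -/
def poissonKer (α β : ℝ) (c : ℕ → ℝ) (t θ φ : ℝ) : ℝ :=
  ∑' n : ℕ, Real.exp (-t * |(n:ℝ) + jacobiTau α β|) * nJacobi α β c n θ * nJacobi α β c n φ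

/-- The Riesz-Jacobi kernel of order `N`. -/
def rieszKer (α β : ℝ) (c : ℕ → ℝ) (N : ℕ) (θ φ : ℝ) : ℝ :=
  (1 / Real.Gamma (N:ℝ)) *
    ∫ t in Set.Ioi (0:ℝ), iteratedDeriv N (fun θ' => poissonKer α β c t θ' φ) θ * t ^ (N-1)

/-- Inner product in `L²(dμ_{α,β})`. -/
def jacobiInner (α β : ℝ) (f g : ℝ → ℝ) : ℝ := ∫ θ, f θ * g θ ∂(jacobiMeasure α β)

/-- The Riesz-Jacobi transform of order `N` on test functions. -/
def rieszTransform (α β : ℝ) (c : ℕ → ℝ) (N : ℕ) (f : ℝ → ℝ) (θ : ℝ) : ℝ :=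
  ∑' n : ℕ, |((n:ℝ)+1) + jacobiTau α β| ^ (-(N:ℝ)) *
    jacobiInner α β f (nJacobi α β c (n+1)) *
    iteratedDeriv N (nJacobi α β c (n+1)) θ

/-- `f ∈ C_c^∞(0,π)`. -/
def IsCcSmooth (f : ℝ → ℝ) : Prop :=
  ContDiff ℝ (⊤ : ℕ∞) f ∧ HasCompactSupport f ∧ tsupport f ⊆ Set.Ioo 0 π

section
open Polynomial Topology


/-- The Jacobi weight. -/
def jw (α β θ : ℝ) : ℝ := (Real.sin (θ/2)) ^ (2*α+1) * (Real.cos (θ/2)) ^ (2*β+1)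

lemma sin_half_pos {θ : ℝ} (h : θ ∈ Ioo 0 π) : 0 < Real.sin (θ/2) :=
  Real.sin_pos_of_pos_of_lt_pi (by linarith [h.1]) (by linarith [h.2, Real.pi_pos])

lemma cos_half_pos {θ : ℝ} (h : θ ∈ Ioo 0 π) : 0 < Real.cos (θ/2) :=
  Real.cos_pos_of_mem_Ioo ⟨by linarith [h.1, Real.pi_pos], by linarith [h.2]⟩

lemma jw_pos (α β : ℝ) {θ : ℝ} (h : θ ∈ Ioo 0 π) : 0 < jw α β θ :=
  mul_pos (Real.rpow_pos_of_pos (sin_half_pos h) _) (Real.rpow_pos_of_pos (cos_half_pos h) _)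

lemma jw_meas (α β : ℝ) : Measurable (jw α β) := by
  unfold jw; fun_prop

lemma jw_reflect (α β θ : ℝ) : jw α β (π - θ) = jw β α θ := by
  unfold jw
  rw [show (π - θ)/2 = π/2 - θ/2 by ring, Real.sin_pi_div_two_sub, Real.cos_pi_div_two_sub, mul_comm]

lemma jw_int_left (α β : ℝ) (hα : -1 < α) : IntegrableOn (jw α β) (Ioc 0 (π/2)) := by
  -- continuous part
  have h1 : IntegrableOn (fun θ : ℝ => θ ^ (2*α+1)) (Ioc 0 (π/2)) := by
    rw [← intervalIntegrable_iff_integrableOn_Ioc_of_le (by positivity)]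
    exact intervalIntegral.intervalIntegrable_rpow' (by linarith)
  have hs : ∀ θ ∈ Ioc (0:ℝ) (π/2), θ/π ≤ Real.sin (θ/2) ∧ Real.sin (θ/2) ≤ θ/2 := by
    intro θ hθ
    refine ⟨?_, Real.sin_le (by linarith [hθ.1])⟩
    have := Real.mul_le_sin (x := θ/2) (by linarith [hθ.1]) (by linarith [hθ.2, Real.pi_pos])
    calc θ/π = 2/π * (θ/2) := by field_simp
      _ ≤ _ := this
  have hc : ∀ θ ∈ Ioc (0:ℝ) (π/2), 1/2 ≤ Real.cos (θ/2) ∧ Real.cos (θ/2) ≤ 1 := by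
    intro θ hθ
    refine ⟨?_, Real.cos_le_one _⟩
    rw [← Real.cos_pi_div_three]
    apply Real.cos_le_cos_of_nonneg_of_le_pi <;> linarith [hθ.1, hθ.2, Real.pi_pos]
  -- rpow bounds
  have hb : ∀ (a b x p : ℝ), 0 < a → a ≤ x → x ≤ b → x ^ p ≤ a ^ p + b ^ p := by
    intro a b x p ha h1 h2
    rcases le_total 0 p with hp | hp
    · have := Real.rpow_le_rpow (by linarith) h2 hp
      have h3 := (Real.rpow_pos_of_pos ha p).le
      linarith
    · have := Real.rpow_le_rpow_of_nonpos ha h1 hp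
      have h3 := (Real.rpow_pos_of_pos (show 0 < b by linarith) p).le
      linarith
  refine Integrable.mono' (g := fun θ => (((1/π)^(2*α+1) + (1/2)^(2*α+1)) * ((1/2)^(2*β+1) + 1^(2*β+1))) * θ^(2*α+1))
    (h1.const_mul _) (jw_meas α β).aestronglyMeasurable ?_
  filter_upwards [ae_restrict_mem measurableSet_Ioc] with θ hθ
  have hθ' : θ ∈ Ioo 0 π := ⟨hθ.1, by linarith [hθ.2, Real.pi_pos]⟩
  rw [Real.norm_of_nonneg (jw_pos α β hθ').le]
  unfold jw
  have e1 := hb (θ/π) (θ/2) _ (2*α+1) (by have := hθ.1; positivity) (hs θ hθ).1 (hs θ hθ).2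
  have e2 := hb (1/2) 1 _ (2*β+1) (by norm_num) (hc θ hθ).1 (hc θ hθ).2
  have e3 : (θ/π)^(2*α+1) = (1/π)^(2*α+1) * θ^(2*α+1) := by
    rw [← Real.mul_rpow (by positivity) hθ.1.le]; congr 1; ring
  have e4 : (θ/2)^(2*α+1) = (1/2)^(2*α+1) * θ^(2*α+1) := by
    rw [← Real.mul_rpow (by positivity) hθ.1.le]; congr 1; ring
  rw [e3, e4] at e1
  calc _ ≤ _ := mul_le_mul e1 e2 (Real.rpow_nonneg (cos_half_pos hθ').le _)
        (by have := hθ.1; positivity)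
    _ = _ := by ring

lemma jw_integrableOn (α β : ℝ) (hα : -1 < α) (hβ : -1 < β) : IntegrableOn (jw α β) (Ioo 0 π) := by
  have h1 := jw_int_left α β hα
  have h2 := jw_int_left β α hβ
  rw [← intervalIntegrable_iff_integrableOn_Ioo_of_le Real.pi_pos.le]
  rw [← intervalIntegrable_iff_integrableOn_Ioc_of_le (by positivity)] at h1 h2
  refine h1.trans ?_
  have h3 := h2.comp_sub_left π
  simp only [sub_zero] at h3
  have : (fun x => jw β α (π - x)) = jw α β := by
    funext x; exact jw_reflect β α x
  rw [this] at h3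
  convert h3.symm using 1; ring

lemma jm_eq (α β : ℝ) : jacobiMeasure α β =
    (volume.restrict (Set.Ioo 0 π)).withDensity (fun θ => ENNReal.ofReal (jw α β θ)) := rfl

lemma jm_setIntegral (α β : ℝ) (S : Set ℝ) (hS : MeasurableSet S) (F : ℝ → ℝ) :
    ∫ θ in S, F θ ∂(jacobiMeasure α β) = ∫ θ in S ∩ Ioo 0 π, F θ * jw α β θ := by
  rw [jm_eq, restrict_withDensity hS, integral_withDensity_eq_integral_toReal_smul
    (by have := jw_meas α β; fun_prop) (by simp), Measure.restrict_restrict hS]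
  apply setIntegral_congr_fun (hS.inter measurableSet_Ioo)
  intro θ hθ
  simp only [smul_eq_mul]
  rw [ENNReal.toReal_ofReal (jw_pos α β hθ.2).le, mul_comm]

lemma jm_integral (α β : ℝ) (F : ℝ → ℝ) :
    ∫ θ, F θ ∂(jacobiMeasure α β) = ∫ θ in Ioo 0 π, F θ * jw α β θ := by
  have := jm_setIntegral α β univ MeasurableSet.univ F
  simpa using this

lemma jm_finite (α β : ℝ) (hα : -1 < α) (hβ : -1 < β) : IsFiniteMeasure (jacobiMeasure α β) := by
  rw [jm_eq]
  apply isFiniteMeasure_withDensity_ofReal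
  exact (jw_integrableOn α β hα hβ).2

lemma jm_ac (α β : ℝ) : jacobiMeasure α β ≪ volume := by
  rw [jm_eq]
  exact (withDensity_absolutelyContinuous _ _).trans Measure.restrict_le_self.absolutelyContinuous

lemma jm_ae (α β : ℝ) : ∀ᵐ θ ∂(jacobiMeasure α β), θ ∈ Ioo 0 π := by
  rw [jm_eq]
  exact (withDensity_absolutelyContinuous _ _).ae_le (ae_restrict_mem measurableSet_Ioo)

/-- The moment functional. -/
def jL (α β : ℝ) (p : ℝ[X]) : ℝ := ∫ θ, p.eval (Real.cos θ) ∂(jacobiMeasure α β)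

lemma int_of_cont (α β : ℝ) (hα : -1 < α) (hβ : -1 < β) (g : ℝ → ℝ) (hg : Continuous g) :
    Integrable g (jacobiMeasure α β) := by
  haveI := jm_finite α β hα hβ
  obtain ⟨C, hC⟩ := (isCompact_Icc (a := (0:ℝ)) (b := π)).exists_bound_of_continuousOn hg.continuousOn
  apply Integrable.of_bound hg.aestronglyMeasurable C
  filter_upwards [jm_ae α β] with θ hθ
  exact hC θ ⟨hθ.1.le, hθ.2.le⟩

lemma poly_cos_cont (p : ℝ[X]) : Continuous (fun θ => p.eval (Real.cos θ)) :=
  p.continuous.comp Real.continuous_cos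

lemma jL_int {α β : ℝ} (hα : -1 < α) (hβ : -1 < β) (p : ℝ[X]) : Integrable (fun θ => p.eval (Real.cos θ)) (jacobiMeasure α β) :=
  int_of_cont α β hα hβ _ (poly_cos_cont p)

lemma jL_add {α β : ℝ} (hα : -1 < α) (hβ : -1 < β) (p q : ℝ[X]) : jL α β (p + q) = jL α β p + jL α β q := by
  unfold jL
  simp only [eval_add]
  exact integral_add (jL_int hα hβ p) (jL_int hα hβ q)

lemma jL_sub {α β : ℝ} (hα : -1 < α) (hβ : -1 < β) (p q : ℝ[X]) : jL α β (p - q) = jL α β p - jL α β q := by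
  unfold jL
  simp only [eval_sub]
  exact integral_sub (jL_int hα hβ p) (jL_int hα hβ q)

lemma jL_C {α β : ℝ} (_hα : -1 < α) (_hβ : -1 < β) (a : ℝ) (p : ℝ[X]) : jL α β (C a * p) = a * jL α β p := by
  unfold jL
  simp only [eval_mul, eval_C]
  exact integral_const_mul _ _

end

section
open Polynomial Topology

/-- The first order operator appearing in integration by parts. -/
def ibpOp (α β : ℝ) (r : ℝ[X]) : ℝ[X] :=
  (1 - X^2) * derivative r + (C (β-α) - C (α+β+2) * X) * r

lemma jL_ibp {α β : ℝ} (hα : -1 < α) (hβ : -1 < β) (r : ℝ[X]) : jL α β (ibpOp α β r) = 0 := by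
  unfold jL
  rw [jm_integral, ← integral_Ioc_eq_integral_Ioo, ← intervalIntegral.integral_of_le Real.pi_pos.le]
  set W : ℝ → ℝ := fun θ => (-2) * ((Real.sin (θ/2)) ^ (2*α+2) * (Real.cos (θ/2)) ^ (2*β+2) * r.eval (Real.cos θ))
    with hW
  have hcont : Continuous W := by
    have h1 : Continuous fun θ : ℝ => (Real.sin (θ/2)) ^ (2*α+2) :=
      Continuous.rpow_const (by fun_prop) (fun _ => Or.inr (by linarith))
    have h2 : Continuous fun θ : ℝ => (Real.cos (θ/2)) ^ (2*β+2) :=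
      Continuous.rpow_const (by fun_prop) (fun _ => Or.inr (by linarith))
    have h3 := poly_cos_cont r
    fun_prop
  have key := intervalIntegral.integral_eq_sub_of_hasDerivAt_of_tendsto (f := W)
    (f' := fun θ => (ibpOp α β r).eval (Real.cos θ) * jw α β θ) (fa := W 0) (fb := W π) Real.pi_pos ?_ ?_
    (hcont.continuousAt.tendsto.mono_left nhdsWithin_le_nhds)
    (hcont.continuousAt.tendsto.mono_left nhdsWithin_le_nhds)
  · rw [key]
    simp only [hW]
    simp [Real.zero_rpow (show 2*α+2 ≠ 0 by linarith), Real.zero_rpow (show 2*β+2 ≠ 0 by linarith)]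
  · intro θ hθ
    have hs := sin_half_pos hθ
    have hc := cos_half_pos hθ
    have d1 : HasDerivAt (fun θ : ℝ => Real.sin (θ/2)) (Real.cos (θ/2) * (1/2)) θ :=
      ((hasDerivAt_id' θ).div_const 2).sin
    have d2 : HasDerivAt (fun θ : ℝ => Real.cos (θ/2)) (-Real.sin (θ/2) * (1/2)) θ :=
      ((hasDerivAt_id' θ).div_const 2).cos
    have d3 := d1.rpow_const (p := 2*α+2) (Or.inl hs.ne')
    have d4 := d2.rpow_const (p := 2*β+2) (Or.inl hc.ne')
    have d5 : HasDerivAt (fun θ : ℝ => r.eval (Real.cos θ)) ((derivative r).eval (Real.cos θ) * (-Real.sin θ)) θ :=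
      (r.hasDerivAt (Real.cos θ)).comp θ (Real.hasDerivAt_cos θ)
    have d6 := ((d3.mul d4).mul d5).const_mul (-2)
    refine d6.congr_deriv ?_
    unfold ibpOp jw
    simp only [eval_add, eval_mul, eval_sub, eval_one, eval_pow, eval_X, eval_C, Pi.mul_apply]
    have e1 : Real.sin (θ/2) ^ (2*α+2) = Real.sin (θ/2) ^ (2*α+1) * Real.sin (θ/2) := by
      rw [show 2*α+2 = (2*α+1)+1 by ring, Real.rpow_add_one hs.ne']
    have e2 : Real.cos (θ/2) ^ (2*β+2) = Real.cos (θ/2) ^ (2*β+1) * Real.cos (θ/2) := by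
      rw [show 2*β+2 = (2*β+1)+1 by ring, Real.rpow_add_one hc.ne']
    rw [e1, e2, show 2*α+2-1 = 2*α+1 by ring, show 2*β+2-1 = 2*β+1 by ring]
    have e3 : Real.sin θ = 2 * Real.sin (θ/2) * Real.cos (θ/2) := by
      rw [← Real.sin_two_mul]; congr 1; ring
    have e4 : Real.cos θ = 1 - 2 * Real.sin (θ/2)^2 := by
      rw [show θ = 2 * (θ/2) by ring, Real.cos_two_mul', show 2 * (θ/2) / 2 = θ/2 by ring]
      linarith [Real.sin_sq_add_cos_sq (θ/2)]
    have e5 : Real.cos (θ/2)^2 = 1 - Real.sin (θ/2)^2 := by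
      linarith [Real.sin_sq_add_cos_sq (θ/2)]
    rw [show Real.sin θ = 2 * Real.sin (θ/2) * Real.cos (θ/2) from e3]
    generalize hD : (derivative r).eval (Real.cos θ) = D
    generalize hR : r.eval (Real.cos θ) = R
    rw [e4]
    generalize Real.sin (θ/2) ^ (2*α+1) = A
    generalize Real.cos (θ/2) ^ (2*β+1) = B
    generalize Real.sin (θ/2) = s at *
    generalize Real.cos (θ/2) = c at *
    linear_combination (A*B*(4*D*s^2 - R*(2*α+2))) * e5
  · rw [intervalIntegrable_iff_integrableOn_Ioo_of_le Real.pi_pos.le]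
    obtain ⟨M, hM⟩ := (isCompact_Icc (a := (0:ℝ)) (b := π)).exists_bound_of_continuousOn
      (poly_cos_cont (ibpOp α β r)).continuousOn
    refine Integrable.bdd_mul (c := M) (jw_integrableOn α β hα hβ)
      (poly_cos_cont (ibpOp α β r)).aestronglyMeasurable ?_
    filter_upwards [ae_restrict_mem measurableSet_Ioo] with θ hθ
    exact hM θ ⟨hθ.1.le, hθ.2.le⟩

lemma jL_shift (α β : ℝ) (p : ℝ[X]) :
    jL (α+1) (β+1) p = jL α β (C (1/4) * ((1 - X^2) * p)) := by
  unfold jL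
  rw [jm_integral, jm_integral]
  apply setIntegral_congr_fun measurableSet_Ioo
  intro θ hθ
  have hs := sin_half_pos hθ
  have hc := cos_half_pos hθ
  simp only [eval_mul, eval_sub, eval_one, eval_pow, eval_X, eval_C]
  unfold jw
  have e1 : Real.sin (θ/2) ^ (2*(α+1)+1) = Real.sin (θ/2) ^ (2*α+1) * Real.sin (θ/2)^2 := by
    rw [show 2*(α+1)+1 = (2*α+1)+(2:ℕ) by push_cast; ring, Real.rpow_add_natCast hs.ne']
  have e2 : Real.cos (θ/2) ^ (2*(β+1)+1) = Real.cos (θ/2) ^ (2*β+1) * Real.cos (θ/2)^2 := by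
    rw [show 2*(β+1)+1 = (2*β+1)+(2:ℕ) by push_cast; ring, Real.rpow_add_natCast hc.ne']
  have e3 : Real.sin θ = 2 * Real.sin (θ/2) * Real.cos (θ/2) := by
    rw [← Real.sin_two_mul]; congr 1; ring
  have e4 : 1 - Real.cos θ^2 = (2 * Real.sin (θ/2) * Real.cos (θ/2))^2 := by
    rw [← e3]; linarith [Real.sin_sq_add_cos_sq θ]
  rw [e1, e2, e4]; ring

/-- coefficients of the Jacobi polynomial -/
def jcoef (α β : ℝ) (n k : ℕ) : ℝ :=
  (Real.Gamma ((n:ℝ)+α+1) / (Real.Gamma (α+(k:ℝ)+1) * (Nat.factorial (n-k)))) *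
    (Real.Gamma ((n:ℝ)+β+1) / (Real.Gamma ((n:ℝ)+β-(k:ℝ)+1) * (Nat.factorial k)))

/-- The Jacobi polynomial as a polynomial. -/
def jP (α β : ℝ) (n : ℕ) : ℝ[X] :=
  ∑ k ∈ Finset.range (n+1), C (jcoef α β n k) * ((C (1/2) * (X - 1))^k * (C (1/2) * (X + 1))^(n-k))

lemma jP_eval (α β : ℝ) (n : ℕ) (x : ℝ) : (jP α β n).eval x = jacobiPoly α β n x := by
  unfold jP jacobiPoly jcoef
  rw [eval_finsetSum]
  apply Finset.sum_congr rfl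
  intro k _
  simp only [eval_mul, eval_C, eval_pow, eval_sub, eval_add, eval_X, eval_one]
  rw [show (1/2:ℝ) * (x-1) = (x-1)/2 by ring, show (1/2:ℝ)*(x+1) = (x+1)/2 by ring]
  ring

lemma jcoef_pos {α β : ℝ} (hα : -1 < α) (hβ : -1 < β) {n k : ℕ} (hk : k ≤ n) : 0 < jcoef α β n k := by
  have hk' : (k:ℝ) ≤ n := by exact_mod_cast hk
  have h0 : (0:ℝ) ≤ k := Nat.cast_nonneg k
  unfold jcoef
  have a1 := Real.Gamma_pos_of_pos (show 0 < (n:ℝ)+α+1 by linarith)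
  have a2 := Real.Gamma_pos_of_pos (show 0 < α+(k:ℝ)+1 by linarith)
  have a3 := Real.Gamma_pos_of_pos (show 0 < (n:ℝ)+β+1 by linarith)
  have a4 := Real.Gamma_pos_of_pos (show 0 < (n:ℝ)+β-(k:ℝ)+1 by linarith)
  positivity

lemma jcoef_rel1 {α β : ℝ} (hα : -1 < α) {n k : ℕ} (hk : k ≤ n) :
    ((k:ℝ)+α+1) * jcoef (α+1) (β+1) n k = ((n:ℝ)+1-k) * jcoef α β (n+1) k := by
  have hk' : (k:ℝ) ≤ n := by exact_mod_cast hk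
  have h0 : (0:ℝ) ≤ k := Nat.cast_nonneg k
  unfold jcoef
  have g1 : Real.Gamma (α+1+(k:ℝ)+1) = (α+k+1) * Real.Gamma (α+k+1) := by
    rw [← Real.Gamma_add_one (by linarith)]; congr 1; ring
  have f1 : ((n+1-k).factorial : ℝ) = ((n:ℝ)+1-k) * ((n-k).factorial : ℝ) := by
    rw [show n+1-k = (n-k)+1 by omega, Nat.factorial_succ]; push_cast [Nat.cast_sub hk]; ring
  have a2 := (Real.Gamma_pos_of_pos (show 0 < α+(k:ℝ)+1 by linarith)).ne'
  have n1 : (α+k+1:ℝ) ≠ 0 := by linarith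
  have n2 : ((n:ℝ)+1-k) ≠ 0 := by linarith
  rw [g1, f1]
  push_cast
  rw [show (n:ℝ)+(α+1)+1 = n+1+α+1 by ring, show (n:ℝ)+(β+1)+1 = n+1+β+1 by ring,
    show (n:ℝ)+(β+1)-k+1 = n+1+β-k+1 by ring, show (k:ℝ)+α+1 = α+k+1 by ring]
  have f2 : ((n-k).factorial : ℝ) ≠ 0 := by positivity
  field_simp

lemma jcoef_rel2 {α β : ℝ} (hβ : -1 < β) {n k : ℕ} (hk : k ≤ n) :
    (((n-k:ℕ):ℝ)+β+1) * jcoef (α+1) (β+1) n k = ((k:ℝ)+1) * jcoef α β (n+1) (k+1) := by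
  have hk' : (k:ℝ) ≤ n := by exact_mod_cast hk
  have h0 : (0:ℝ) ≤ k := Nat.cast_nonneg k
  unfold jcoef
  have g1 : Real.Gamma ((n:ℝ)+(β+1)-k+1) = (n-k+β+1) * Real.Gamma (n-k+β+1) := by
    rw [← Real.Gamma_add_one (by linarith)]; congr 1; ring
  have a2 := (Real.Gamma_pos_of_pos (show 0 < (n-k+β+1:ℝ) by linarith)).ne'
  have n1 : (n-k+β+1:ℝ) ≠ 0 := by linarith
  rw [g1, Nat.factorial_succ, show n+1-(k+1) = n-k by omega]
  push_cast [Nat.cast_sub hk]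
  rw [show (n:ℝ)+(α+1)+1 = n+1+α+1 by ring, show (n:ℝ)+(β+1)+1 = n+1+β+1 by ring,
    show (n:ℝ)+1+β-(k+1)+1 = n-k+β+1 by ring, show (α+1+k+1:ℝ) = α+(k+1)+1 by ring]
  have f2 : (k.factorial : ℝ) ≠ 0 := by positivity
  have n3 : (k:ℝ)+1 ≠ 0 := by positivity
  field_simp

lemma ibpOp_term (α β : ℝ) (i j : ℕ) :
    ibpOp α β ((C (1/2) * (X - 1))^i * (C (1/2) * (X + 1))^j) =
    C (-2 * (i+α+1)) * ((C (1/2) * (X - 1))^i * (C (1/2) * (X + 1))^(j+1)) +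
    C (-2 * (j+β+1)) * ((C (1/2) * (X - 1))^(i+1) * (C (1/2) * (X + 1))^j) := by
  apply Polynomial.funext
  intro x
  have hd : ∀ (m : ℕ) (y : ℝ), (m:ℝ) * y^(m-1) * y = m * y^m := by
    intro m y; cases m with
    | zero => simp
    | succ m => simp [pow_succ]; ring
  have h1 := hd i ((1/2)*(x-1))
  have h2 := hd j ((1/2)*(x+1))
  unfold ibpOp
  simp only [derivative_mul, derivative_pow, derivative_sub, derivative_add, derivative_X, derivative_one,
    derivative_C, eval_add, eval_mul, eval_sub, eval_pow, eval_C, eval_X, eval_one, eval_zero, eval_natCast,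
    map_mul, map_add, map_sub, map_natCast]
  rw [pow_succ ((1/2:ℝ)*(x-1)) i, pow_succ ((1/2:ℝ)*(x+1)) j]
  generalize ((1/2:ℝ)*(x-1))^(i-1) = u at *
  generalize ((1/2:ℝ)*(x+1))^(j-1) = v at *
  generalize ((1/2:ℝ)*(x-1))^i = U at *
  generalize ((1/2:ℝ)*(x+1))^j = V at *
  linear_combination (-(x+1)*V) * h1 - ((x-1)*U) * h2

lemma ibpOp_add (α β : ℝ) (p q : ℝ[X]) : ibpOp α β (p+q) = ibpOp α β p + ibpOp α β q := by
  unfold ibpOp; rw [derivative_add]; ring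

lemma ibpOp_C (α β a : ℝ) (q : ℝ[X]) : ibpOp α β (C a * q) = C a * ibpOp α β q := by
  unfold ibpOp; rw [derivative_C_mul]; ring

lemma ibpOp_sum (α β : ℝ) (s : Finset ℕ) (g : ℕ → ℝ[X]) :
    ibpOp α β (∑ k ∈ s, g k) = ∑ k ∈ s, ibpOp α β (g k) := by
  induction s using Finset.induction_on with
  | empty => simp [ibpOp]
  | insert a s ha ih => rw [Finset.sum_insert ha, Finset.sum_insert ha, ibpOp_add, ih]

lemma rodrigues {α β : ℝ} (hα : -1 < α) (hβ : -1 < β) (n : ℕ) :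
    ibpOp α β (jP (α+1) (β+1) n) = C (-2*((n:ℝ)+1)) * jP α β (n+1) := by
  unfold jP
  rw [ibpOp_sum]
  simp only [ibpOp_C, ibpOp_term]
  set S : ℕ → ℝ[X] := fun k => (C (1/2) * (X - 1))^k * (C (1/2) * (X + 1))^(n+1-k) with hS
  have hl : ∀ k ∈ Finset.range (n+1),
      C (jcoef (α+1) (β+1) n k) * (C (-2 * (k+α+1)) * ((C (1/2) * (X - 1))^k * (C (1/2) * (X + 1))^(n-k+1)) +
        C (-2 * ((n-k:ℕ)+β+1)) * ((C (1/2) * (X - 1))^(k+1) * (C (1/2) * (X + 1))^(n-k)))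
      = C (-2*(((n:ℝ)+1-k) * jcoef α β (n+1) k)) * S k
        + C (-2 * (((k+1:ℕ):ℝ) * jcoef α β (n+1) (k+1))) * S (k+1) := by
    intro k hk
    have hk' : k ≤ n := by simpa [Nat.lt_succ_iff] using hk
    rw [← jcoef_rel1 hα hk']
    push_cast
    rw [← jcoef_rel2 hβ hk']
    simp only [hS]
    rw [show n+1-k = n-k+1 by omega, show n+1-(k+1) = n-k by omega]
    simp only [map_mul]
    push_cast
    ring
  rw [Finset.sum_congr rfl hl, Finset.sum_add_distrib]
  have h1 : ∑ k ∈ Finset.range (n+1), C (-2*(((n:ℝ)+1-k) * jcoef α β (n+1) k)) * S k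
      = ∑ k ∈ Finset.range (n+1+1), C (-2*(((n:ℝ)+1-k) * jcoef α β (n+1) k)) * S k := by
    rw [Finset.sum_range_succ _ (n+1)]
    simp
  have h2 : ∑ k ∈ Finset.range (n+1), C (-2 * (((k+1:ℕ):ℝ) * jcoef α β (n+1) (k+1))) * S (k+1)
      = ∑ k ∈ Finset.range (n+1+1), C (-2 * ((k:ℝ) * jcoef α β (n+1) k)) * S k := by
    rw [Finset.sum_range_succ' _ (n+1)]
    simp
  rw [h1, h2, ← Finset.sum_add_distrib, Finset.mul_sum]
  apply Finset.sum_congr rfl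
  intro k _
  rw [← add_mul, ← map_add]
  show _ = C (-2*((n:ℝ)+1)) * (C (jcoef α β (n+1) k) * S k)
  rw [← mul_assoc (C (-2*((n:ℝ)+1))) (C _) (S k), ← map_mul]
  congr 2
  ring

lemma jP_orth (n : ℕ) : ∀ {α β : ℝ} (_ : -1 < α) (_ : -1 < β) (r : ℝ[X]), r.degree < n →
    jL α β (jP α β n * r) = 0 := by
  induction n with
  | zero =>
    intro α β hα hβ r hr
    have : r = 0 := by
      by_contra h
      have := zero_le_degree_iff.mpr h
      exact absurd (lt_of_le_of_lt this hr) (by simp)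
    simp [this, jL]
  | succ n ih =>
    intro α β hα hβ r hr
    have h1 := jL_ibp hα hβ (jP (α+1) (β+1) n * r)
    have h2 : ibpOp α β (jP (α+1) (β+1) n * r) =
        C (-2*((n:ℝ)+1)) * (jP α β (n+1) * r) + C 4 * (C (1/4) * ((1-X^2) * (jP (α+1) (β+1) n * derivative r))) := by
      rw [← mul_assoc, ← rodrigues hα hβ, ← mul_assoc (C 4), ← map_mul]
      unfold ibpOp
      rw [derivative_mul]
      norm_num
      ring
    rw [h2, jL_add hα hβ, jL_C hα hβ, jL_C hα hβ, ← jL_shift] at h1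
    have h3 : jL (α+1) (β+1) (jP (α+1) (β+1) n * derivative r) = 0 := by
      apply ih (by linarith) (by linarith)
      by_cases hz : r = 0
      · simp [hz]
      have := degree_derivative_lt hz
      rw [degree_eq_natDegree hz] at this hr
      by_cases hz' : derivative r = 0
      · simp [hz']
      rw [degree_eq_natDegree hz'] at this ⊢
      have a1 : (derivative r).natDegree < r.natDegree := by exact_mod_cast this
      have a2 : r.natDegree < n + 1 := by exact_mod_cast hr
      exact_mod_cast (by omega : (derivative r).natDegree < n)
    rw [h3] at h1
    have h4 : (-2*((n:ℝ)+1)) ≠ 0 := by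
      have : (0:ℝ) ≤ n := Nat.cast_nonneg n
      linarith
    have := mul_eq_zero.mp (by linarith : (-2*((n:ℝ)+1)) * jL α β (jP α β (n+1) * r) = 0)
    exact this.resolve_left h4

lemma jP_degree_le (α β : ℝ) (n : ℕ) : (jP α β n).natDegree ≤ n := by
  unfold jP
  apply natDegree_sum_le_of_forall_le
  intro k hk
  have hk' : k ≤ n := by simpa [Nat.lt_succ_iff] using hk
  have h : (C (jcoef α β n k) * ((C (1/2:ℝ) * (X - 1))^k * (C (1/2) * (X + 1))^(n-k))).natDegree ≤ 0 + (k*1 + (n-k)*1) := by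
    refine natDegree_mul_le_of_le (by simp) (natDegree_mul_le_of_le (natDegree_pow_le_of_le _ ?_) (natDegree_pow_le_of_le _ ?_))
    · compute_degree
    · compute_degree
  omega

lemma jP_coeff_pos {α β : ℝ} (hα : -1 < α) (hβ : -1 < β) (n : ℕ) : 0 < (jP α β n).coeff n := by
  unfold jP
  rw [finsetSum_coeff]
  apply Finset.sum_pos
  · intro k hk
    have hk' : k ≤ n := by simpa [Nat.lt_succ_iff] using hk
    rw [coeff_C_mul]
    apply mul_pos (jcoef_pos hα hβ hk')
    have l1 : (C (1/2:ℝ) * (X - 1)).natDegree ≤ 1 := by compute_degree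
    have l2 : (C (1/2:ℝ) * (X + 1)).natDegree ≤ 1 := by compute_degree
    have := coeff_mul_add_eq_of_natDegree_le (natDegree_pow_le_of_le k l1) (natDegree_pow_le_of_le (n-k) l2)
    rw [show k*1+(n-k)*1 = n by omega] at this
    rw [this, coeff_pow_of_natDegree_le l1, coeff_pow_of_natDegree_le l2]
    have c1 : (C (1/2:ℝ) * (X - 1)).coeff 1 = 1/2 := by
      rw [coeff_C_mul]; simp [coeff_one]
    have c2 : (C (1/2:ℝ) * (X + 1)).coeff 1 = 1/2 := by
      rw [coeff_C_mul]; simp [coeff_one]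
    rw [c1, c2]; positivity
  · simp

end

section
open Polynomial Topology

/-- The normalized polynomial. -/
def pp (α β : ℝ) (c : ℕ → ℝ) (n : ℕ) : ℝ[X] := C (c n) * jP α β n

lemma pp_eval (α β : ℝ) (c : ℕ → ℝ) (n : ℕ) (θ : ℝ) :
    (pp α β c n).eval (Real.cos θ) = nJacobi α β c n θ := by
  unfold pp nJacobi; rw [eval_mul, eval_C, jP_eval]

/-- Package of standing assumptions. -/
structure JH (α β : ℝ) (c : ℕ → ℝ) : Prop where
  hα : -1 < α
  hβ : -1 < β
  hc : JacobiNormalized α β c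

/-- functional `r ↦ 𝓛(r p_k)` -/
def jl (α β : ℝ) (c : ℕ → ℝ) (k : ℕ) (r : ℝ[X]) : ℝ := jL α β (r * pp α β c k)

/-- recurrence coefficients -/
def ja (α β : ℝ) (c : ℕ → ℝ) (n : ℕ) : ℝ := jl α β c n (X * pp α β c n)
def jb (α β : ℝ) (c : ℕ → ℝ) (n : ℕ) : ℝ := jl α β c (n+1) (X * pp α β c n)
def jbm (α β : ℝ) (c : ℕ → ℝ) : ℕ → ℝ
  | 0 => 0
  | (n+1) => jb α β c n

lemma degLT {r : ℝ[X]} {n : ℕ} (h : r.natDegree ≤ n) (h0 : r.coeff n = 0) : r.degree < n := by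
  rw [degree_lt_iff_coeff_zero]
  intro m hm
  rcases hm.eq_or_lt with rfl | h'
  · exact h0
  · exact coeff_eq_zero_of_natDegree_lt (lt_of_le_of_lt h h')

lemma ndSub {p q : ℝ[X]} {n : ℕ} (hp : p.natDegree ≤ n) (hq : q.natDegree ≤ n) : (p - q).natDegree ≤ n :=
  (natDegree_sub_le p q).trans (max_le hp hq)

lemma degLT' {r : ℝ[X]} {m n : ℕ} (h : r.natDegree ≤ m) (h0 : m < n) : r.degree < n :=
  lt_of_le_of_lt degree_le_natDegree (by exact_mod_cast lt_of_le_of_lt h h0)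

namespace JH
variable {α β : ℝ} {c : ℕ → ℝ}

lemma lC (H : JH α β c) (k : ℕ) (a : ℝ) (r : ℝ[X]) : jl α β c k (C a * r) = a * jl α β c k r := by
  unfold jl; rw [mul_assoc, jL_C H.hα H.hβ]
lemma ladd (H : JH α β c) (k : ℕ) (r s : ℝ[X]) : jl α β c k (r + s) = jl α β c k r + jl α β c k s := by
  unfold jl; rw [add_mul, jL_add H.hα H.hβ]
lemma lsub (H : JH α β c) (k : ℕ) (r s : ℝ[X]) : jl α β c k (r - s) = jl α β c k r - jl α β c k s := by
  unfold jl; rw [sub_mul, jL_sub H.hα H.hβ]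
lemma lneg (H : JH α β c) (k : ℕ) (r : ℝ[X]) : jl α β c k (-r) = - jl α β c k r := by
  rw [show -r = C (-1) * r by simp, H.lC]; ring

lemma orth (H : JH α β c) {k : ℕ} {r : ℝ[X]} (h : r.degree < k) : jl α β c k r = 0 := by
  unfold jl pp
  rw [show r * (C (c k) * jP α β k) = C (c k) * (jP α β k * r) by ring, jL_C H.hα H.hβ,
    jP_orth k H.hα H.hβ r h, mul_zero]

lemma natDeg (_H : JH α β c) (n : ℕ) : (pp α β c n).natDegree ≤ n :=
  (natDegree_C_mul_le _ _).trans (jP_degree_le α β n)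

lemma coeff_pos (H : JH α β c) (n : ℕ) : 0 < (pp α β c n).coeff n := by
  unfold pp; rw [coeff_C_mul]; exact mul_pos (H.hc.1 n) (jP_coeff_pos H.hα H.hβ n)

lemma norm1 (H : JH α β c) (n : ℕ) : jl α β c n (pp α β c n) = 1 := by
  rw [← H.hc.2 n]
  unfold jl jL
  simp only [eval_mul, pp_eval, sq]

lemma symm (_H : JH α β c) (m n : ℕ) : jl α β c n (pp α β c m) = jl α β c m (pp α β c n) := by
  unfold jl; rw [mul_comm]

lemma symmX (_H : JH α β c) (m n : ℕ) (r : ℝ[X]) :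
    jl α β c n (r * pp α β c m) = jl α β c m (r * pp α β c n) := by
  unfold jl; congr 1; ring

lemma ortho (H : JH α β c) {m n : ℕ} (h : m ≠ n) : jl α β c n (pp α β c m) = 0 := by
  rcases lt_or_gt_of_ne h with h | h
  · exact H.orth (degLT' (H.natDeg m) h)
  · rw [H.symm]; exact H.orth (degLT' (H.natDeg n) h)

lemma zero (H : JH α β c) (m : ℕ) : ∀ (r : ℝ[X]), r.natDegree ≤ m → (∀ k ≤ m, jl α β c k r = 0) → r = 0 := by
  induction m with
  | zero =>
    intro r hr hk
    have h0 := H.coeff_pos 0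
    have e1 := eq_C_of_natDegree_le_zero hr
    have e2 := eq_C_of_natDegree_le_zero (H.natDeg 0)
    have e3 : r = C (r.coeff 0 / (pp α β c 0).coeff 0) * pp α β c 0 := by
      rw [e2, coeff_C_zero, ← map_mul, div_mul_cancel₀ _ h0.ne']; exact e1
    have := hk 0 le_rfl
    rw [e3, H.lC, H.norm1, mul_one] at this
    rw [e3, this]; simp
  | succ m ih =>
    intro r hr hk
    have h0 := H.coeff_pos (m+1)
    set l := r.coeff (m+1) / (pp α β c (m+1)).coeff (m+1) with hl
    have hd : (r - C l * pp α β c (m+1)).degree < ((m+1 : ℕ) : WithBot ℕ) := by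
      apply degLT
      · exact ndSub hr ((natDegree_C_mul_le _ _).trans (H.natDeg _))
      · rw [coeff_sub, coeff_C_mul, hl, div_mul_cancel₀ _ h0.ne', sub_self]
    have h1 := H.orth hd
    rw [H.lsub, H.lC, H.norm1, hk _ le_rfl] at h1
    have hl0 : l = 0 := by linarith
    rw [hl0] at hd
    simp only [map_zero, zero_mul, sub_zero] at hd
    apply ih r _ (fun k hk' => hk k (by omega))
    apply Nat.le_of_lt_succ
    by_cases hr0 : r = 0
    · simp [hr0]
    · rw [degree_eq_natDegree hr0] at hd; exact_mod_cast hd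

lemma natDegX (H : JH α β c) (n : ℕ) : (X * pp α β c n).natDegree ≤ n+1 := by
  refine (natDegree_mul_le_of_le natDegree_X_le (H.natDeg n)).trans (by omega)

lemma jb_pos (H : JH α β c) (n : ℕ) : 0 < jb α β c n := by
  have h0 := H.coeff_pos n
  have h1 := H.coeff_pos (n+1)
  set l := (pp α β c n).coeff n / (pp α β c (n+1)).coeff (n+1) with hl
  have hd : (X * pp α β c n - C l * pp α β c (n+1)).degree < ((n+1 : ℕ) : WithBot ℕ) := by
    apply degLT
    · exact ndSub (H.natDegX n) ((natDegree_C_mul_le _ _).trans (H.natDeg _))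
    · rw [coeff_sub, coeff_C_mul, hl, div_mul_cancel₀ _ h1.ne', coeff_X_mul, sub_self]
  have h2 := H.orth hd
  rw [H.lsub, H.lC, H.norm1] at h2
  have : jb α β c n = l := by unfold jb; linarith
  rw [this]; positivity

lemma recur (H : JH α β c) (n : ℕ) : X * pp α β c n =
    C (jb α β c n) * pp α β c (n+1) + C (ja α β c n) * pp α β c n + C (jbm α β c n) * pp α β c (n-1) := by
  rw [← sub_eq_zero]
  apply H.zero (n+1)
  · refine ndSub (H.natDegX n) (natDegree_add_le_of_degree_le
      (natDegree_add_le_of_degree_le ?_ ?_) ?_) <;> refine (natDegree_C_mul_le _ _).trans ?_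
    · exact H.natDeg _
    · exact (H.natDeg _).trans (by omega)
    · exact (H.natDeg _).trans (by omega)
  · intro k hk
    rw [H.lsub, H.ladd, H.ladd, H.lC, H.lC, H.lC]
    rcases hk.eq_or_lt with rfl | hk
    · rw [H.norm1, H.ortho (show n ≠ n+1 by omega), H.ortho (show n-1 ≠ n+1 by omega)]
      unfold jb; ring
    rcases (Nat.lt_succ_iff.mp hk).eq_or_lt with rfl | hk
    · rw [H.norm1, H.ortho (show k+1 ≠ k by omega)]
      have : jbm α β c k * jl α β c k (pp α β c (k-1)) = 0 := by
        cases k with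
        | zero => simp [jbm]
        | succ k => rw [H.ortho (by omega), mul_zero]
      rw [this]; unfold ja; ring
    obtain ⟨m, rfl⟩ : ∃ m, n = m + 1 := ⟨n-1, by omega⟩
    rw [H.ortho (show m+1+1 ≠ k by omega), H.ortho (show m+1 ≠ k by omega)]
    simp only [jbm, Nat.add_sub_cancel]
    rcases (Nat.lt_succ_iff.mp hk).eq_or_lt with rfl | hk
    · rw [H.norm1, H.symmX]; unfold jb; ring
    rw [H.ortho (show m ≠ k by omega), H.symmX, H.orth (degLT' (H.natDegX k) (by omega))]
    ring

lemma lX (H : JH α β c) (n : ℕ) (r : ℝ[X]) : jl α β c n (X * r) =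
    jb α β c n * jl α β c (n+1) r + ja α β c n * jl α β c n r + jbm α β c n * jl α β c (n-1) r := by
  have h := H.recur n
  unfold jl
  rw [show X * r * pp α β c n = r * (X * pp α β c n) by ring, h, mul_add, mul_add]
  rw [jL_add H.hα H.hβ, jL_add H.hα H.hβ, ← jL_C H.hα H.hβ, ← jL_C H.hα H.hβ, ← jL_C H.hα H.hβ]
  congr 1
  · congr 1 <;> congr 1 <;> ring
  · congr 1; ring

/-- the derivation -/
def _root_.jD (r : ℝ[X]) : ℝ[X] := (1 - X^2) * derivative r

lemma natDegD (m : ℕ) (r : ℝ[X]) (h : r.natDegree ≤ m) : (jD r).natDegree ≤ m+1 := by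
  unfold jD
  cases m with
  | zero =>
    rw [eq_C_of_natDegree_le_zero h]; simp
  | succ m =>
    have h1 : (derivative r).natDegree ≤ m := (natDegree_derivative_le r).trans (by omega)
    have h2 : (1 - X^2 : ℝ[X]).natDegree ≤ 2 := by compute_degree
    exact (natDegree_mul_le_of_le h2 h1).trans (by omega)

lemma coeffD (m : ℕ) (r : ℝ[X]) (h : r.natDegree ≤ m) : (jD r).coeff (m+1) = - (m:ℝ) * r.coeff m := by
  unfold jD
  cases m with
  | zero =>
    rw [eq_C_of_natDegree_le_zero h]; simp
  | succ m =>
    have h1 : (derivative r).natDegree ≤ m := (natDegree_derivative_le r).trans (by omega)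
    rw [sub_mul, coeff_sub, one_mul, coeff_eq_zero_of_natDegree_lt (lt_of_le_of_lt h1 (by omega)),
      show m+1+1 = m + 2 by rfl, coeff_X_pow_mul, coeff_derivative]
    push_cast; ring

lemma ibp (H : JH α β c) (p r : ℝ[X]) : jL α β (jD p * r) =
    - jL α β (p * (jD r + (C (β-α) - C (α+β+2) * X) * r)) := by
  have h := jL_ibp H.hα H.hβ (p * r)
  have e : ibpOp α β (p*r) = jD p * r + p * (jD r + (C (β-α) - C (α+β+2) * X) * r) := by
    unfold ibpOp jD; rw [derivative_mul]; ring
  rw [e, jL_add H.hα H.hβ] at h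
  linarith

lemma lD (H : JH α β c) (n : ℕ) (r : ℝ[X]) : jl α β c n (jD r) =
    - jL α β (r * (jD (pp α β c n) + (C (β-α) - C (α+β+2) * X) * pp α β c n)) := H.ibp r _

/-- diagonal structure coefficient -/
def _root_.jB (α β : ℝ) (c : ℕ → ℝ) (n : ℕ) : ℝ := -(β-α)/2 + (α+β+2) * ja α β c n / 2

lemma D_up (H : JH α β c) (n : ℕ) : jl α β c (n+1) (jD (pp α β c n)) = -(n:ℝ) * jb α β c n := by
  have hd : (jD (pp α β c n) + C (n:ℝ) * (X * pp α β c n)).degree < ((n+1 : ℕ) : WithBot ℕ) := by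
    apply degLT
    · exact natDegree_add_le_of_degree_le (natDegD _ _ (H.natDeg n)) ((natDegree_C_mul_le _ _).trans (H.natDegX n))
    · rw [coeff_add, coeffD _ _ (H.natDeg n), coeff_C_mul, coeff_X_mul]; ring
  have := H.orth hd
  rw [H.ladd, H.lC] at this
  unfold jb; linarith

lemma D_diag (H : JH α β c) (n : ℕ) : jl α β c n (jD (pp α β c n)) = jB α β c n := by
  have h := H.lD n (pp α β c n)
  have e : pp α β c n * (jD (pp α β c n) + (C (β-α) - C (α+β+2) * X) * pp α β c n) =
     jD (pp α β c n) * pp α β c n + (C (β-α) * pp α β c n - C (α+β+2) * (X * pp α β c n)) * pp α β c n := by ring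
  rw [e, jL_add H.hα H.hβ] at h
  change _ = -(jl α β c n _ + jl α β c n _) at h
  rw [H.lsub, H.lC, H.lC, H.norm1] at h
  unfold jB; unfold ja
  linarith

lemma D_down (H : JH α β c) (n : ℕ) : jl α β c n (jD (pp α β c (n+1))) = ((n:ℝ)+α+β+2) * jb α β c n := by
  have h := H.lD n (pp α β c (n+1))
  have e : pp α β c (n+1) * (jD (pp α β c n) + (C (β-α) - C (α+β+2) * X) * pp α β c n) =
     jD (pp α β c n) * pp α β c (n+1) + (C (β-α) * pp α β c n - C (α+β+2) * (X * pp α β c n)) * pp α β c (n+1) := by ring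
  rw [e, jL_add H.hα H.hβ] at h
  change _ = -(jl α β c (n+1) _ + jl α β c (n+1) _) at h
  rw [H.lsub, H.lC, H.lC, H.ortho (show n ≠ n+1 by omega), H.D_up] at h
  unfold jb at *
  linarith

lemma D_far (H : JH α β c) {n k : ℕ} (h : n + 1 < k) : jl α β c k (jD (pp α β c n)) = 0 :=
  H.orth (degLT' (natDegD _ _ (H.natDeg n)) h)

lemma D_low (H : JH α β c) {n k : ℕ} (h : k + 1 < n) : jl α β c k (jD (pp α β c n)) = 0 := by
  have e := H.lD k (pp α β c n)
  have e2 : pp α β c n * (jD (pp α β c k) + (C (β-α) - C (α+β+2) * X) * pp α β c k) =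
     (jD (pp α β c k) + (C (β-α) * pp α β c k - C (α+β+2) * (X * pp α β c k))) * pp α β c n := by ring
  rw [e2] at e
  change _ = -(jl α β c n _) at e
  rw [e, H.ladd, H.lsub, H.lC, H.lC, H.D_far h, H.ortho (by omega), H.orth (degLT' (H.natDegX k) h)]
  ring

lemma struct (H : JH α β c) (n : ℕ) : jD (pp α β c n) =
    C (-(n:ℝ) * jb α β c n) * pp α β c (n+1) + C (jB α β c n) * pp α β c n
      + C (((n:ℝ)+α+β+1) * jbm α β c n) * pp α β c (n-1) := by
  rw [← sub_eq_zero]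
  apply H.zero (n+1)
  · refine ndSub (natDegD _ _ (H.natDeg n)) (natDegree_add_le_of_degree_le
      (natDegree_add_le_of_degree_le ?_ ?_) ?_) <;> refine (natDegree_C_mul_le _ _).trans ?_
    · exact H.natDeg _
    · exact (H.natDeg _).trans (by omega)
    · exact (H.natDeg _).trans (by omega)
  · intro k hk
    rw [H.lsub, H.ladd, H.ladd, H.lC, H.lC, H.lC]
    rcases hk.eq_or_lt with rfl | hk
    · rw [H.norm1, H.ortho (show n ≠ n+1 by omega), H.ortho (show n-1 ≠ n+1 by omega), H.D_up]
      ring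
    rcases (Nat.lt_succ_iff.mp hk).eq_or_lt with rfl | hk
    · rw [H.norm1, H.ortho (show k+1 ≠ k by omega), H.D_diag]
      have : jbm α β c k * jl α β c k (pp α β c (k-1)) = 0 := by
        cases k with
        | zero => simp [jbm]
        | succ k => rw [H.ortho (by omega), mul_zero]
      rw [mul_assoc _ (jbm α β c k), this]; ring
    obtain ⟨m, rfl⟩ : ∃ m, n = m + 1 := ⟨n-1, by omega⟩
    rw [H.ortho (show m+1+1 ≠ k by omega), H.ortho (show m+1 ≠ k by omega)]
    simp only [jbm, Nat.add_sub_cancel]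
    rcases (Nat.lt_succ_iff.mp hk).eq_or_lt with rfl | hk
    · rw [H.norm1, H.D_down]; push_cast; ring
    rw [H.ortho (show m ≠ k by omega), H.D_low (by omega)]
    ring

lemma D_X (p : ℝ[X]) : jD (X * p) = X * jD p + (p - X * (X * p)) := by
  unfold jD; rw [derivative_mul, derivative_X]; ring

lemma D_recur (H : JH α β c) (n : ℕ) : C (jb α β c n) * jD (pp α β c (n+1)) + C (ja α β c n) * jD (pp α β c n)
    + C (jbm α β c n) * jD (pp α β c (n-1)) = X * jD (pp α β c n) + (pp α β c n - X * (X * pp α β c n)) := by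
  rw [← D_X, H.recur n]
  unfold jD
  simp only [derivative_add, derivative_C_mul]
  ring

lemma rel_a (H : JH α β c) (n : ℕ) :
    ((n:ℝ)+1+(α+β+1)/2+3/2) * ja α β c (n+2) = ((n:ℝ)+1+(α+β+1)/2-1/2) * ja α β c (n+1) := by
  have h := congrArg (jl α β c (n+2)) (H.D_recur (n+1))
  simp only [H.ladd, H.lsub, H.lC, H.lX (n+2), H.D_diag, H.D_up, jbm, Nat.add_sub_cancel,
    show n+1+1 = n+2 by rfl, show n+2-1 = n+1 by omega, H.D_far (show n+1 < n+2 by omega),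
    H.D_far (show n+1+1 < n+2+1 by omega)] at h
  have e1 : jl α β c (n+2) (pp α β c (n+1)) = 0 := H.ortho (by omega)
  have e2 : jl α β c (n+2+1) (pp α β c (n+1)) = 0 := H.ortho (by omega)
  have e3 : jl α β c (n+1) (X * pp α β c (n+1)) = ja α β c (n+1) := rfl
  have e4 : jl α β c (n+2) (X * pp α β c (n+1)) = jb α β c (n+1) := rfl
  have e5 : jl α β c (n+2+1) (X * pp α β c (n+1)) = 0 := H.orth (degLT' (H.natDegX _) (by omega))
  have e6 : jl α β c (n+2) (jD (pp α β c (n+1))) = -((n+1:ℕ):ℝ) * jb α β c (n+1) := H.D_up (n+1)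
  simp only [e1, e2, e5, H.norm1, e3] at h
  have hb := (H.jb_pos (n+1)).ne'
  unfold jB at h
  push_cast at h
  have : jb α β c (n+1) * (((n:ℝ)+1+(α+β+1)/2+3/2) * ja α β c (n+2) - ((n:ℝ)+1+(α+β+1)/2-1/2) * ja α β c (n+1)) = 0 := by
    linear_combination h
  have := (mul_eq_zero.mp this).resolve_left hb
  linarith

lemma rel_b (H : JH α β c) (n : ℕ) :
    (2*((n:ℝ)+1+(α+β+1)/2)+2) * jb α β c (n+1)^2 - (2*((n:ℝ)+1+(α+β+1)/2)-2) * jb α β c n^2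
      = 1 - ja α β c (n+1)^2 := by
  have h := congrArg (jl α β c (n+1)) (H.D_recur (n+1))
  simp only [H.ladd, H.lsub, H.lC, H.lX (n+1), H.D_diag, H.D_up, H.D_down, jbm, Nat.add_sub_cancel,
    H.norm1] at h
  have e3 : jl α β c (n+1) (X * pp α β c (n+1)) = ja α β c (n+1) := rfl
  have e4 : jl α β c (n+1+1) (X * pp α β c (n+1)) = jb α β c (n+1) := rfl
  have e5 : jl α β c n (X * pp α β c (n+1)) = jb α β c n := by rw [H.symmX]; rfl
  have e1 : jl α β c (n+1+1) (pp α β c (n+1)) = 0 := H.ortho (by omega)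
  have e2 : jl α β c n (pp α β c (n+1)) = 0 := H.ortho (by omega)
  simp only [e1, e2, e4, e5] at h
  push_cast at h
  linear_combination h

lemma eigen (H : JH α β c) (n : ℕ) : ibpOp α β (derivative (pp α β c n)) = C (-(n:ℝ) * (n+α+β+1)) * pp α β c n := by
  have nd : ∀ m, (ibpOp α β (derivative (pp α β c m))).natDegree ≤ m := by
    intro m
    unfold ibpOp
    cases m with
    | zero =>
      rw [eq_C_of_natDegree_le_zero (H.natDeg 0)]; simp
    | succ m =>
      have h1 : (derivative (pp α β c (m+1))).natDegree ≤ m := (natDegree_derivative_le _).trans (by have := H.natDeg (m+1); omega)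
      refine natDegree_add_le_of_degree_le ?_ ?_
      · exact natDegD m _ h1
      · have h2 : (C (β-α) - C (α+β+2) * X).natDegree ≤ 1 := by compute_degree
        exact (natDegree_mul_le_of_le h2 h1).trans (by omega)
  have sy : ∀ p s : ℝ[X], jL α β (ibpOp α β (derivative p) * s) = jL α β (ibpOp α β (derivative s) * p) := by
    intro p s
    have h1 := jL_ibp H.hα H.hβ (derivative p * s)
    have h2 := jL_ibp H.hα H.hβ (derivative s * p)
    have e1 : ibpOp α β (derivative p * s) = ibpOp α β (derivative p) * s + (1-X^2)*(derivative p * derivative s) := by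
      unfold ibpOp; rw [derivative_mul]; ring
    have e2 : ibpOp α β (derivative s * p) = ibpOp α β (derivative s) * p + (1-X^2)*(derivative p * derivative s) := by
      unfold ibpOp; rw [derivative_mul]; ring
    rw [e1, jL_add H.hα H.hβ] at h1
    rw [e2, jL_add H.hα H.hβ] at h2
    linarith
  rw [← sub_eq_zero]
  have hnd : (ibpOp α β (derivative (pp α β c n)) - C (-(n:ℝ) * (n+α+β+1)) * pp α β c n).natDegree ≤ n :=
    ndSub (nd n) ((natDegree_C_mul_le _ _).trans (H.natDeg n))
  apply H.zero n _ hnd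
  intro k hk
  rcases hk.eq_or_lt with rfl | hk
  · apply H.orth
    apply degLT hnd
    rw [coeff_sub, coeff_C_mul]
    unfold ibpOp
    cases k with
    | zero => rw [eq_C_of_natDegree_le_zero (H.natDeg 0)]; simp
    | succ k =>
      have h1 : (derivative (pp α β c (k+1))).natDegree ≤ k := (natDegree_derivative_le _).trans (by have := H.natDeg (k+1); omega)
      have h2 := coeffD k _ h1
      unfold jD at h2
      rw [coeff_add, h2, sub_mul, coeff_sub, coeff_C_mul, mul_assoc, coeff_C_mul, coeff_X_mul,
        coeff_eq_zero_of_natDegree_lt (n := k+1) (lt_of_le_of_lt h1 (Nat.lt_succ_self k)), coeff_derivative]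
      push_cast; ring
  · rw [H.lsub, H.lC, H.ortho hk.ne']
    unfold jl
    rw [sy]
    change jl α β c n _ - _ = _
    rw [H.orth (degLT' (nd k) hk)]; ring

end JH

end

section
open Polynomial Topology

namespace JH
variable {α β : ℝ} {c : ℕ → ℝ}

lemma ja_bound (H : JH α β c) : ∃ C : ℝ, 0 < C ∧ ∀ n : ℕ, |ja α β c n| ≤ C / ((n:ℝ)+1)^2 := by
  set T := (α+β+1)/2 with hT
  have hT' : -1/2 < T := by have := H.hα; have := H.hβ; rw [hT]; linarith
  have hconst : ∀ n : ℕ, ((n+1+T)^2-1/4) * ja α β c (n+1) = ((1+T)^2-1/4) * ja α β c 1 := by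
    intro n
    induction n with
    | zero => simp
    | succ n ih =>
      rw [← ih]
      have := H.rel_a n
      push_cast
      linear_combination ((n:ℝ)+1+T+1/2) * this
  set K := ((1+T)^2-1/4) * ja α β c 1 with hK
  set d := min (T+1/2) 1 with hd
  have hd0 : 0 < d := lt_min (by linarith) one_pos
  have hd1 : d ≤ 1 := min_le_right _ _
  have hd2 : d ≤ T+1/2 := min_le_left _ _
  refine ⟨|ja α β c 0| + 4*|K|/d + 1, by positivity, ?_⟩
  intro n
  cases n with
  | zero =>
    simp
    have : 0 ≤ 4*|K|/d := by positivity
    linarith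
  | succ n =>
    have h0 : (0:ℝ) ≤ n := Nat.cast_nonneg n
    have h1 : d/4 * ((n:ℝ)+2)^2 ≤ (n+1+T)^2-1/4 := by
      have e : ((n:ℝ)+1+T)^2-1/4 = (n+(T+1/2)) * (n+1+(T+1/2)) := by ring
      rw [e]
      have a1 : d * ((n:ℝ)+2)/2 ≤ n+(T+1/2) := by nlinarith
      have a2 : ((n:ℝ)+2)/2 ≤ n+1+(T+1/2) := by linarith
      calc d/4 * ((n:ℝ)+2)^2 = (d * ((n:ℝ)+2)/2) * (((n:ℝ)+2)/2) := by ring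
        _ ≤ _ := mul_le_mul a1 a2 (by positivity) (by linarith)
    have h2 : 0 < d/4 * ((n:ℝ)+2)^2 := by positivity
    have h3 : |ja α β c (n+1)| * (d/4 * ((n:ℝ)+2)^2) ≤ |K| := by
      rw [← hconst n, abs_mul, mul_comm, abs_of_pos (lt_of_lt_of_le h2 h1)]
      exact mul_le_mul_of_nonneg_right h1 (abs_nonneg _)
    push_cast
    rw [le_div_iff₀ (by positivity)]
    have h4 : |ja α β c (n+1)| * ((n:ℝ)+2)^2 ≤ 4*|K|/d := by
      rw [le_div_iff₀ hd0]; linarith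
    have : 0 ≤ |ja α β c 0| := abs_nonneg _
    rw [show (n:ℝ)+1+1 = n+2 by ring]
    linarith

lemma jb_bound (H : JH α β c) : ∃ C : ℝ, 0 < C ∧ ∀ n : ℕ, |jb α β c n - 1/2| ≤ C / ((n:ℝ)+1)^2 := by
  obtain ⟨A, hA, ha⟩ := H.ja_bound
  set T := (α+β+1)/2 with hT
  have hT' : -1/2 < T := by have := H.hα; have := H.hβ; rw [hT]; linarith
  set Y : ℕ → ℝ := fun n => (n+T)*(n+T+1)*(jb α β c n^2-1/4) with hY
  have hdiff : ∀ n : ℕ, |Y (n+1) - Y n| ≤ (1+|T|)*A^2 * (1/((n:ℝ)+1) - 1/((n:ℝ)+2)) := by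
    intro n
    have h0 : (0:ℝ) ≤ n := Nat.cast_nonneg n
    have e : Y (n+1) - Y n = -((n:ℝ)+1+T)*ja α β c (n+1)^2/2 := by
      have := H.rel_b n
      simp only [hY]; push_cast
      linear_combination ((n:ℝ)+1+T)/2 * this
    have a1 := ha (n+1)
    push_cast at a1
    rw [show (n:ℝ)+1+1 = n+2 by ring] at a1
    have a2 : ja α β c (n+1)^2 ≤ (A/((n:ℝ)+2)^2)^2 := by rw [← sq_abs]; gcongr
    have a3 : |(n:ℝ)+1+T| ≤ (1+|T|) * (n+2) := by
      have := abs_nonneg T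
      calc |(n:ℝ)+1+T| ≤ |(n:ℝ)+1| + |T| := abs_add_le _ _
        _ = n+1+|T| := by rw [abs_of_nonneg (by positivity)]
        _ ≤ _ := by nlinarith
    rw [e, abs_div, abs_mul, abs_neg, abs_of_nonneg (sq_nonneg (ja α β c (n+1)))]
    have e2 : 1/((n:ℝ)+1) - 1/((n:ℝ)+2) = 1/(((n:ℝ)+1)*(n+2)) := by field_simp; ring
    rw [e2]
    have hh : |(2:ℝ)| = 2 := abs_two
    calc |(n:ℝ)+1+T| * ja α β c (n+1)^2/|2| ≤ (1+|T|) * (n+2) * (A/((n:ℝ)+2)^2)^2/1 := by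
          rw [hh]; gcongr; norm_num
      _ = (1+|T|) * A^2 * (1/((n:ℝ)+2)^3) := by field_simp
      _ ≤ _ := by
        gcongr
        nlinarith [sq_nonneg (n:ℝ)]
  set E := (1+|T|)*A^2 with hE
  have hE0 : 0 ≤ E := by positivity
  have hYb : ∀ n : ℕ, |Y n| ≤ |Y 0| + E*(1-1/((n:ℝ)+1)) := by
    intro n
    induction n with
    | zero => simp
    | succ n ih =>
      have := hdiff n
      have h2 : |Y (n+1)| ≤ |Y n| + |Y (n+1) - Y n| := by
        have := abs_add_le (Y n) (Y (n+1) - Y n); simpa using this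
      push_cast
      rw [show (n:ℝ)+1+1 = n+2 by ring]
      linarith
  set G := |Y 0| + E with hG
  have hYG : ∀ n, |Y n| ≤ G := by
    intro n
    have := hYb n
    have h2 : 0 ≤ E * (1/((n:ℝ)+1)) := by positivity
    linarith
  refine ⟨|jb α β c 0 - 1/2| + 16*G + 1, by positivity, ?_⟩
  have hG0 : 0 ≤ G := by positivity
  intro n
  cases n with
  | zero => simp; norm_num at *; linarith
  | succ n =>
    have h0 : (0:ℝ) ≤ n := Nat.cast_nonneg n
    have hb := H.jb_pos (n+1)
    have h1 : (1/8) * ((n:ℝ)+2)^2 ≤ (n+1+T)*(n+1+T+1) := by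
      calc (1/8) * ((n:ℝ)+2)^2 = (((n:ℝ)+2)/4) * (((n:ℝ)+2)/2) := by ring
        _ ≤ _ := mul_le_mul (by linarith) (by linarith) (by positivity) (by linarith)
    have h2 : |jb α β c (n+1)^2 - 1/4| * ((1/8) * ((n:ℝ)+2)^2) ≤ G := by
      have := hYG (n+1)
      simp only [hY] at this
      rw [abs_mul] at this
      push_cast at this
      rw [abs_of_pos (lt_of_lt_of_le (by positivity) h1)] at this
      refine le_trans ?_ this
      rw [mul_comm]
      exact mul_le_mul_of_nonneg_right h1 (abs_nonneg _)
    have h3 : |jb α β c (n+1) - 1/2| ≤ 2*|jb α β c (n+1)^2 - 1/4| := by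
      have e : jb α β c (n+1)^2 - 1/4 = (jb α β c (n+1) - 1/2)*(jb α β c (n+1) + 1/2) := by ring
      rw [e, abs_mul, abs_of_pos (show 0 < jb α β c (n+1) + 1/2 by linarith)]
      nlinarith [abs_nonneg (jb α β c (n+1) - 1/2)]
    push_cast
    rw [show (n:ℝ)+1+1 = n+2 by ring, le_div_iff₀ (by positivity)]
    have h4 := mul_le_mul_of_nonneg_right h3 (show 0 ≤ ((n:ℝ)+2)^2 by positivity)
    have := abs_nonneg (jb α β c 0 - 1/2)
    nlinarith

lemma jb_lower (H : JH α β c) : ∃ b0 : ℝ, 0 < b0 ∧ ∀ n : ℕ, b0 ≤ jb α β c n := by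
  obtain ⟨C, hC, hb⟩ := H.jb_bound
  have hlim : Tendsto (fun n => jb α β c n) atTop (𝓝 (1/2)) := by
    rw [tendsto_iff_norm_sub_tendsto_zero]
    refine squeeze_zero (fun _ => norm_nonneg _) hb ?_
    have h1 : Tendsto (fun n : ℕ => 1/((n:ℝ)+1)) atTop (𝓝 0) := tendsto_one_div_add_atTop_nhds_zero_nat
    have h2 := (h1.mul h1).const_mul C
    simp only [mul_zero] at h2
    refine h2.congr (fun n => ?_)
    field_simp
  have h2 := hlim.inv₀ (by norm_num)
  obtain ⟨M, hM⟩ := h2.bddAbove_range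
  have hM' : ∀ n, (jb α β c n)⁻¹ ≤ M := fun n => hM ⟨n, rfl⟩
  have hM0 : 0 < M := lt_of_lt_of_le (inv_pos.mpr (H.jb_pos 0)) (hM' 0)
  exact ⟨M⁻¹, inv_pos.mpr hM0, fun n => inv_le_of_inv_le₀ (H.jb_pos n) (hM' n)⟩

/-- combined bounds -/
lemma coef_bounds (H : JH α β c) : ∃ C : ℝ, 1 ≤ C ∧ (∀ n : ℕ, |ja α β c n| ≤ C / ((n:ℝ)+1)^2) ∧
    (∀ n : ℕ, |1 - 2 * jb α β c n| ≤ C / ((n:ℝ)+1)^2) ∧ (∀ n : ℕ, 1/C ≤ jb α β c n) ∧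
    (∀ n, jb α β c n ≤ C) := by
  obtain ⟨A, hA, ha⟩ := H.ja_bound
  obtain ⟨B, hB, hb⟩ := H.jb_bound
  obtain ⟨b0, hb0, hl⟩ := H.jb_lower
  refine ⟨1 + A + 2*B + 1/b0, ?_, ?_, ?_, ?_, ?_⟩
  · have : 0 < 1/b0 := by positivity
    linarith
  · intro n
    refine (ha n).trans ?_
    have : 0 < 1/b0 := by positivity
    gcongr; linarith
  · intro n
    have h := hb n
    have e : 1 - 2 * jb α β c n = -2 * (jb α β c n - 1/2) := by ring
    rw [e, abs_mul, show |(-2:ℝ)| = 2 by norm_num]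
    calc 2 * |jb α β c n - 1/2| ≤ 2 * (B/((n:ℝ)+1)^2) := by gcongr
      _ = (2*B)/((n:ℝ)+1)^2 := by ring
      _ ≤ _ := by
        have : 0 < 1/b0 := by positivity
        gcongr; linarith
  · intro n
    refine le_trans ?_ (hl n)
    rw [div_le_iff₀ (by positivity)]
    have : b0 * (1/b0) = 1 := by field_simp
    nlinarith
  · intro n
    have h := hb n
    have h3 : B/((n:ℝ)+1)^2 ≤ B := by
      apply div_le_self hB.le
      have : (0:ℝ) ≤ n := Nat.cast_nonneg n
      nlinarith
    have := (abs_le.mp h).2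
    have : 0 < 1/b0 := by positivity
    linarith
end JH

end

section
open Polynomial Topology

/-- sequences of functions of size `O((n+1)^k)` uniformly on `S` -/
def Od (S : Set ℝ) (k : ℤ) (u : ℝ → ℕ → ℝ) : Prop :=
  ∃ C : ℝ, 0 ≤ C ∧ ∀ θ ∈ S, ∀ n : ℕ, |u θ n| ≤ C * ((n:ℝ)+1)^k

namespace Od
variable {S : Set ℝ} {k l : ℤ} {u v : ℝ → ℕ → ℝ}

lemma congr (h : Od S k u) (e : ∀ θ ∈ S, ∀ n, v θ n = u θ n) : Od S k v := by
  obtain ⟨C, hC, h⟩ := h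
  exact ⟨C, hC, fun θ hθ n => by rw [e θ hθ n]; exact h θ hθ n⟩

lemma of_le (h : Od S k u) (e : ∀ θ ∈ S, ∀ n, |v θ n| ≤ |u θ n|) : Od S k v := by
  obtain ⟨C, hC, h⟩ := h
  exact ⟨C, hC, fun θ hθ n => (e θ hθ n).trans (h θ hθ n)⟩

lemma add (hu : Od S k u) (hv : Od S k v) : Od S k (fun θ n => u θ n + v θ n) := by
  obtain ⟨C, hC, h⟩ := hu
  obtain ⟨D, hD, h'⟩ := hv
  refine ⟨C+D, by positivity, fun θ hθ n => (abs_add_le _ _).trans ?_⟩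
  rw [add_mul]; exact add_le_add (h θ hθ n) (h' θ hθ n)

lemma neg (hu : Od S k u) : Od S k (fun θ n => - u θ n) := by
  obtain ⟨C, hC, h⟩ := hu
  exact ⟨C, hC, fun θ hθ n => by rw [abs_neg]; exact h θ hθ n⟩

lemma sub (hu : Od S k u) (hv : Od S k v) : Od S k (fun θ n => u θ n - v θ n) :=
  (hu.add hv.neg).congr (fun _ _ _ => sub_eq_add_neg _ _)

lemma mul (hu : Od S k u) (hv : Od S l v) : Od S (k+l) (fun θ n => u θ n * v θ n) := by
  obtain ⟨C, hC, h⟩ := hu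
  obtain ⟨D, hD, h'⟩ := hv
  refine ⟨C*D, by positivity, fun θ hθ n => ?_⟩
  have hn : (0:ℝ) < (n:ℝ)+1 := by positivity
  rw [abs_mul, zpow_add₀ hn.ne']
  calc _ ≤ (C * ((n:ℝ)+1)^k) * (D * ((n:ℝ)+1)^l) :=
        mul_le_mul (h θ hθ n) (h' θ hθ n) (abs_nonneg _) (by positivity)
    _ = _ := by ring

lemma mono (hu : Od S k u) (h : k ≤ l) : Od S l u := by
  obtain ⟨C, hC, h'⟩ := hu
  refine ⟨C, hC, fun θ hθ n => (h' θ hθ n).trans ?_⟩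
  have hn : (1:ℝ) ≤ (n:ℝ)+1 := by have : (0:ℝ) ≤ n := Nat.cast_nonneg n; linarith
  exact mul_le_mul_of_nonneg_left (zpow_le_zpow_right₀ hn h) hC

lemma bdd (g : ℝ → ℝ) (M : ℝ) (h : ∀ θ ∈ S, |g θ| ≤ M) : Od S 0 (fun θ _ => g θ) :=
  ⟨|M|, abs_nonneg _, fun θ hθ n => by simpa using (h θ hθ).trans (le_abs_self M)⟩

lemma const (a : ℝ) : Od S 0 (fun _ _ => a) := bdd _ |a| (fun _ _ => le_rfl)

lemma bmul (hu : Od S k u) (g : ℝ → ℝ) (M : ℝ) (h : ∀ θ ∈ S, |g θ| ≤ M) : Od S k (fun θ n => g θ * u θ n) :=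
  by simpa using (bdd g M h).mul hu

lemma cmul (hu : Od S k u) (a : ℝ) : Od S k (fun θ n => a * u θ n) :=
  bmul hu (fun _ => a) |a| (fun _ _ => le_rfl)

lemma nat : Od S 1 (fun _ n => (n:ℝ)) :=
  ⟨1, zero_le_one, fun θ _ n => by simp⟩

lemma seq {a : ℕ → ℝ} {C : ℝ} (h : ∀ n : ℕ, |a n| ≤ C * ((n:ℝ)+1)^k) : Od S k (fun _ n => a n) := by
  refine ⟨|C|, abs_nonneg _, fun θ _ n => (h n).trans ?_⟩
  have hn : (0:ℝ) < (n:ℝ)+1 := by positivity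
  exact mul_le_mul_of_nonneg_right (le_abs_self C) (by positivity)

lemma pow (hu : Od S k u) (j : ℕ) : Od S (j*k) (fun θ n => u θ n ^ j) := by
  induction j with
  | zero => simpa using const (S := S) 1
  | succ j ih => 
    have := ih.mul hu
    simp only [pow_succ]
    convert this using 1
    push_cast; ring

lemma comp (hu : Od S k u) (f : ℕ → ℕ) (h1 : ∀ n, f n + 1 ≤ 2*(n+1)) (h2 : ∀ n, n + 1 ≤ 2*(f n+1)) :
    Od S k (fun θ n => u θ (f n)) := by
  obtain ⟨C, hC, h⟩ := hu
  refine ⟨C * 2^(k.natAbs), by positivity, fun θ hθ n => (h θ hθ (f n)).trans ?_⟩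
  have hn : (0:ℝ) < (n:ℝ)+1 := by positivity
  have hn' : (0:ℝ) < (f n:ℝ)+1 := by positivity
  have h1' : (f n:ℝ)+1 ≤ 2 * ((n:ℝ)+1) := by exact_mod_cast h1 n
  have h2' : (n:ℝ)+1 ≤ 2 * ((f n:ℝ)+1) := by exact_mod_cast h2 n
  rw [mul_assoc]
  apply mul_le_mul_of_nonneg_left _ hC
  rcases Int.natAbs_eq k with e | e
  · rw [e]
    simp only [Int.natAbs_natCast, zpow_natCast]
    rw [← mul_pow]
    gcongr
  · rw [e]
    simp only [Int.natAbs_neg, Int.natAbs_natCast, zpow_neg, zpow_natCast]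
    rw [inv_le_iff_one_le_mul₀ (by positivity), mul_comm, ← mul_assoc, ← div_eq_mul_inv, le_div_iff₀ (by positivity), one_mul,
      ← mul_pow]
    gcongr
    linarith

lemma up (hu : Od S k u) : Od S k (fun θ n => u θ (n+1)) := hu.comp (fun n => n+1) (by intro n; omega) (by intro n; omega)
lemma down (hu : Od S k u) : Od S k (fun θ n => u θ (n-1)) := hu.comp (fun n => n-1) (by intro n; omega) (by intro n; omega)

lemma sum {ι : Type*} (s : Finset ι) (w : ι → ℝ → ℕ → ℝ) (h : ∀ i ∈ s, Od S k (w i)) :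
    Od S k (fun θ n => ∑ i ∈ s, w i θ n) := by
  induction s using Finset.induction_on with
  | empty => exact ⟨0, le_rfl, fun θ _ n => by simp⟩
  | insert a s ha ih =>
    have h1 := h a (Finset.mem_insert_self a s)
    have h2 := ih (fun i hi => h i (Finset.mem_insert_of_mem hi))
    exact (h1.add h2).congr (fun θ _ n => Finset.sum_insert ha)

lemma powdiff (j : ℕ) : Od S (j-1) (fun _ n => ((n:ℝ)+1)^j - (n:ℝ)^j) := by
  induction j with
  | zero => exact ⟨0, le_rfl, fun θ _ n => by simp⟩
  | succ j ih =>
    have h1 : Od S j (fun _ n => (n:ℝ)^j) := by simpa using (nat (S := S)).pow j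
    have h2 : Od S 1 (fun _ n => (n:ℝ)+1) := nat.add ((const 1).mono (by norm_num))
    have h3 := (h2.mul ih).mono (show 1 + ((j:ℤ)-1) ≤ j by linarith)
    have := h3.add h1
    push_cast
    rw [add_sub_cancel_right]
    exact this.congr (fun θ _ n => by ring)

lemma powdiff_down (j : ℕ) : Od S (j-1) (fun _ n => (((n-1:ℕ):ℝ))^j - (n:ℝ)^j) := by
  refine (powdiff (S := S) j).down.of_le (fun θ _ n => ?_)
  cases n with
  | zero => simp
  | succ m =>
    simp only [Nat.add_sub_cancel]; push_cast
    rw [abs_sub_comm]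
end Od

/-- previous polynomial, zero at index zero -/
def Pm (α β : ℝ) (c : ℕ → ℝ) : ℕ → ℝ → ℝ
  | 0, _ => 0
  | (n+1), θ => nJacobi α β c n θ

/-- Defect in the Chebyshev recurrence -/
def rho (α β : ℝ) (c : ℕ → ℝ) (n : ℕ) (θ : ℝ) : ℝ :=
  nJacobi α β c (n+1) θ - 2 * Real.cos θ * nJacobi α β c n θ + Pm α β c n θ

/-- region with sine bounded below -/
def sS (σ : ℝ) : Set ℝ := {θ | σ ≤ Real.sin θ}

/-- unit complex number -/
def jz (θ : ℝ) : ℂ := Complex.exp (θ * Complex.I)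

lemma jz_ne (θ : ℝ) : jz θ ≠ 0 := Complex.exp_ne_zero _
lemma jz_norm (θ : ℝ) : ‖jz θ‖ = 1 := Complex.norm_exp_ofReal_mul_I θ
lemma jz_inv (θ : ℝ) : (jz θ)⁻¹ = Complex.exp (-(θ * Complex.I)) := by unfold jz; rw [Complex.exp_neg]
lemma jz_eq (θ : ℝ) : jz θ = Real.cos θ + Real.sin θ * Complex.I := by
  unfold jz; rw [Complex.exp_mul_I]; push_cast; rfl
lemma jz_inv_eq (θ : ℝ) : (jz θ)⁻¹ = Real.cos θ - Real.sin θ * Complex.I := by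
  rw [jz_inv, ← neg_mul, Complex.exp_mul_I]; simp; ring
lemma jz_add_inv (θ : ℝ) : jz θ + (jz θ)⁻¹ = 2 * Real.cos θ := by
  rw [jz_inv_eq, jz_eq]; ring

/-- the sequence converging to the amplitude -/
def jeta (α β : ℝ) (c : ℕ → ℝ) (n : ℕ) (θ : ℝ) : ℂ :=
  (jz θ)^n * (nJacobi α β c (n+1) θ - jz θ * nJacobi α β c n θ)

lemma eta_succ (α β : ℝ) (c : ℕ → ℝ) (n : ℕ) (θ : ℝ) :
    jeta α β c (n+1) θ = jeta α β c n θ + (jz θ)^(n+1) * rho α β c (n+1) θ := by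
  unfold jeta rho Pm
  have h := jz_add_inv θ
  have h2 : (jz θ) * (jz θ)⁻¹ = 1 := mul_inv_cancel₀ (jz_ne θ)
  push_cast
  rw [← Complex.ofReal_cos] 
  linear_combination (-(jz θ)^(n+1) * nJacobi α β c (n+1) θ) * h + ((jz θ)^n * nJacobi α β c (n+1) θ) * h2 

lemma P_le_eta (α β : ℝ) (c : ℕ → ℝ) (n : ℕ) (θ : ℝ) :
    Real.sin θ * |nJacobi α β c n θ| ≤ ‖jeta α β c n θ‖ ∧ Real.sin θ * |nJacobi α β c (n+1) θ| ≤ ‖jeta α β c n θ‖ := by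
  have h0 : ‖jeta α β c n θ‖ = ‖(nJacobi α β c (n+1) θ - jz θ * nJacobi α β c n θ : ℂ)‖ := by
    unfold jeta; rw [norm_mul, norm_pow, jz_norm, one_pow, one_mul]
  constructor
  · rw [h0]
    have h1 : (nJacobi α β c (n+1) θ - jz θ * nJacobi α β c n θ : ℂ).im = - (Real.sin θ * nJacobi α β c n θ) := by
      rw [jz_eq]; simp [-Complex.ofReal_sin, -Complex.ofReal_cos]
    calc _ ≤ |Real.sin θ * nJacobi α β c n θ| := by
          rw [abs_mul]; exact mul_le_mul_of_nonneg_right (le_abs_self _) (abs_nonneg _)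
      _ = |(nJacobi α β c (n+1) θ - jz θ * nJacobi α β c n θ : ℂ).im| := by rw [h1, abs_neg]
      _ ≤ _ := Complex.abs_im_le_norm _
  · have h2 : ‖jeta α β c n θ‖ = ‖((jz θ)⁻¹ * nJacobi α β c (n+1) θ - nJacobi α β c n θ : ℂ)‖ := by
      rw [h0, ← one_mul ‖((jz θ)⁻¹ * nJacobi α β c (n+1) θ - nJacobi α β c n θ : ℂ)‖, ← jz_norm θ, ← norm_mul]
      congr 1
      rw [mul_sub, ← mul_assoc, mul_inv_cancel₀ (jz_ne θ), one_mul]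
    rw [h2]
    have h1 : ((jz θ)⁻¹ * nJacobi α β c (n+1) θ - nJacobi α β c n θ : ℂ).im = - (Real.sin θ * nJacobi α β c (n+1) θ) := by
      rw [jz_inv_eq]; simp [-Complex.ofReal_sin, -Complex.ofReal_cos]
    calc _ ≤ |Real.sin θ * nJacobi α β c (n+1) θ| := by
          rw [abs_mul]; exact mul_le_mul_of_nonneg_right (le_abs_self _) (abs_nonneg _)
      _ = |((jz θ)⁻¹ * nJacobi α β c (n+1) θ - nJacobi α β c n θ : ℂ).im| := by rw [h1, abs_neg]
      _ ≤ _ := Complex.abs_im_le_norm _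

/-- auxiliary sequence -/
def jg (α β : ℝ) (c : ℕ → ℝ) : ℕ → ℝ
  | 0 => 0
  | (n+1) => 1 - 2 * jb α β c n

namespace JH
variable {α β : ℝ} {c : ℕ → ℝ}

lemma recurP (H : JH α β c) (n : ℕ) (θ : ℝ) : Real.cos θ * nJacobi α β c n θ =
    jb α β c n * nJacobi α β c (n+1) θ + ja α β c n * nJacobi α β c n θ + jbm α β c n * nJacobi α β c (n-1) θ := by
  have h := congrArg (fun p => p.eval (Real.cos θ)) (H.recur n)
  simpa only [eval_mul, eval_add, eval_X, eval_C, pp_eval] using h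

lemma rho_eq (H : JH α β c) (n : ℕ) (θ : ℝ) : rho α β c n θ = (1 - 2 * jb α β c n) * nJacobi α β c (n+1) θ
    - 2 * ja α β c n * nJacobi α β c n θ + jg α β c n * nJacobi α β c (n-1) θ := by
  have h := H.recurP n θ
  cases n with
  | zero =>
    simp only [rho, Pm, jg, jbm] at *
    linear_combination (-2) * h
  | succ n =>
    simp only [rho, Pm, jg, jbm, Nat.add_sub_cancel] at *
    linear_combination (-2) * h

lemma od_a (H : JH α β c) (S : Set ℝ) : Od S (-2) (fun _ n => ja α β c n) := by
  obtain ⟨C, -, h, -⟩ := H.coef_bounds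
  exact Od.seq (C := C) (fun n => by simpa [zpow_neg, div_eq_mul_inv] using h n)

lemma od_b1 (H : JH α β c) (S : Set ℝ) : Od S (-2) (fun _ n => 1 - 2 * jb α β c n) := by
  obtain ⟨C, -, -, h, -⟩ := H.coef_bounds
  exact Od.seq (C := C) (fun n => by simpa [zpow_neg, div_eq_mul_inv] using h n)

lemma od_g (H : JH α β c) (S : Set ℝ) : Od S (-2) (fun _ n => jg α β c n) := by
  refine (H.od_b1 S).down.of_le (fun θ _ n => ?_)
  cases n with
  | zero => simp [jg]
  | succ n => simp [jg]

lemma od_bm1 (H : JH α β c) (S : Set ℝ) : Od S (-2) (fun _ n => 1 - 2 * jbm α β c n) := by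
  obtain ⟨C, hC, h⟩ := H.od_g S
  refine ⟨C+1, by positivity, fun θ hθ n => ?_⟩
  cases n with
  | zero => simp [jbm]; exact hC
  | succ n =>
    refine (h θ hθ (n+1)).trans ?_
    gcongr; linarith

lemma od_b (H : JH α β c) (S : Set ℝ) : Od S 0 (fun _ n => jb α β c n) := by
  have := ((Od.const (S := S) 1).sub ((H.od_b1 S).mono (by norm_num))).cmul (1/2)
  exact this.congr (fun θ _ n => by ring)

lemma od_bm (H : JH α β c) (S : Set ℝ) : Od S 0 (fun _ n => jbm α β c n) := by
  have := ((Od.const (S := S) 1).sub ((H.od_bm1 S).mono (by norm_num))).cmul (1/2)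
  exact this.congr (fun θ _ n => by ring)

lemma nJ_cont (α β : ℝ) (c : ℕ → ℝ) (n : ℕ) : Continuous (nJacobi α β c n) := by
  have := poly_cos_cont (pp α β c n)
  simpa only [pp_eval] using this

lemma nJ_bdd (α β : ℝ) (c : ℕ → ℝ) (n : ℕ) : ∃ M, 0 ≤ M ∧ ∀ θ, |nJacobi α β c n θ| ≤ M := by
  obtain ⟨M, hM⟩ := (isCompact_Icc (a := (-1:ℝ)) (b := 1)).exists_bound_of_continuousOn
      (pp α β c n).continuous.continuousOn
  refine ⟨|M|, abs_nonneg _, fun θ => ?_⟩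
  rw [← pp_eval]
  exact (hM _ ⟨Real.neg_one_le_cos θ, Real.cos_le_one θ⟩).trans (le_abs_self M)

lemma od_P (H : JH α β c) {σ : ℝ} (hσ : 0 < σ) : Od (sS σ) 0 (fun θ n => nJacobi α β c n θ) := by
  obtain ⟨A, hA, ha⟩ := H.od_a (sS σ)
  obtain ⟨B, hB, hb⟩ := H.od_b1 (sS σ)
  obtain ⟨G, hG, hg⟩ := H.od_g (sS σ)
  obtain ⟨C, hC1, haC, hb1C, hlC, huC⟩ := H.coef_bounds
  obtain ⟨M0, hM0, h0⟩ := nJ_bdd α β c 0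
  obtain ⟨M1, hM1, h1⟩ := nJ_bdd α β c 1
  have hC0 : 0 < C := by linarith
  set D := C * (1 + 2*C) * (2/σ) with hD
  have hD0 : 0 ≤ D := by positivity
  set K := B * D + 2*A*(1/σ) + G*(1/σ) with hK
  have hK0 : 0 ≤ K := by positivity
  have main : ∀ θ ∈ sS σ, ∀ n : ℕ, ‖jeta α β c n θ‖ ≤ (M0+M1) * Real.exp (K*(1 - 1/((n:ℝ)+1))) := by
    intro θ hθ n
    have hsin : σ ≤ Real.sin θ := hθ
    induction n with
    | zero =>
      simp only [jeta, pow_zero, one_mul, Nat.cast_zero, zero_add, div_one, sub_self, mul_zero, Real.exp_zero, mul_one]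
      calc _ ≤ ‖(nJacobi α β c 1 θ : ℂ)‖ + ‖jz θ * (nJacobi α β c 0 θ : ℂ)‖ := norm_sub_le _ _
        _ ≤ _ := by
          rw [norm_mul, jz_norm, Complex.norm_real, Complex.norm_real, one_mul, Real.norm_eq_abs, Real.norm_eq_abs]
          linarith [h0 θ, h1 θ]
    | succ n ih =>
      obtain ⟨q1, q2⟩ := P_le_eta α β c n θ
      set E := ‖jeta α β c n θ‖ with hE
      have hE0 : 0 ≤ E := norm_nonneg _
      have p1 : |nJacobi α β c n θ| ≤ (1/σ) * E := by
        rw [one_div, inv_mul_eq_div, le_div_iff₀ hσ]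
        nlinarith [abs_nonneg (nJacobi α β c n θ)]
      have p2 : |nJacobi α β c (n+1) θ| ≤ (1/σ) * E := by
        rw [one_div, inv_mul_eq_div, le_div_iff₀ hσ]
        nlinarith [abs_nonneg (nJacobi α β c (n+1) θ)]
      have p3 : |nJacobi α β c (n+2) θ| ≤ D * E := by
        have hr := H.recurP (n+1) θ
        simp only [jbm, Nat.add_sub_cancel] at hr
        have hbp := H.jb_pos (n+1)
        have e : jb α β c (n+1) * nJacobi α β c (n+2) θ = (Real.cos θ - ja α β c (n+1)) * nJacobi α β c (n+1) θ
            - jb α β c n * nJacobi α β c n θ := by linear_combination -hr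
        have e2 : jb α β c (n+1) * |nJacobi α β c (n+2) θ| ≤ (1+C) * ((1/σ)*E) + C * ((1/σ)*E) := by
          rw [← abs_of_pos hbp, ← abs_mul, e]
          refine (abs_sub _ _).trans ?_
          rw [abs_mul, abs_mul]
          have i1 : |Real.cos θ - ja α β c (n+1)| ≤ 1 + C := by
            refine (abs_sub _ _).trans (add_le_add (Real.abs_cos_le_one θ) ((haC (n+1)).trans ?_))
            apply div_le_self hC0.le
            have : (0:ℝ) ≤ ((n+1:ℕ):ℝ) := Nat.cast_nonneg _
            nlinarith
          have i2 : |jb α β c n| ≤ C := by rw [abs_of_pos (H.jb_pos n)]; exact huC n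
          gcongr
        have e3 : 1/C * |nJacobi α β c (n+2) θ| ≤ jb α β c (n+1) * |nJacobi α β c (n+2) θ| :=
          mul_le_mul_of_nonneg_right (hlC (n+1)) (abs_nonneg _)
        have e4 := e3.trans e2
        rw [one_div, inv_mul_eq_div, div_le_iff₀ hC0] at e4
        refine e4.trans ?_
        rw [hD]
        have : 0 ≤ C * (1/σ*E) := by positivity
        have e5 : C * (1 + 2*C) * (2/σ) * E = ((1+C) * ((1/σ)*E) + C * ((1/σ)*E)) * C + C * (1/σ*E) + 2*C*(C * (1/σ*E)) := by
          field_simp; ring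
        rw [e5]
        have : 0 ≤ 2*C*(C * (1/σ*E)) := by positivity
        linarith
      have hz : (((n+1:ℕ):ℝ)+1)^(-2:ℤ) = 1/((n:ℝ)+2)^2 := by
        rw [zpow_neg, show (2:ℤ) = ((2:ℕ):ℤ) by rfl, zpow_natCast]; push_cast; rw [one_div]; ring_nf
      have hrho : |rho α β c (n+1) θ| ≤ K * (1/((n:ℝ)+2)^2) * E := by
        rw [H.rho_eq]
        simp only [Nat.add_sub_cancel]
        have ha' := ha θ hθ (n+1)
        have hb' := hb θ hθ (n+1)
        have hg' := hg θ hθ (n+1)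
        rw [hz] at ha' hb' hg'
        calc _ ≤ |(1 - 2*jb α β c (n+1)) * nJacobi α β c (n+2) θ| + |2*ja α β c (n+1) * nJacobi α β c (n+1) θ|
              + |jg α β c (n+1) * nJacobi α β c n θ| :=
              (abs_add_le _ _).trans (add_le_add_left (abs_sub _ _) _)
          _ ≤ (B * (1/((n:ℝ)+2)^2)) * (D*E) + (2 * (A * (1/((n:ℝ)+2)^2))) * ((1/σ)*E)
              + (G * (1/((n:ℝ)+2)^2)) * ((1/σ)*E) := by
              rw [abs_mul, abs_mul, abs_mul, abs_mul, abs_two]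
              gcongr
          _ = _ := by rw [hK]; ring
      have h5 : 1/((n:ℝ)+2)^2 ≤ 1/((n:ℝ)+1) - 1/((n:ℝ)+2) := by
        have e2 : 1/((n:ℝ)+1) - 1/((n:ℝ)+2) = 1/(((n:ℝ)+1)*(n+2)) := by field_simp; ring
        rw [e2]; gcongr
        nlinarith [Nat.cast_nonneg (α := ℝ) n]
      calc ‖jeta α β c (n+1) θ‖ ≤ E + |rho α β c (n+1) θ| := by
            rw [eta_succ]
            refine (norm_add_le _ _).trans ?_
            rw [norm_mul, norm_pow, jz_norm, one_pow, one_mul, Complex.norm_real, Real.norm_eq_abs]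
        _ ≤ (1 + K * (1/((n:ℝ)+1) - 1/((n:ℝ)+2))) * E := by
            have : K * (1/((n:ℝ)+2)^2) * E ≤ K * (1/((n:ℝ)+1) - 1/((n:ℝ)+2)) * E := by gcongr
            linarith
        _ ≤ Real.exp (K * (1/((n:ℝ)+1) - 1/((n:ℝ)+2))) * ((M0+M1) * Real.exp (K*(1 - 1/((n:ℝ)+1)))) := by
            gcongr
            have := Real.add_one_le_exp (K * (1/((n:ℝ)+1) - 1/((n:ℝ)+2)))
            linarith
        _ = _ := by
            rw [mul_left_comm, ← Real.exp_add]
            congr 2; push_cast; ring_nf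
  refine ⟨(1/σ) * ((M0+M1) * Real.exp K), by positivity, fun θ hθ n => ?_⟩
  rw [zpow_zero, mul_one]
  have hsin : σ ≤ Real.sin θ := hθ
  have q1 := (P_le_eta α β c n θ).1
  have q2 := main θ hθ n
  have q3 : Real.exp (K*(1 - 1/((n:ℝ)+1))) ≤ Real.exp K := by
    apply Real.exp_le_exp.mpr
    have : 0 ≤ K * (1/((n:ℝ)+1)) := by positivity
    linarith
  have q4 : σ * |nJacobi α β c n θ| ≤ (M0+M1) * Real.exp K := by
    have := mul_le_mul_of_nonneg_left q3 (show 0 ≤ M0+M1 by positivity)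
    nlinarith [abs_nonneg (nJacobi α β c n θ)]
  rw [one_div, inv_mul_eq_div, le_div_iff₀ hσ]
  linarith

lemma od_rho (H : JH α β c) {σ : ℝ} (hσ : 0 < σ) : Od (sS σ) (-2) (fun θ n => rho α β c n θ) := by
  have hP := H.od_P hσ
  have h1 := (H.od_b1 _).mul hP.up
  have h2 := ((H.od_a _).mul hP).cmul 2
  have h3 := (H.od_g _).mul hP.down
  have := (h1.sub h2).add h3
  rw [add_zero] at this
  exact this.congr (fun θ _ n => by rw [H.rho_eq]; ring)

end JH

end

section
open Polynomial Topology

/-- iterated derivatives of the Jacobi functions -/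
def jv (α β : ℝ) (c : ℕ → ℝ) (j n : ℕ) (θ : ℝ) : ℝ := iteratedDeriv j (nJacobi α β c n) θ

lemma nJ_eq (α β : ℝ) (c : ℕ → ℝ) (n : ℕ) : nJacobi α β c n = fun θ => (pp α β c n).eval (Real.cos θ) := by
  funext θ; rw [pp_eval]

lemma nJ_smooth (α β : ℝ) (c : ℕ → ℝ) (n : ℕ) (k : WithTop ℕ∞) : ContDiff ℝ k (nJacobi α β c n) := by
  rw [nJ_eq]
  have h1 : ContDiff ℝ k (fun x : ℝ => (pp α β c n).eval x) := by
    simpa using (pp α β c n).contDiff_aeval (n := k) (𝕜 := ℝ) (R := ℝ)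
  exact h1.comp Real.contDiff_cos

lemma nJ_hasDeriv (α β : ℝ) (c : ℕ → ℝ) (n : ℕ) (θ : ℝ) :
    HasDerivAt (nJacobi α β c n) ((derivative (pp α β c n)).eval (Real.cos θ) * (-Real.sin θ)) θ := by
  rw [nJ_eq]
  exact ((pp α β c n).hasDerivAt (Real.cos θ)).comp θ (Real.hasDerivAt_cos θ)

lemma jv_zero (α β : ℝ) (c : ℕ → ℝ) (n : ℕ) (θ : ℝ) : jv α β c 0 n θ = nJacobi α β c n θ := by
  simp [jv]

lemma jv_hasDeriv (α β : ℝ) (c : ℕ → ℝ) (j n : ℕ) (θ : ℝ) :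
    HasDerivAt (jv α β c j n) (jv α β c (j+1) n θ) θ := by
  unfold jv
  rw [iteratedDeriv_succ]
  apply DifferentiableAt.hasDerivAt
  have h := (nJ_smooth α β c n (j+1)).differentiable_iteratedDeriv j (by exact_mod_cast Nat.lt_succ_self j)
  exact h θ

/-- asymptotic amplitude -/
def etaI (α β : ℝ) (c : ℕ → ℝ) (θ : ℝ) : ℂ :=
  (jz θ)⁻¹ * nJacobi α β c 0 θ + ∑' k : ℕ, (jz θ)^k * (rho α β c k θ : ℂ)

/-- the model sequence -/
def mm (α β : ℝ) (c : ℕ → ℝ) (j n : ℕ) (θ : ℝ) : ℝ :=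
  - ((-Complex.I)^j * ((jz θ)⁻¹^n * etaI α β c θ)).im / Real.sin θ

lemma eta_eq_sum (α β : ℝ) (c : ℕ → ℝ) (n : ℕ) (θ : ℝ) : jeta α β c n θ =
    (jz θ)⁻¹ * nJacobi α β c 0 θ + ∑ k ∈ Finset.range (n+1), (jz θ)^k * (rho α β c k θ : ℂ) := by
  induction n with
  | zero =>
    simp [jeta, rho, Pm]
    have := jz_add_inv θ
    push_cast at this
    linear_combination (-(nJacobi α β c 0 θ : ℂ)) * this
  | succ n ih => rw [eta_succ, ih, Finset.sum_range_succ _ (n+1)]; ring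

lemma mm_step (α β : ℝ) (c : ℕ → ℝ) (j n : ℕ) (θ : ℝ) (hs : Real.sin θ ≠ 0) :
    (n:ℝ) * (mm α β c j (n+1) θ - mm α β c j (n-1) θ) = 2 * n * Real.sin θ * mm α β c (j+1) n θ := by
  cases n with
  | zero => simp
  | succ n =>
    simp only [Nat.add_sub_cancel]
    have key : (-Complex.I)^j * ((jz θ)⁻¹^(n+1+1) * etaI α β c θ) - (-Complex.I)^j * ((jz θ)⁻¹^n * etaI α β c θ)
      = (2 * Real.sin θ : ℝ) * ((-Complex.I)^(j+1) * ((jz θ)⁻¹^(n+1) * etaI α β c θ)) := by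
      have h : (jz θ)⁻¹ * (jz θ)⁻¹ - 1 = 2 * Real.sin θ * (-Complex.I) * (jz θ)⁻¹ := by
        have h2 : (jz θ)⁻¹ * (jz θ) = 1 := inv_mul_cancel₀ (jz_ne θ)
        have h3 : (jz θ)⁻¹ - jz θ = 2 * Real.sin θ * (-Complex.I) := by rw [jz_inv_eq, jz_eq]; ring
        linear_combination (jz θ)⁻¹ * h3 + h2
      push_cast at h ⊢
      rw [pow_succ ((jz θ)⁻¹) (n+1), pow_succ ((jz θ)⁻¹) n, pow_succ (-Complex.I) j]
      linear_combination ((-Complex.I)^j * ((jz θ)⁻¹^n * etaI α β c θ)) * h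
    have k2 := congrArg Complex.im key
    rw [Complex.sub_im, Complex.im_ofReal_mul] at k2
    unfold mm
    generalize ((-Complex.I)^(j+1) * ((jz θ)⁻¹^(n+1) * etaI α β c θ)).im = A at *
    generalize ((-Complex.I)^j * ((jz θ)⁻¹^(n+1+1) * etaI α β c θ)).im = B at *
    generalize ((-Complex.I)^j * ((jz θ)⁻¹^n * etaI α β c θ)).im = D at *
    field_simp
    linear_combination -k2

lemma im_jz_pow_le (θ : ℝ) (j n : ℕ) (w : ℂ) : |((-Complex.I)^j * ((jz θ)⁻¹^n * w)).im| ≤ ‖w‖ := by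
  refine (Complex.abs_im_le_norm _).trans ?_
  rw [norm_mul, norm_mul, norm_pow, norm_pow, norm_inv, jz_norm]; simp

lemma inv_sin_bdd {σ : ℝ} (hσ : 0 < σ) : ∀ θ ∈ sS σ, |(Real.sin θ)⁻¹| ≤ 1/σ := by
  intro θ hθ
  have h : σ ≤ Real.sin θ := hθ
  rw [abs_of_pos (inv_pos.mpr (by linarith)), one_div]
  exact inv_anti₀ hσ h

namespace JH
variable {α β : ℝ} {c : ℕ → ℝ}

lemma derivP (H : JH α β c) (n : ℕ) (θ : ℝ) : Real.sin θ * deriv (nJacobi α β c n) θ =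
    ((n:ℝ) * jb α β c n) * nJacobi α β c (n+1) θ - jB α β c n * nJacobi α β c n θ
    - (((n:ℝ)+α+β+1) * jbm α β c n) * nJacobi α β c (n-1) θ := by
  have h := congrArg (fun p => p.eval (Real.cos θ)) (H.struct n)
  simp only [eval_mul, eval_add, eval_C, pp_eval, jD, eval_sub, eval_one, eval_pow, eval_X] at h
  rw [(nJ_hasDeriv α β c n θ).deriv]
  have e := Real.sin_sq_add_cos_sq θ
  linear_combination -h - (derivative (pp α β c n)).eval (Real.cos θ) * e

lemma jv_rec (H : JH α β c) (j n : ℕ) (θ : ℝ) : Real.sin θ * jv α β c (j+1) n θ =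
    ((n:ℝ) * jb α β c n) * jv α β c j (n+1) θ - jB α β c n * jv α β c j n θ
    - (((n:ℝ)+α+β+1) * jbm α β c n) * jv α β c j (n-1) θ
    - ∑ i ∈ Finset.range j, ((j.choose (i+1) : ℝ) * iteratedDeriv (i+1) Real.sin θ) * jv α β c (j-i) n θ := by
  have hfun : (fun θ => Real.sin θ * deriv (nJacobi α β c n) θ) = fun θ =>
    ((n:ℝ) * jb α β c n) * nJacobi α β c (n+1) θ - jB α β c n * nJacobi α β c n θ
    - (((n:ℝ)+α+β+1) * jbm α β c n) * nJacobi α β c (n-1) θ := funext (H.derivP n)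
  have h := congrArg (fun g => iteratedDeriv j g θ) hfun
  have sm : ∀ n, ContDiffAt ℝ j (nJacobi α β c n) θ := fun n => (nJ_smooth α β c n j).contDiffAt
  have smd : ContDiffAt ℝ j (deriv (nJacobi α β c n)) θ := by
    have h1 := nJ_smooth α β c n ((j:WithTop ℕ∞)+1)
    rw [contDiff_succ_iff_deriv] at h1
    exact h1.2.2.contDiffAt
  rw [iteratedDeriv_fun_mul Real.contDiff_sin.contDiffAt smd] at h
  rw [iteratedDeriv_fun_sub ((contDiffAt_const.mul (sm _)).sub (contDiffAt_const.mul (sm _))) (contDiffAt_const.mul (sm _)),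
    iteratedDeriv_fun_sub (contDiffAt_const.mul (sm _)) (contDiffAt_const.mul (sm _)),
    iteratedDeriv_const_mul_field, iteratedDeriv_const_mul_field, iteratedDeriv_const_mul_field,
    Finset.sum_range_succ'] at h
  simp only [Nat.choose_zero_right, Nat.cast_one, one_mul, iteratedDeriv_zero, Nat.sub_zero,
    ← iteratedDeriv_succ'] at h
  have e : ∑ i ∈ Finset.range j, ((j.choose (i+1) : ℝ) * iteratedDeriv (i+1) Real.sin θ) * jv α β c (j-i) n θ
    = ∑ i ∈ Finset.range j, ((j.choose (i+1) : ℝ) * iteratedDeriv (i+1) Real.sin θ) *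
      iteratedDeriv (j-(i+1)+1) (nJacobi α β c n) θ := by
    apply Finset.sum_congr rfl
    intro i hi
    rw [Finset.mem_range] at hi
    rw [show j-(i+1)+1 = j-i by omega]; rfl
  rw [e]
  unfold jv
  linarith

lemma od_B (H : JH α β c) (S : Set ℝ) : Od S 0 (fun _ n => jB α β c n) := by
  have := (Od.const (S := S) (-(β-α)/2)).add (((H.od_a S).mono (by norm_num)).cmul ((α+β+2)/2))
  exact this.congr (fun θ _ n => by unfold jB; ring)

lemma od_lower (j : ℕ) {σ : ℝ} (h : ∀ i ≤ j, Od (sS σ) i (fun θ n => jv α β c i n θ)) :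
    Od (sS σ) j (fun θ n => ∑ i ∈ Finset.range j,
      ((j.choose (i+1) : ℝ) * iteratedDeriv (i+1) Real.sin θ) * jv α β c (j-i) n θ) := by
  apply Od.sum
  intro i hi
  have h1 := (h (j-i) (by omega)).mono (show ((j-i:ℕ):ℤ) ≤ j by omega)
  refine h1.bmul (fun θ => (j.choose (i+1) : ℝ) * iteratedDeriv (i+1) Real.sin θ) (j.choose (i+1)) ?_
  intro θ _
  rw [abs_mul, Nat.abs_cast]
  exact mul_le_of_le_one_right (by positivity) (Real.abs_iteratedDeriv_sin_le_one _ _)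

lemma od_v (H : JH α β c) {σ : ℝ} (hσ : 0 < σ) (j : ℕ) : Od (sS σ) j (fun θ n => jv α β c j n θ) := by
  induction j using Nat.strong_induction_on with
  | _ j ih =>
  cases j with
  | zero => exact (H.od_P hσ).congr (fun θ _ n => jv_zero α β c n θ)
  | succ j =>
    have hj := ih j (by omega)
    have s1 := ((Od.nat (S := sS σ)).mul (H.od_b _)).mul hj.up
    have s2 := (H.od_B (sS σ)).mul hj
    have s3 := (((Od.nat (S := sS σ)).add ((Od.const (α+β+1)).mono (by norm_num))).mul (H.od_bm _)).mul hj.down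
    have s4 := od_lower (α := α) (β := β) (c := c) j (σ := σ) (fun i hi => ih i (by omega))
    have l : (1 + 0 + (j:ℤ)) = ((j+1:ℕ):ℤ) := by push_cast; ring
    rw [l] at s1 s3
    have := ((s1.sub (s2.mono (by push_cast; linarith))).sub s3).sub (s4.mono (by push_cast; linarith))
    refine (this.bmul (fun θ => (Real.sin θ)⁻¹) (1/σ) (inv_sin_bdd hσ)).congr ?_
    intro θ hθ n
    have hs : Real.sin θ ≠ 0 := (lt_of_lt_of_le hσ hθ).ne'
    have e := H.jv_rec j n θ
    rw [eq_inv_mul_iff_mul_eq₀ hs, e]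
    ring

lemma rho_summable (H : JH α β c) {σ : ℝ} (hσ : 0 < σ) {θ : ℝ} (hθ : θ ∈ sS σ) :
    Summable (fun k => |rho α β c k θ|) := by
  obtain ⟨C, hC, h⟩ := H.od_rho hσ
  refine Summable.of_nonneg_of_le (fun _ => abs_nonneg _) (h θ hθ) ?_
  have : Summable (fun n : ℕ => (1:ℝ)/(n:ℝ)^2) := Real.summable_one_div_nat_pow.mpr (by norm_num)
  have := ((summable_nat_add_iff 1).mpr this).mul_left C
  refine this.congr (fun n => ?_)
  rw [zpow_neg, show (2:ℤ) = ((2:ℕ):ℤ) by rfl, zpow_natCast, one_div]; push_cast; rfl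

lemma od_eta (H : JH α β c) {σ : ℝ} (hσ : 0 < σ) :
    Od (sS σ) (-1) (fun θ n => ‖jeta α β c n θ - etaI α β c θ‖) := by
  obtain ⟨C, hC, h⟩ := H.od_rho hσ
  refine ⟨C, hC, fun θ hθ n => ?_⟩
  rw [abs_of_nonneg (norm_nonneg _)]
  have hs := H.rho_summable hσ hθ
  have hs' : Summable (fun k => (jz θ)^k * (rho α β c k θ : ℂ)) := by
    apply Summable.of_norm
    simpa [jz_norm] using hs
  have hlim : Tendsto (fun m => jeta α β c m θ) atTop (𝓝 (etaI α β c θ)) := by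
    have := (hs'.hasSum.tendsto_sum_nat.comp (tendsto_add_atTop_nat 1)).const_add ((jz θ)⁻¹ * (nJacobi α β c 0 θ : ℂ))
    refine this.congr (fun m => ?_)
    rw [eta_eq_sum]; rfl
  have hb : ∀ m, ‖jeta α β c n θ - jeta α β c (n+m) θ‖ ≤ C * (1/((n:ℝ)+1) - 1/((n:ℝ)+m+1)) := by
    intro m
    induction m with
    | zero => simp
    | succ m ih =>
      have e : jeta α β c n θ - jeta α β c (n+m+1) θ = (jeta α β c n θ - jeta α β c (n+m) θ)
          - (jz θ)^(n+m+1) * (rho α β c (n+m+1) θ : ℂ) := by rw [eta_succ]; ring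
      rw [← add_assoc, e]
      refine (norm_sub_le _ _).trans ?_
      rw [norm_mul, norm_pow, jz_norm, one_pow, one_mul, Complex.norm_real, Real.norm_eq_abs]
      have h2 := h θ hθ (n+m+1)
      rw [zpow_neg, show (2:ℤ) = ((2:ℕ):ℤ) by rfl, zpow_natCast] at h2
      push_cast at h2 ⊢
      have h3 : (((n:ℝ)+m+1+1)^2)⁻¹ ≤ 1/((n:ℝ)+m+1) - 1/((n:ℝ)+(m+1)+1) := by
        have e2 : 1/((n:ℝ)+m+1) - 1/((n:ℝ)+(m+1)+1) = 1/(((n:ℝ)+m+1)*(n+m+1+1)) := by field_simp; ring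
        rw [e2, ← one_div]
        have : (0:ℝ) ≤ (n:ℝ)+m := by positivity
        gcongr
        nlinarith
      have := mul_le_mul_of_nonneg_left h3 hC
      linarith
  have hlim2 : Tendsto (fun m => ‖jeta α β c n θ - jeta α β c (n+m) θ‖) atTop (𝓝 ‖jeta α β c n θ - etaI α β c θ‖) := by
    refine (tendsto_const_nhds.sub ?_).norm
    have := hlim.comp (tendsto_add_atTop_nat n)
    refine this.congr (fun m => ?_)
    simp [add_comm]
  refine le_of_tendsto hlim2 (Eventually.of_forall (fun m => (hb m).trans ?_))
  rw [zpow_neg_one, ← one_div]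
  apply mul_le_mul_of_nonneg_left _ hC
  have : 0 ≤ 1/((n:ℝ)+m+1) := by positivity
  linarith

lemma od_etaI (H : JH α β c) {σ : ℝ} (hσ : 0 < σ) : ∃ M, 0 ≤ M ∧ ∀ θ ∈ sS σ, ‖etaI α β c θ‖ ≤ M := by
  obtain ⟨C, hC, h⟩ := H.od_eta hσ
  obtain ⟨M0, hM0, h0⟩ := nJ_bdd α β c 0
  obtain ⟨M1, hM1, h1⟩ := nJ_bdd α β c 1
  refine ⟨C + (M1 + M0), by positivity, fun θ hθ => ?_⟩
  have h2 := h θ hθ 0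
  simp at h2
  have h3 : ‖jeta α β c 0 θ‖ ≤ M1 + M0 := by
    simp only [jeta, pow_zero, one_mul, zero_add]
    calc _ ≤ ‖(nJacobi α β c 1 θ : ℂ)‖ + ‖jz θ * (nJacobi α β c 0 θ : ℂ)‖ := norm_sub_le _ _
      _ ≤ _ := by
        rw [norm_mul, jz_norm, Complex.norm_real, Complex.norm_real, one_mul, Real.norm_eq_abs, Real.norm_eq_abs]
        linarith [h0 θ, h1 θ]
  have h4 : etaI α β c θ = jeta α β c 0 θ - (jeta α β c 0 θ - etaI α β c θ) := by ring
  rw [h4]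
  refine (norm_sub_le _ _).trans ?_
  linarith

lemma od_mm (H : JH α β c) {σ : ℝ} (hσ : 0 < σ) (j : ℕ) : Od (sS σ) 0 (fun θ n => mm α β c j n θ) := by
  obtain ⟨M, hM, h⟩ := H.od_etaI hσ
  refine ⟨(1/σ) * M, by positivity, fun θ hθ n => ?_⟩
  have e0 : mm α β c j n θ = (Real.sin θ)⁻¹ * -((-Complex.I)^j * ((jz θ)⁻¹^n * etaI α β c θ)).im := by
    unfold mm; rw [div_eq_inv_mul]
  beta_reduce
  rw [zpow_zero, mul_one, e0, abs_mul, abs_neg]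
  have h2 := (im_jz_pow_le θ j n (etaI α β c θ)).trans (h θ hθ)
  have h3 := inv_sin_bdd hσ θ hθ
  gcongr

lemma asym (H : JH α β c) {σ : ℝ} (hσ : 0 < σ) (j : ℕ) :
    Od (sS σ) ((j:ℤ)-1) (fun θ n => jv α β c j n θ - (n:ℝ)^j * mm α β c j n θ) := by
  induction j with
  | zero =>
    obtain ⟨C, hC, h⟩ := H.od_eta hσ
    refine ⟨(1/σ) * C, by positivity, fun θ hθ n => ?_⟩
    have hs : Real.sin θ ≠ 0 := (lt_of_lt_of_le hσ hθ).ne'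
    have e : jv α β c 0 n θ - (n:ℝ)^0 * mm α β c 0 n θ =
        (Real.sin θ)⁻¹ * (- ((-Complex.I)^0 * ((jz θ)⁻¹^n * (jeta α β c n θ - etaI α β c θ))).im) := by
      rw [jv_zero]
      unfold mm
      have e1 : (jz θ)⁻¹^n * jeta α β c n θ = nJacobi α β c (n+1) θ - jz θ * nJacobi α β c n θ := by
        unfold jeta
        rw [← mul_assoc, ← mul_pow, inv_mul_cancel₀ (jz_ne θ), one_pow, one_mul]
      rw [mul_sub ((jz θ)⁻¹^n), e1]
      have h1 : (nJacobi α β c (n+1) θ - jz θ * nJacobi α β c n θ : ℂ).im = - (Real.sin θ * nJacobi α β c n θ) := by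
        rw [jz_eq]; simp [-Complex.ofReal_sin, -Complex.ofReal_cos]
      simp only [pow_zero, one_mul]
      rw [Complex.sub_im, h1]
      field_simp
      ring
    show |jv α β c 0 n θ - (n:ℝ)^0 * mm α β c 0 n θ| ≤ _
    rw [e, abs_mul, abs_neg, mul_assoc]
    have h2 := h θ hθ n
    rw [abs_of_nonneg (norm_nonneg _)] at h2
    have h3 := (im_jz_pow_le θ 0 n (jeta α β c n θ - etaI α β c θ)).trans h2
    have h4 := inv_sin_bdd hσ θ hθ
    have : (((0:ℕ):ℤ)-1) = -1 := by norm_num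
    rw [this]
    gcongr
  | succ j ih =>
    have hj := H.od_v hσ j
    have hm := H.od_mm hσ j
    have n1 := Od.nat (S := sS σ)
    have t1 := (n1.mul (H.od_b1 _)).mul hj.up
    have t2 := (n1.mul (H.od_bm1 _)).mul hj.down
    have t3 := (H.od_B (sS σ)).mul hj
    have t4 := ((H.od_bm (sS σ)).mul hj.down).cmul (α+β+1)
    have t5 := od_lower (α := α) (β := β) (c := c) j (σ := σ) (fun i _ => H.od_v hσ i)
    have t6 := n1.mul ((Od.powdiff (S := sS σ) j).mul hm.up)
    have t7 := n1.mul ((Od.powdiff_down (S := sS σ) j).mul hm.down)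
    have t8 := n1.mul ih.up
    have t9 := n1.mul ih.down
    replace t1 := (t1.mono (show 1 + -2 + (j:ℤ) ≤ j by linarith)).cmul (-1/2)
    replace t2 := (t2.mono (show 1 + -2 + (j:ℤ) ≤ j by linarith)).cmul (1/2)
    replace t3 := t3.mono (show 0 + (j:ℤ) ≤ j by linarith)
    replace t4 := t4.mono (show 0 + (j:ℤ) ≤ j by linarith)
    replace t6 := (t6.mono (show 1 + (((j:ℤ)-1)+0) ≤ j by linarith)).cmul (1/2)
    replace t7 := (t7.mono (show 1 + (((j:ℤ)-1)+0) ≤ j by linarith)).cmul (1/2)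
    replace t8 := (t8.mono (show 1 + ((j:ℤ)-1) ≤ j by linarith)).cmul (1/2)
    replace t9 := (t9.mono (show 1 + ((j:ℤ)-1) ≤ j by linarith)).cmul (1/2)
    have tt := (((((((t1.add t2).sub t3).sub t4).sub t5).add t6).sub t7).add t8).sub t9
    have := tt.bmul (fun θ => (Real.sin θ)⁻¹) (1/σ) (inv_sin_bdd hσ)
    have ej : (((j+1:ℕ):ℤ)-1) = j := by push_cast; ring
    rw [ej]
    refine this.congr ?_
    intro θ hθ n
    have hs : Real.sin θ ≠ 0 := (lt_of_lt_of_le hσ hθ).ne'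
    have e := H.jv_rec j n θ
    have e2 := mm_step α β c j n θ hs
    rw [eq_inv_mul_iff_mul_eq₀ hs, mul_sub, e]
    push_cast
    linear_combination ((n:ℝ)^j/2) * e2
end JH

end

section
open Polynomial Topology

lemma cc_support (f : ℝ → ℝ) (hf : IsCcSmooth f) :
    ∃ δ : ℝ, 0 < δ ∧ δ < π/2 ∧ ∀ φ, φ ∉ Icc δ (π-δ) → f φ = 0 := by
  obtain ⟨_, h2, h3⟩ := hf
  have hK : IsCompact (tsupport f) := h2
  have key : ∃ δ : ℝ, 0 < δ ∧ δ < π/2 ∧ tsupport f ⊆ Icc δ (π-δ) := by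
    by_cases hne : (tsupport f).Nonempty
    · obtain ⟨a, ha, hmin⟩ := hK.exists_isMinOn hne continuous_id.continuousOn
      obtain ⟨b, hb, hmax⟩ := hK.exists_isMaxOn hne continuous_id.continuousOn
      have ha' := h3 ha
      have hb' := h3 hb
      refine ⟨min (min a (π-b)) (π/4), ?_, ?_, ?_⟩
      · have := Real.pi_pos
        simp only [lt_min_iff]
        exact ⟨⟨ha'.1, by linarith [hb'.2]⟩, by linarith⟩
      · have := Real.pi_pos
        exact lt_of_le_of_lt (min_le_right _ _) (by linarith)
      · intro x hx
        have h4 : a ≤ x := hmin hx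
        have h5 : x ≤ b := hmax hx
        have h6 := min_le_left (min a (π-b)) (π/4)
        have h7 := min_le_left a (π-b)
        have h8 := min_le_right a (π-b)
        constructor <;> linarith
    · rw [Set.not_nonempty_iff_eq_empty] at hne
      refine ⟨π/4, by positivity, by linarith [Real.pi_pos], by simp [hne]⟩
  obtain ⟨δ, h4, h5, h6⟩ := key
  exact ⟨δ, h4, h5, fun φ hφ => image_eq_zero_of_notMem_tsupport (fun h => hφ (h6 h))⟩

lemma Icc_sub_sS {δ : ℝ} (h0 : 0 < δ) (h1 : δ < π/2) {φ : ℝ} (h : φ ∈ Icc δ (π-δ)) : φ ∈ sS (Real.sin δ) := by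
  show Real.sin δ ≤ Real.sin φ
  rcases le_total φ (π/2) with h2 | h2
  · exact Real.sin_le_sin_of_le_of_le_pi_div_two (by linarith) h2 h.1
  · rw [← Real.sin_pi_sub φ]
    exact Real.sin_le_sin_of_le_of_le_pi_div_two (by linarith) (by linarith) (by linarith [h.2])

/-- logarithmic derivative of the weight -/
def jom (α β θ : ℝ) : ℝ := (2*α+1)/2 * (Real.cos (θ/2) / Real.sin (θ/2)) - (2*β+1)/2 * (Real.sin (θ/2) / Real.cos (θ/2))

lemma jw_hasDeriv (α β : ℝ) {θ : ℝ} (h : θ ∈ Ioo 0 π) : HasDerivAt (jw α β) (jw α β θ * jom α β θ) θ := by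
  have hs := sin_half_pos h
  have hc := cos_half_pos h
  have h2 : HasDerivAt (fun x:ℝ => x/2) (1/2) θ := (hasDerivAt_id θ).div_const 2
  have d1 := ((Real.hasDerivAt_sin (θ/2)).comp θ h2).rpow_const (p := 2*α+1) (Or.inl hs.ne')
  have d2 := ((Real.hasDerivAt_cos (θ/2)).comp θ h2).rpow_const (p := 2*β+1) (Or.inl hc.ne')
  have d := d1.mul d2
  have d' : HasDerivAt (jw α β) _ θ := d
  refine d'.congr_deriv ?_
  simp only [Function.comp, jom, jw]
  rw [Real.rpow_sub_one hs.ne', Real.rpow_sub_one hc.ne']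
  field_simp
  ring

lemma jom_sin (α β : ℝ) {θ : ℝ} (h : θ ∈ Ioo 0 π) :
    jom α β θ * Real.sin θ = (α - β) + (α+β+1) * Real.cos θ := by
  have hs := sin_half_pos h
  have hc := cos_half_pos h
  have e1 : Real.sin θ = 2 * Real.sin (θ/2) * Real.cos (θ/2) := by
    rw [← Real.sin_two_mul]; congr 1; ring
  have e2 : Real.cos θ = Real.cos (θ/2)^2 - Real.sin (θ/2)^2 := by
    rw [← Real.cos_two_mul']; congr 1; ring
  have e3 := Real.sin_sq_add_cos_sq (θ/2)
  rw [e1, e2, jom]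
  field_simp
  linear_combination (α - β) * e3

lemma jom_cont (α β : ℝ) : ContinuousOn (jom α β) (Ioo 0 π) := by
  unfold jom
  have h1 : ContinuousOn (fun θ:ℝ => Real.cos (θ/2)) (Ioo 0 π) := by fun_prop
  have h2 : ContinuousOn (fun θ:ℝ => Real.sin (θ/2)) (Ioo 0 π) := by fun_prop
  exact (continuousOn_const.mul (h1.div h2 (fun x hx => (sin_half_pos hx).ne'))).sub
    (continuousOn_const.mul (h2.div h1 (fun x hx => (cos_half_pos hx).ne')))

lemma jw_cont (α β : ℝ) : ContinuousOn (jw α β) (Ioo 0 π) :=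
  fun x hx => (jw_hasDeriv α β hx).continuousAt.continuousWithinAt

namespace JH
variable {α β : ℝ} {c : ℕ → ℝ}

lemma ode (H : JH α β c) (n : ℕ) {θ : ℝ} (h : θ ∈ Ioo 0 π) :
    jv α β c 2 n θ + jom α β θ * jv α β c 1 n θ = -((n:ℝ)*(n+α+β+1)) * nJacobi α β c n θ := by
  have e1 : ∀ x, jv α β c 1 n x = (derivative (pp α β c n)).eval (Real.cos x) * (-Real.sin x) := by
    intro x
    have := jv_hasDeriv α β c 0 n x
    have h0 : jv α β c 0 n = nJacobi α β c n := funext (jv_zero α β c n)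
    rw [h0] at this
    exact this.unique (nJ_hasDeriv α β c n x)
  have e2 : jv α β c 2 n θ = (derivative (derivative (pp α β c n))).eval (Real.cos θ) * (-Real.sin θ) * (-Real.sin θ)
     + (derivative (pp α β c n)).eval (Real.cos θ) * (- Real.cos θ) := by
    have h1 := jv_hasDeriv α β c 1 n θ
    rw [funext e1] at h1
    have h2 := (((derivative (pp α β c n)).hasDerivAt (Real.cos θ)).comp θ (Real.hasDerivAt_cos θ)).mul
      (Real.hasDerivAt_sin θ).neg
    exact h1.unique h2
  have h3 := congrArg (fun q => q.eval (Real.cos θ)) (H.eigen n)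
  simp only [ibpOp, eval_mul, eval_add, eval_sub, eval_C, eval_X, eval_one, eval_pow, pp_eval] at h3
  rw [e2, e1]
  have h4 := jom_sin α β h
  have h5 := Real.sin_sq_add_cos_sq θ
  linear_combination h3 - (derivative (pp α β c n)).eval (Real.cos θ) * h4 + (derivative (derivative (pp α β c n))).eval (Real.cos θ) * h5

lemma ibp_f (H : JH α β c) (f : ℝ → ℝ) (hf : ContDiff ℝ (⊤:ℕ∞) f) {δ : ℝ} (h0 : 0 < δ) (h1 : δ < π/2)
    (hs : ∀ φ, φ ∉ Icc δ (π-δ) → f φ = 0) (n : ℕ) :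
    ((n:ℝ)*(n+α+β+1)) * jacobiInner α β f (nJacobi α β c n) =
    - ∫ θ in (δ/2)..(π-δ/2), (deriv (deriv f) θ + jom α β θ * deriv f θ) * nJacobi α β c n θ * jw α β θ := by
  have hsub : Icc (δ/2) (π-δ/2) ⊆ Ioo 0 π := fun x hx => ⟨by linarith [hx.1], by linarith [hx.2]⟩
  have hle : δ/2 ≤ π - δ/2 := by linarith
  have hinner : jacobiInner α β f (nJacobi α β c n) =
      ∫ θ in (δ/2)..(π-δ/2), f θ * nJacobi α β c n θ * jw α β θ := by
    unfold jacobiInner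
    rw [jm_integral, intervalIntegral.integral_of_le hle]
    apply setIntegral_eq_of_subset_of_forall_diff_eq_zero measurableSet_Ioo
    · exact fun x hx => hsub ⟨hx.1.le, hx.2⟩
    · intro x hx
      rw [hs x, zero_mul, zero_mul]
      intro h
      exact hx.2 ⟨by linarith [h.1], by linarith [h.2]⟩
  have hd1 : ∀ x, HasDerivAt f (deriv f x) x := fun x =>
    (hf.differentiable (by simp) x).hasDerivAt
  have hf1 : ContDiff ℝ (⊤:ℕ∞) (deriv f) := (contDiff_infty_iff_deriv.1 hf).2
  have hf2 : ContDiff ℝ (⊤:ℕ∞) (deriv (deriv f)) := (contDiff_infty_iff_deriv.1 hf1).2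
  have hd2 : ∀ x, HasDerivAt (deriv f) (deriv (deriv f) x) x := fun x =>
    (hf1.differentiable (by simp) x).hasDerivAt
  have hs' : ∀ φ, φ ∉ Icc δ (π-δ) → deriv f φ = 0 := by
    intro φ hφ
    have : f =ᶠ[𝓝 φ] fun _ => 0 := by
      filter_upwards [isClosed_Icc.isOpen_compl.mem_nhds hφ] with x hx using hs x hx
    rw [this.deriv_eq]; simp
  have D : ∀ x ∈ Icc (δ/2) (π-δ/2), HasDerivAt
      (fun x => f x * (jw α β x * jv α β c 1 n x) - (jw α β x * deriv f x) * nJacobi α β c n x)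
      (-((n:ℝ)*(n+α+β+1)) * (f x * nJacobi α β c n x * jw α β x) -
        (deriv (deriv f) x + jom α β x * deriv f x) * nJacobi α β c n x * jw α β x) x := by
    intro x hx
    have hw := jw_hasDeriv α β (hsub hx)
    have hv1 := jv_hasDeriv α β c 1 n x
    have hv0 := jv_hasDeriv α β c 0 n x
    rw [show jv α β c 0 n = nJacobi α β c n from funext (jv_zero α β c n)] at hv0
    have := ((hd1 x).mul (hw.mul hv1)).sub ((hw.mul (hd2 x)).mul hv0)
    refine HasDerivAt.congr_deriv this ?_
    have o := H.ode n (hsub hx)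
    simp only [Pi.mul_apply] at *
    norm_num
    linear_combination (f x * jw α β x) * o
  have cw : ContinuousOn (jw α β) (uIcc (δ/2) (π-δ/2)) := by
    rw [uIcc_of_le hle]; exact (jw_cont α β).mono hsub
  have co : ContinuousOn (jom α β) (uIcc (δ/2) (π-δ/2)) := by
    rw [uIcc_of_le hle]; exact (jom_cont α β).mono hsub
  have cP := (nJ_cont α β c n).continuousOn (s := uIcc (δ/2) (π-δ/2))
  have c1 : ContinuousOn (fun x => f x * nJacobi α β c n x * jw α β x) (uIcc (δ/2) (π-δ/2)) :=
    (hf.continuous.continuousOn.mul cP).mul cw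
  have c2 : ContinuousOn (fun x => (deriv (deriv f) x + jom α β x * deriv f x) * nJacobi α β c n x * jw α β x)
      (uIcc (δ/2) (π-δ/2)) :=
    ((hf2.continuous.continuousOn.add (co.mul hf1.continuous.continuousOn)).mul cP).mul cw
  have i1 := c1.intervalIntegrable (μ := volume)
  have i2 := c2.intervalIntegrable (μ := volume)
  have F := intervalIntegral.integral_eq_sub_of_hasDerivAt (f := 
    (fun x => f x * (jw α β x * jv α β c 1 n x) - (jw α β x * deriv f x) * nJacobi α β c n x))
    (fun x hx => D x (by rwa [uIcc_of_le hle] at hx)) ((i1.const_mul _).sub i2)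
  have za : δ/2 ∉ Icc δ (π-δ) := fun h => by linarith [h.1]
  have zb : π-δ/2 ∉ Icc δ (π-δ) := fun h => by linarith [h.2]
  rw [hs _ za, hs _ zb, hs' _ za, hs' _ zb, intervalIntegral.integral_sub (i1.const_mul _) i2,
    intervalIntegral.integral_const_mul, ← hinner] at F
  linarith

lemma f_decay (H : JH α β c) (f : ℝ → ℝ) (hf : ContDiff ℝ (⊤:ℕ∞) f) {δ : ℝ} (h0 : 0 < δ) (h1 : δ < π/2)
    (hs : ∀ φ, φ ∉ Icc δ (π-δ) → f φ = 0) :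
    ∃ C, 0 ≤ C ∧ ∀ n : ℕ, |jacobiInner α β f (nJacobi α β c n)| ≤ C / ((n:ℝ)+1)^2 := by
  have hsub : Icc (δ/2) (π-δ/2) ⊆ Ioo 0 π := fun x hx => ⟨by linarith [hx.1], by linarith [hx.2]⟩
  have hle : δ/2 ≤ π - δ/2 := by linarith
  have hf1 : ContDiff ℝ (⊤:ℕ∞) (deriv f) := (contDiff_infty_iff_deriv.1 hf).2
  have hf2 : ContDiff ℝ (⊤:ℕ∞) (deriv (deriv f)) := (contDiff_infty_iff_deriv.1 hf1).2
  have c2 : ContinuousOn (fun x => (deriv (deriv f) x + jom α β x * deriv f x) * jw α β x)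
      (Icc (δ/2) (π-δ/2)) :=
    ((hf2.continuous.continuousOn.add (((jom_cont α β).mono hsub).mul hf1.continuous.continuousOn))).mul
      ((jw_cont α β).mono hsub)
  obtain ⟨B, hB⟩ := isCompact_Icc.exists_bound_of_continuousOn c2
  have hσ : 0 < Real.sin (δ/2) := Real.sin_pos_of_pos_of_lt_pi (by linarith) (by linarith [Real.pi_pos])
  obtain ⟨M, hM, hP⟩ := H.od_P hσ
  have hB0 : 0 ≤ B := (norm_nonneg _).trans (hB (δ/2) ⟨le_rfl, hle⟩)
  have key : ∀ n : ℕ, |((n:ℝ)*(n+α+β+1)) * jacobiInner α β f (nJacobi α β c n)| ≤ B * M * π := by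
    intro n
    rw [H.ibp_f f hf h0 h1 hs n, abs_neg]
    have := intervalIntegral.norm_integral_le_of_norm_le_const (a := δ/2) (b := π-δ/2) (C := B*M)
      (f := fun θ => (deriv (deriv f) θ + jom α β θ * deriv f θ) * nJacobi α β c n θ * jw α β θ) ?_
    · rw [Real.norm_eq_abs] at this
      refine this.trans ?_
      rw [abs_of_nonneg (by linarith)]
      gcongr; linarith
    · intro x hx
      rw [uIoc_of_le hle] at hx
      have hx' : x ∈ Icc (δ/2) (π-δ/2) := ⟨hx.1.le, hx.2⟩
      have hb := hB x hx'
      have hp := hP x (Icc_sub_sS (by linarith) (by linarith) hx') n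
      rw [zpow_zero, mul_one] at hp
      rw [mul_right_comm, norm_mul]
      exact mul_le_mul hb hp (abs_nonneg _) hB0
  have hα := H.hα
  have hβ := H.hβ
  set g := fun n => |jacobiInner α β f (nJacobi α β c n)| with hg
  refine ⟨6*(B*M*π) + g 0 + 4 * g 1, ?_, ?_⟩
  · have := Real.pi_pos; have : 0 ≤ g 0 := abs_nonneg _; have : 0 ≤ g 1 := abs_nonneg _; positivity
  · have hg0 : 0 ≤ g 0 := abs_nonneg _
    have hg1 : 0 ≤ g 1 := abs_nonneg _
    have hC : 0 ≤ B*M*π := by positivity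
    intro n
    rw [le_div_iff₀ (by positivity)]
    change g n * _ ≤ _
    match n with
    | 0 => simp; nlinarith
    | 1 => norm_num; nlinarith
    | k+2 =>
      have h := key (k+2)
      rw [abs_mul] at h
      change _ * g (k+2) ≤ _ at h
      have hgk : 0 ≤ g (k+2) := abs_nonneg _
      have hk : (0:ℝ) ≤ k := Nat.cast_nonneg k
      have h3 : (((k+2:ℕ):ℝ)+1)^2 ≤ 6 * |((k+2:ℕ):ℝ)*(((k+2:ℕ):ℝ)+α+β+1)| := by
        push_cast
        refine le_trans ?_ (mul_le_mul_of_nonneg_left (le_abs_self _) (by norm_num))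
        nlinarith
      calc g (k+2) * (((k+2:ℕ):ℝ)+1)^2 ≤ g (k+2) * (6 * |((k+2:ℕ):ℝ)*(((k+2:ℕ):ℝ)+α+β+1)|) := by gcongr
        _ ≤ _ := by linarith

end JH

end

section
open Polynomial Topology

/-- bounded test functions supported away from the endpoints -/
structure TF (σ B : ℝ) (ψ : ℝ → ℝ) : Prop where
  m : Measurable ψ
  b : ∀ φ, |ψ φ| ≤ B
  z : ∀ φ, φ ∉ sS σ → ψ φ = 0

/-- series in the Jacobi system -/
def jF (α β : ℝ) (c : ℕ → ℝ) (d : ℕ → ℝ) (φ : ℝ) : ℝ := ∑' n, d n * nJacobi α β c n φ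

namespace JH
variable {α β : ℝ} {c : ℕ → ℝ}

lemma sq_sum (H : JH α β c) (d : ℕ → ℝ) (M : ℕ) :
    ∫ φ, (∑ n ∈ Finset.range M, d n * nJacobi α β c n φ)^2 ∂(jacobiMeasure α β) = ∑ n ∈ Finset.range M, d n^2 := by
  have hlin : ∀ k M, jl α β c k (∑ n ∈ Finset.range M, C (d n) * pp α β c n) =
      ∑ n ∈ Finset.range M, d n * jl α β c k (pp α β c n) := by
    intro k M
    induction M with
    | zero => simp [jl, jL]
    | succ M ih => rw [Finset.sum_range_succ, H.ladd, ih, H.lC, Finset.sum_range_succ]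
  have key : ∀ M, jL α β ((∑ n ∈ Finset.range M, C (d n) * pp α β c n) * (∑ n ∈ Finset.range M, C (d n) * pp α β c n))
      = ∑ n ∈ Finset.range M, d n^2 := by
    intro M
    induction M with
    | zero => simp [jL]
    | succ M ih =>
      rw [Finset.sum_range_succ, Finset.sum_range_succ (fun n => d n^2), ← ih]
      set S := ∑ n ∈ Finset.range M, C (d n) * pp α β c n with hS
      have e : (S + C (d M) * pp α β c M) * (S + C (d M) * pp α β c M) =
        S * S + C (2 * d M) * (S * pp α β c M) + C (d M^2) * (pp α β c M * pp α β c M) := by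
        simp only [C_mul, C_pow]
        rw [show (C (2:ℝ) : ℝ[X]) = 2 by rfl]
        ring
      rw [e, jL_add H.hα H.hβ, jL_add H.hα H.hβ, jL_C H.hα H.hβ, jL_C H.hα H.hβ]
      have h1 := hlin M M
      have h2 : jL α β (S * pp α β c M) = 0 := by
        change jl α β c M S = 0
        rw [hS, h1]
        apply Finset.sum_eq_zero
        intro n hn
        rw [H.ortho (Finset.mem_range.1 hn).ne, mul_zero]
      have h3 : jL α β (pp α β c M * pp α β c M) = 1 := H.norm1 M
      rw [h2, h3]; ring
  rw [← key M]
  unfold jL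
  congr 1
  funext φ
  simp only [eval_mul, eval_finset_sum, eval_C, pp_eval]
  ring

lemma TF_P (H : JH α β c) {σ : ℝ} (hσ : 0 < σ) : ∃ K, 0 ≤ K ∧ ∀ B ψ, 0 ≤ B → TF σ B ψ →
    ∀ n φ, |ψ φ * nJacobi α β c n φ| ≤ B * K := by
  obtain ⟨K, hK, h⟩ := H.od_P hσ
  refine ⟨K, hK, fun B ψ hB T n φ => ?_⟩
  by_cases hφ : φ ∈ sS σ
  · have := h φ hφ n
    rw [zpow_zero, mul_one] at this
    rw [abs_mul]
    exact mul_le_mul (T.b φ) this (abs_nonneg _) hB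
  · rw [T.z φ hφ, zero_mul, abs_zero]; positivity

lemma TF_int (H : JH α β c) {σ B : ℝ} (hσ : 0 < σ) (hB : 0 ≤ B) {ψ : ℝ → ℝ} (T : TF σ B ψ) (n : ℕ) :
    Integrable (fun φ => ψ φ * nJacobi α β c n φ) (jacobiMeasure α β) := by
  haveI := jm_finite α β H.hα H.hβ
  obtain ⟨K, hK, h⟩ := H.TF_P hσ
  exact Integrable.of_bound (T.m.mul (nJ_cont α β c n).measurable).aestronglyMeasurable (B*K)
    (Eventually.of_forall (fun φ => h B ψ hB T n φ))

lemma TF_hasSum (H : JH α β c) {σ B : ℝ} (hσ : 0 < σ) (hB : 0 ≤ B) {ψ : ℝ → ℝ} (T : TF σ B ψ) {d : ℕ → ℝ}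
    (hd : Summable (fun n => |d n|)) (φ : ℝ) :
    HasSum (fun n => ψ φ * (d n * nJacobi α β c n φ)) (ψ φ * jF α β c d φ) := by
  by_cases hφ : φ ∈ sS σ
  · apply HasSum.mul_left
    apply Summable.hasSum
    obtain ⟨K, hK, h⟩ := H.od_P hσ
    apply Summable.of_norm_bounded (hd.mul_right K)
    intro n
    have := h φ hφ n
    rw [zpow_zero, mul_one] at this
    rw [norm_mul]
    exact mul_le_mul_of_nonneg_left this (abs_nonneg _)
  · simp only [T.z φ hφ, zero_mul]
    exact hasSum_zero

lemma TF_swap (H : JH α β c) {σ B : ℝ} (hσ : 0 < σ) (hB : 0 ≤ B) {ψ : ℝ → ℝ} (T : TF σ B ψ) {d : ℕ → ℝ}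
    (hd : Summable (fun n => |d n|)) :
    Integrable (fun φ => ψ φ * jF α β c d φ) (jacobiMeasure α β) ∧
    HasSum (fun n => d n * jacobiInner α β ψ (nJacobi α β c n)) (∫ φ, ψ φ * jF α β c d φ ∂(jacobiMeasure α β)) := by
  haveI := jm_finite α β H.hα H.hβ
  obtain ⟨K, hK, h⟩ := H.TF_P hσ
  have hIntg : ∀ n, Integrable (fun φ => ψ φ * (d n * nJacobi α β c n φ)) (jacobiMeasure α β) := by
    intro n
    have := (H.TF_int hσ hB T n).const_mul (d n)
    refine this.congr (Eventually.of_forall (fun φ => ?_))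
    simp only; ring
  have hb : ∀ n φ, |ψ φ * (d n * nJacobi α β c n φ)| ≤ |d n| * (B*K) := by
    intro n φ
    rw [mul_left_comm, abs_mul]
    exact mul_le_mul_of_nonneg_left (h B ψ hB T n φ) (abs_nonneg _)
  have hsum : Summable (fun n => ∫ φ, ‖ψ φ * (d n * nJacobi α β c n φ)‖ ∂(jacobiMeasure α β)) := by
    refine Summable.of_nonneg_of_le (fun n => integral_nonneg (fun _ => norm_nonneg _)) (fun n => ?_)
      (hd.mul_right (B*K * (jacobiMeasure α β).real univ))
    have := integral_mono (hIntg n).norm (integrable_const (|d n| * (B*K))) (hb n)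
    refine this.trans (le_of_eq ?_)
    rw [integral_const, smul_eq_mul]; ring
  have e : ∀ φ, ψ φ * jF α β c d φ = ∑' n, ψ φ * (d n * nJacobi α β c n φ) :=
    fun φ => (H.TF_hasSum hσ hB T hd φ).tsum_eq.symm
  have hS := hasSum_integral_of_summable_integral_norm hIntg hsum
  simp_rw [← e] at hS
  constructor
  · have hm : AEStronglyMeasurable (fun φ => ψ φ * jF α β c d φ) (jacobiMeasure α β) := by
      apply aestronglyMeasurable_of_tendsto_ae atTop
        (f := fun M φ => ∑ n ∈ Finset.range M, ψ φ * (d n * nJacobi α β c n φ))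
      · intro M
        exact (integrable_finset_sum _ (fun n _ => hIntg n)).aestronglyMeasurable
      · exact Eventually.of_forall (fun φ => (H.TF_hasSum hσ hB T hd φ).tendsto_sum_nat)
    refine Integrable.of_bound hm (∑' n, |d n| * (B*K)) (Eventually.of_forall (fun φ => ?_))
    rw [e]
    exact tsum_of_norm_bounded ((hd.mul_right (B*K)).hasSum) (fun n => hb n φ)
  · have e3 : (fun n => d n * jacobiInner α β ψ (nJacobi α β c n)) =
        fun n => ∫ φ, ψ φ * (d n * nJacobi α β c n φ) ∂(jacobiMeasure α β) := by
      funext n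
      unfold jacobiInner
      rw [← integral_const_mul]
      congr 1; funext φ; ring
    rw [e3]
    exact hS

lemma TF_L2 (H : JH α β c) {σ B : ℝ} (hσ : 0 < σ) (hB : 0 ≤ B) {ψ : ℝ → ℝ} (T : TF σ B ψ) {d : ℕ → ℝ}
    (hd : Summable (fun n => |d n|)) {Q : ℝ} (hQ : ∀ M, ∑ n ∈ Finset.range M, d n^2 ≤ Q) {r : ℝ} (hr : 0 < r) :
    ∫ φ, |ψ φ * jF α β c d φ| ∂(jacobiMeasure α β) ≤ r/2 * ∫ φ, ψ φ^2 ∂(jacobiMeasure α β) + Q/(2*r) := by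
  haveI := jm_finite α β H.hα H.hβ
  obtain ⟨K, hK, h⟩ := H.TF_P hσ
  have hpart : ∀ M φ, ∑ n ∈ Finset.range M, ψ φ * (d n * nJacobi α β c n φ) =
    ψ φ * ∑ n ∈ Finset.range M, d n * nJacobi α β c n φ := fun M φ => by rw [Finset.mul_sum]
  have hb : ∀ n φ, |ψ φ * (d n * nJacobi α β c n φ)| ≤ |d n| * (B*K) := by
    intro n φ
    rw [mul_left_comm, abs_mul]
    exact mul_le_mul_of_nonneg_left (h B ψ hB T n φ) (abs_nonneg _)
  have hcont : ∀ M, Continuous (fun φ => ∑ n ∈ Finset.range M, d n * nJacobi α β c n φ) := fun M =>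
    continuous_finset_sum _ (fun n _ => (nJ_cont α β c n).const_mul _)
  have lim : Tendsto (fun M => ∫ φ, |∑ n ∈ Finset.range M, ψ φ * (d n * nJacobi α β c n φ)| ∂(jacobiMeasure α β))
      atTop (𝓝 (∫ φ, |ψ φ * jF α β c d φ| ∂(jacobiMeasure α β))) := by
    apply tendsto_integral_of_dominated_convergence (fun _ => ∑' n, |d n| * (B*K))
    · intro M
      simp_rw [hpart]
      exact (T.m.mul (hcont M).measurable).abs.aestronglyMeasurable
    · exact integrable_const _
    · intro M
      refine Eventually.of_forall (fun φ => ?_)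
      rw [Real.norm_eq_abs, abs_abs]
      refine (Finset.abs_sum_le_sum_abs _ _).trans ?_
      refine (Finset.sum_le_sum (fun n _ => hb n φ)).trans ?_
      exact (hd.mul_right (B*K)).sum_le_tsum _ (fun n _ => by positivity)
    · exact Eventually.of_forall (fun φ => (H.TF_hasSum hσ hB T hd φ).tendsto_sum_nat.abs)
  have i1 : Integrable (fun φ => ψ φ^2) (jacobiMeasure α β) := by
    refine Integrable.of_bound (T.m.pow_const 2).aestronglyMeasurable (B^2) (Eventually.of_forall (fun φ => ?_))
    rw [Real.norm_eq_abs, abs_pow]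
    exact pow_le_pow_left₀ (abs_nonneg _) (T.b φ) 2
  apply le_of_tendsto lim
  refine Eventually.of_forall (fun M => ?_)
  have i2 : Integrable (fun φ => (∑ n ∈ Finset.range M, d n * nJacobi α β c n φ)^2) (jacobiMeasure α β) :=
    int_of_cont α β H.hα H.hβ _ ((hcont M).pow 2)
  calc ∫ φ, |∑ n ∈ Finset.range M, ψ φ * (d n * nJacobi α β c n φ)| ∂(jacobiMeasure α β)
      ≤ ∫ φ, (r/2 * ψ φ^2 + 1/(2*r) * (∑ n ∈ Finset.range M, d n * nJacobi α β c n φ)^2) ∂(jacobiMeasure α β) := by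
        apply integral_mono_of_nonneg (Eventually.of_forall (fun _ => abs_nonneg _)) ((i1.const_mul _).add (i2.const_mul _))
        refine Eventually.of_forall (fun φ => ?_)
        simp only [hpart, Pi.add_apply]
        set S := ∑ n ∈ Finset.range M, d n * nJacobi α β c n φ
        rw [abs_mul]
        have e1 : r/2 * ψ φ^2 + 1/(2*r) * S^2 - |ψ φ| * |S| = (r * |ψ φ| - |S|)^2 / (2*r) := by
          rw [← sq_abs (ψ φ), ← sq_abs S]
          field_simp
          ring
        have : 0 ≤ (r * |ψ φ| - |S|)^2 / (2*r) := by positivity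
        linarith
    _ = r/2 * ∫ φ, ψ φ^2 ∂(jacobiMeasure α β) + 1/(2*r) * ∑ n ∈ Finset.range M, d n^2 := by
        rw [integral_add (i1.const_mul _) (i2.const_mul _), integral_const_mul, integral_const_mul, H.sq_sum]
    _ ≤ _ := by
        have : 1/(2*r) * ∑ n ∈ Finset.range M, d n^2 ≤ 1/(2*r) * Q := by
          apply mul_le_mul_of_nonneg_left (hQ M); positivity
        have e : 1/(2*r) * Q = Q/(2*r) := by ring
        linarith

end JH

end

section
open Polynomial Topology

/-- shifted frequencies (the frequency zero is replaced by the first one) -/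
def nu (α β : ℝ) (n : ℕ) : ℝ := ((max n 1 : ℕ):ℝ) + jacobiTau α β

/-- coefficients of the differentiated Poisson kernel -/
def wt (α β : ℝ) (c : ℕ → ℝ) (N : ℕ) (t θ : ℝ) (n : ℕ) : ℝ := Real.exp (-t * nu α β n) * jv α β c N n θ

/-- commutator with the Jacobi matrix -/
def cm (α β : ℝ) (c : ℕ → ℝ) (θ : ℝ) (w : ℕ → ℝ) (n : ℕ) : ℝ :=
  Real.cos θ * w n - (jbm α β c n * w (n-1) + ja α β c n * w n + jb α β c n * w (n+1))

lemma summable_pe (k : ℕ) {r : ℝ} (hr : 0 < r) : Summable (fun n : ℕ => ((n:ℝ)+1)^k * Real.exp (-r * (n+1))) := by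
  have := (summable_nat_add_iff 1).2 (Real.summable_pow_mul_exp_neg_nat_mul k hr)
  refine this.congr (fun n => ?_)
  push_cast; rfl

lemma exp_diff_le {a b m : ℝ} (ha : m ≤ a) (hb : m ≤ b) : |Real.exp (-a) - Real.exp (-b)| ≤ |a - b| * Real.exp (-m) := by
  have key : ∀ a b : ℝ, a ≤ b → m ≤ a → |Real.exp (-a) - Real.exp (-b)| ≤ |a - b| * Real.exp (-m) := by
    intro a b hab hm
    have h1 : Real.exp (-b) ≤ Real.exp (-a) := Real.exp_le_exp.2 (by linarith)
    rw [abs_of_nonneg (by linarith), abs_of_nonpos (by linarith)]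
    have h2 : Real.exp (-b) = Real.exp (-a) * Real.exp (a-b) := by rw [← Real.exp_add]; congr 1; ring
    have h3 := Real.add_one_le_exp (a-b)
    have h4 : Real.exp (-a) ≤ Real.exp (-m) := Real.exp_le_exp.2 (by linarith)
    rw [h2]
    have h5 := Real.exp_pos (-a)
    nlinarith
  rcases le_total a b with h | h
  · exact key a b h ha
  · rw [abs_sub_comm, abs_sub_comm a b]; exact key b a h hb

lemma HasSum.congr_fun' {f g : ℕ → ℝ} {a : ℝ} (h : HasSum f a) (e : ∀ n, f n = g n) : HasSum g a := by
  rwa [show g = f from funext (fun n => (e n).symm)]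

namespace JH
variable {α β : ℝ} {c : ℕ → ℝ}

lemma nu_lower (H : JH α β c) (n : ℕ) : ((n:ℝ)+1)/4 ≤ nu α β n := by
  have h1 := H.hα
  have h2 := H.hβ
  unfold nu jacobiTau
  rcases n with _ | n
  · simp; linarith
  · rw [max_eq_left (by omega)]
    push_cast
    have : (0:ℝ) ≤ n := Nat.cast_nonneg n
    linarith

lemma nu_lower' (H : JH α β c) (n : ℕ) : ((n:ℝ)+1)/8 ≤ nu α β (n-1) := by
  refine le_trans ?_ (H.nu_lower (n-1))
  rcases n with _ | n
  · simp; norm_num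
  · simp only [Nat.add_sub_cancel]; push_cast
    have : (0:ℝ) ≤ n := Nat.cast_nonneg n
    linarith

lemma nu_step (n : ℕ) : |nu α β (n+1) - nu α β n| ≤ 1 := by
  unfold nu
  rcases n with _ | n
  · simp
  · rw [max_eq_left (by omega), max_eq_left (by omega)]; push_cast
    rw [show ((n:ℝ)+1+1+jacobiTau α β - ((n:ℝ)+1+jacobiTau α β)) = 1 by ring]; simp

lemma nu_eq (H : JH α β c) (n : ℕ) : nu α β (n+1) = |((n:ℝ)+1) + jacobiTau α β| := by
  have h := H.nu_lower (n+1)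
  unfold nu at *
  rw [max_eq_left (by omega)] at *
  push_cast at *
  rw [abs_of_nonneg]
  have : (0:ℝ) ≤ n := Nat.cast_nonneg n
  linarith

lemma jv_at_zero (H : JH α β c) (m : ℕ) (θ : ℝ) : jv α β c (m+1) 0 θ = 0 := by
  have h := H.natDeg 0
  have h1 : (pp α β c 0) = C ((pp α β c 0).coeff 0) := Polynomial.eq_C_of_natDegree_le_zero h
  unfold jv
  rw [nJ_eq, h1]
  simp only [eval_C]
  rw [iteratedDeriv_const]; simp

lemma wt_bound (H : JH α β c) {σ : ℝ} (hσ : 0 < σ) (N : ℕ) : ∃ K, 0 ≤ K ∧ ∀ θ ∈ sS σ, ∀ t, 0 < t → ∀ n : ℕ,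
    |wt α β c N t θ n| ≤ K * (((n:ℝ)+1)^N * Real.exp (-(t/4) * (n+1))) := by
  obtain ⟨K, hK, h⟩ := H.od_v hσ N
  refine ⟨K, hK, fun θ hθ t ht n => ?_⟩
  have h1 := h θ hθ n
  rw [zpow_natCast] at h1
  unfold wt
  rw [abs_mul, abs_of_pos (Real.exp_pos _), mul_comm, ← mul_assoc]
  have h2 := H.nu_lower n
  have h3 : Real.exp (-t * nu α β n) ≤ Real.exp (-(t/4) * (n+1)) := Real.exp_le_exp.2 (by nlinarith)
  exact mul_le_mul h1 h3 (Real.exp_pos _).le (by positivity)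

lemma wt_summable (H : JH α β c) {σ : ℝ} (hσ : 0 < σ) (N : ℕ) {θ : ℝ} (hθ : θ ∈ sS σ) {t : ℝ} (ht : 0 < t) :
    Summable (fun n => |wt α β c N t θ n|) := by
  obtain ⟨K, hK, h⟩ := H.wt_bound hσ N
  exact Summable.of_nonneg_of_le (fun _ => abs_nonneg _) (h θ hθ t ht) ((summable_pe N (by linarith)).mul_left K)

lemma ker_deriv (H : JH α β c) {σ r θ : ℝ} (hσ : 0 < σ) (hr : 0 < r) (hU : Metric.ball θ r ⊆ sS σ)
    {t φ : ℝ} (ht : 0 < t) (hφ : φ ∈ sS σ) (N : ℕ) :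
    ∀ x ∈ Metric.ball θ r, iteratedDeriv N (fun θ' => poissonKer α β c t θ' φ) x =
      ∑' n : ℕ, Real.exp (-t * |(n:ℝ) + jacobiTau α β|) * jv α β c N n x * nJacobi α β c n φ := by
  obtain ⟨K, hK, hP⟩ := H.od_P hσ
  have hb : ∀ j : ℕ, ∃ u : ℕ → ℝ, Summable u ∧ ∀ n : ℕ, ∀ x ∈ Metric.ball θ r,
      ‖Real.exp (-t * |(n:ℝ) + jacobiTau α β|) * jv α β c j n x * nJacobi α β c n φ‖ ≤ u n := by
    intro j
    obtain ⟨C, hC, h⟩ := H.od_v hσ j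
    refine ⟨fun n => (Real.exp (t * (|jacobiTau α β| + 1)) * C * K) * (((n:ℝ)+1)^j * Real.exp (-t * (n+1))),
      (summable_pe j ht).mul_left _, fun n x hx => ?_⟩
    have h1 := h x (hU hx) n
    have h2 := hP φ hφ n
    rw [zpow_natCast] at h1
    rw [zpow_zero, mul_one] at h2
    rw [norm_mul, norm_mul, Real.norm_eq_abs, Real.norm_eq_abs, Real.norm_eq_abs, abs_of_pos (Real.exp_pos _)]
    have h3 : Real.exp (-t * |(n:ℝ) + jacobiTau α β|) ≤ Real.exp (t * (|jacobiTau α β| + 1)) * Real.exp (-t * (n+1)) := by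
      rw [← Real.exp_add]
      apply Real.exp_le_exp.2
      have : (n:ℝ) - |jacobiTau α β| ≤ |(n:ℝ) + jacobiTau α β| := by
        have a1 := le_abs_self ((n:ℝ) + jacobiTau α β)
        have a2 := neg_abs_le (jacobiTau α β)
        linarith
      nlinarith
    calc _ ≤ (Real.exp (t * (|jacobiTau α β| + 1)) * Real.exp (-t * (n+1))) * (C * ((n:ℝ)+1)^j) * K := by
          gcongr
      _ = _ := by ring
  induction N with
  | zero =>
    intro x hx
    simp only [iteratedDeriv_zero, poissonKer, jv_zero]
  | succ N ih =>
    intro x hx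
    rw [iteratedDeriv_succ]
    have hev : iteratedDeriv N (fun θ' => poissonKer α β c t θ' φ) =ᶠ[𝓝 x] fun x =>
      ∑' n : ℕ, Real.exp (-t * |(n:ℝ) + jacobiTau α β|) * jv α β c N n x * nJacobi α β c n φ := by
      filter_upwards [Metric.isOpen_ball.mem_nhds hx] with y hy using ih y hy
    rw [hev.deriv_eq]
    obtain ⟨u, hu, h1⟩ := hb (N+1)
    obtain ⟨u', hu', h1'⟩ := hb N
    apply HasDerivAt.deriv
    apply hasDerivAt_tsum_of_isPreconnected hu Metric.isOpen_ball (convex_ball θ r).isPreconnected ?_ h1 hx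
      (Summable.of_norm_bounded hu' (fun n => h1' n x hx)) hx
    intro n y hy
    exact ((jv_hasDeriv α β c N n y).const_mul _).mul_const _

lemma ker_eq (H : JH α β c) {σ r θ : ℝ} (hσ : 0 < σ) (hr : 0 < r) (hU : Metric.ball θ r ⊆ sS σ)
    {t φ : ℝ} (ht : 0 < t) (hφ : φ ∈ sS σ) (m : ℕ) :
    iteratedDeriv (m+1) (fun θ' => poissonKer α β c t θ' φ) θ = jF α β c (wt α β c (m+1) t θ) φ := by
  rw [H.ker_deriv hσ hr hU ht hφ (m+1) θ (Metric.mem_ball_self hr)]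
  unfold jF
  apply tsum_congr
  intro n
  unfold wt
  rcases n with _ | n
  · simp [H.jv_at_zero]
  · rw [H.nu_eq]; push_cast; rfl

lemma comm_jF (H : JH α β c) {σ θ φ : ℝ} (hσ : 0 < σ) (hφ : φ ∈ sS σ) {w : ℕ → ℝ} (hw : Summable (fun n => |w n|)) :
    (Real.cos θ - Real.cos φ) * jF α β c w φ = jF α β c (cm α β c θ w) φ := by
  obtain ⟨K, hK, hP⟩ := H.od_P hσ
  obtain ⟨B, hB, hb⟩ := H.od_b univ
  obtain ⟨A, hA, ha⟩ := (H.od_a univ).mono (show (-2:ℤ) ≤ 0 by norm_num)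
  have hP' : ∀ n, |nJacobi α β c n φ| ≤ K := fun n => by have := hP φ hφ n; rwa [zpow_zero, mul_one] at this
  have hb' : ∀ n, |jb α β c n| ≤ B := fun n => by have := hb 0 trivial n; rwa [zpow_zero, mul_one] at this
  have ha' : ∀ n, |ja α β c n| ≤ A := fun n => by have := ha 0 trivial n; rwa [zpow_zero, mul_one] at this
  have s0 : Summable (fun n => w n * nJacobi α β c n φ) := by
    refine Summable.of_norm_bounded (hw.mul_right K) (fun n => ?_)
    rw [norm_mul]; exact mul_le_mul_of_nonneg_left (hP' n) (abs_nonneg _)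
  have s1 : Summable (fun n => w n * (jb α β c n * nJacobi α β c (n+1) φ)) := by
    refine Summable.of_norm_bounded (hw.mul_right (B*K)) (fun n => ?_)
    rw [norm_mul, norm_mul]
    exact mul_le_mul_of_nonneg_left (mul_le_mul (hb' n) (hP' _) (abs_nonneg _) hB) (abs_nonneg _)
  have s2 : Summable (fun n => w n * (ja α β c n * nJacobi α β c n φ)) := by
    refine Summable.of_norm_bounded (hw.mul_right (A*K)) (fun n => ?_)
    rw [norm_mul, norm_mul]
    exact mul_le_mul_of_nonneg_left (mul_le_mul (ha' n) (hP' _) (abs_nonneg _) hA) (abs_nonneg _)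
  have s3 : Summable (fun n => w (n+1) * (jb α β c n * nJacobi α β c n φ)) := by
    refine Summable.of_norm_bounded (((summable_nat_add_iff 1).2 hw).mul_right (B*K)) (fun n => ?_)
    rw [norm_mul, norm_mul]
    exact mul_le_mul_of_nonneg_left (mul_le_mul (hb' n) (hP' _) (abs_nonneg _) hB) (abs_nonneg _)
  -- reindexed versions
  have r1 : HasSum (fun n => jbm α β c n * w (n-1) * nJacobi α β c n φ)
      (∑' n, w n * (jb α β c n * nJacobi α β c (n+1) φ)) := by
    rw [← hasSum_nat_add_iff' 1]
    simp only [Finset.range_one, Finset.sum_singleton, jbm, zero_mul, sub_zero, Nat.add_sub_cancel]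
    refine s1.hasSum.congr_fun' ?_
    intro n; ring
  have r3 : HasSum (fun n => w n * (jbm α β c n * nJacobi α β c (n-1) φ))
      (∑' n, w (n+1) * (jb α β c n * nJacobi α β c n φ)) := by
    rw [← hasSum_nat_add_iff' 1]
    simp only [Finset.range_one, Finset.sum_singleton, jbm, zero_mul, mul_zero, sub_zero, Nat.add_sub_cancel]
    exact s3.hasSum
  have hR : HasSum (fun n => cm α β c θ w n * nJacobi α β c n φ)
      (Real.cos θ * (∑' n, w n * nJacobi α β c n φ) - ((∑' n, w n * (jb α β c n * nJacobi α β c (n+1) φ)) +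
      (∑' n, w n * (ja α β c n * nJacobi α β c n φ)) + ∑' n, w (n+1) * (jb α β c n * nJacobi α β c n φ))) := by
    refine ((s0.hasSum.mul_left (Real.cos θ)).sub ((r1.add s2.hasSum).add s3.hasSum)).congr_fun' ?_
    intro n; unfold cm; ring
  have hL : HasSum (fun n => (Real.cos θ - Real.cos φ) * (w n * nJacobi α β c n φ))
      (Real.cos θ * (∑' n, w n * nJacobi α β c n φ) - ((∑' n, w n * (jb α β c n * nJacobi α β c (n+1) φ)) +
      (∑' n, w n * (ja α β c n * nJacobi α β c n φ)) + ∑' n, w (n+1) * (jb α β c n * nJacobi α β c n φ))) := by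
    refine ((s0.hasSum.mul_left (Real.cos θ)).sub ((s1.hasSum.add s2.hasSum).add r3)).congr_fun' ?_
    intro n
    have := H.recurP n φ
    linear_combination w n * this
  unfold jF
  rw [hR.tsum_eq, ← hL.tsum_eq, tsum_mul_left]

end JH

end

section
open Polynomial Topology

/-- the time profile -/
def At (m : ℕ) (t : ℝ) : ℝ := t ^ (-((m:ℝ) + 3/4)) * Real.exp (-(t/16))

lemma At_pos (m : ℕ) {t : ℝ} (ht : 0 < t) : 0 < At m t := mul_pos (Real.rpow_pos_of_pos ht _) (Real.exp_pos _)

lemma profile_bound (m : ℕ) : ∃ C, 0 ≤ C ∧ ∀ y : ℝ, 0 < y →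
    (1+y) * Real.exp (-(y/8)) ≤ C * At m y := by
  refine ⟨16^(m+2) * (Nat.factorial (m+2)) * Real.exp (1/16), by positivity, fun y hy => ?_⟩
  have h1 := Real.pow_div_factorial_le_exp ((1+y)/16) (by positivity) (m+2)
  have h2 : y ^ ((m:ℝ) + 3/4) ≤ (1+y)^(m+1) := by
    rw [← Real.rpow_natCast]
    refine (Real.rpow_le_rpow hy.le (by linarith : y ≤ 1+y) (by positivity)).trans ?_
    apply Real.rpow_le_rpow_of_exponent_le (by linarith)
    push_cast; linarith
  have h3 : (1+y)^(m+2) ≤ 16^(m+2) * (Nat.factorial (m+2)) * Real.exp ((1+y)/16) := by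
    rw [div_pow, div_div, div_le_iff₀ (by positivity)] at h1
    linarith
  have h4 : Real.exp ((1+y)/16) = Real.exp (1/16) * Real.exp (y/16) := by rw [← Real.exp_add]; congr 1; ring
  have h5 : Real.exp (-(y/8)) = Real.exp (-(y/16)) * Real.exp (-(y/16)) := by rw [← Real.exp_add]; congr 1; ring
  have h6 : Real.exp (y/16) * Real.exp (-(y/16)) = 1 := by rw [← Real.exp_add]; simp
  unfold At
  rw [Real.rpow_neg hy.le]
  have hp : 0 < y ^ ((m:ℝ) + 3/4) := Real.rpow_pos_of_pos hy _
  rw [← mul_assoc, ← div_eq_mul_inv, div_mul_eq_mul_div, le_div_iff₀ hp, h5]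
  have he := Real.exp_pos (-(y/16))
  calc (1+y) * (Real.exp (-(y/16)) * Real.exp (-(y/16))) * y ^ ((m:ℝ) + 3/4)
      ≤ (1+y) * (Real.exp (-(y/16)) * Real.exp (-(y/16))) * (1+y)^(m+1) := by gcongr
    _ = (1+y)^(m+2) * (Real.exp (-(y/16)) * Real.exp (-(y/16))) := by ring
    _ ≤ (16^(m+2) * (Nat.factorial (m+2)) * Real.exp ((1+y)/16)) * (Real.exp (-(y/16)) * Real.exp (-(y/16))) := by gcongr
    _ = (16^(m+2) * (Nat.factorial (m+2)) * Real.exp (1/16)) * (Real.exp (y/16) * Real.exp (-(y/16))) * Real.exp (-(y/16)) := by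
        rw [h4]; ring
    _ = _ := by rw [h6]; ring

lemma At_mul (m n : ℕ) {t : ℝ} (ht : 0 < t) :
    ((n:ℝ)+1)^m * At m (t*(n+1)) ≤ At m t * ((n:ℝ)+1)^(-(3/4:ℝ)) := by
  have hn : (0:ℝ) < (n:ℝ)+1 := by positivity
  unfold At
  rw [Real.mul_rpow ht.le hn.le]
  have e : ((n:ℝ)+1)^m * ((n:ℝ)+1)^(-((m:ℝ)+3/4)) = ((n:ℝ)+1)^(-(3/4:ℝ)) := by
    rw [← Real.rpow_natCast, ← Real.rpow_add hn]; congr 1; ring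
  have h1 : Real.exp (-(t*(n+1)/16)) ≤ Real.exp (-(t/16)) := by
    apply Real.exp_le_exp.2
    have : (0:ℝ) ≤ n := Nat.cast_nonneg n
    nlinarith
  calc _ = t ^ (-((m:ℝ) + 3/4)) * ((((n:ℝ)+1)^m * ((n:ℝ)+1)^(-((m:ℝ)+3/4)))) * Real.exp (-(t*(n+1)/16)) := by ring
    _ ≤ t ^ (-((m:ℝ) + 3/4)) * ((n:ℝ)+1)^(-(3/4:ℝ)) * Real.exp (-(t/16)) := by
        rw [e]; gcongr
    _ = _ := by ring

namespace JH
variable {α β : ℝ} {c : ℕ → ℝ}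

lemma cos_rec (H : JH α β c) (j n : ℕ) (θ : ℝ) : Real.cos θ * jv α β c j n θ
    - (jbm α β c n * jv α β c j (n-1) θ + ja α β c n * jv α β c j n θ + jb α β c n * jv α β c j (n+1) θ) =
    - ∑ i ∈ Finset.range j, ((j.choose (i+1) : ℝ) * iteratedDeriv (i+1) Real.cos θ) * jv α β c (j-(i+1)) n θ := by
  have hfun : (fun θ => Real.cos θ * nJacobi α β c n θ) = fun θ =>
    jb α β c n * nJacobi α β c (n+1) θ + ja α β c n * nJacobi α β c n θ + jbm α β c n * nJacobi α β c (n-1) θ :=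
    funext (H.recurP n)
  have h := congrArg (fun g => iteratedDeriv j g θ) hfun
  have sm : ∀ n, ContDiffAt ℝ j (nJacobi α β c n) θ := fun n => (nJ_smooth α β c n j).contDiffAt
  rw [iteratedDeriv_fun_mul Real.contDiff_cos.contDiffAt (sm n)] at h
  rw [iteratedDeriv_fun_add ((contDiffAt_const.mul (sm _)).add (contDiffAt_const.mul (sm _))) (contDiffAt_const.mul (sm _)),
    iteratedDeriv_fun_add (contDiffAt_const.mul (sm _)) (contDiffAt_const.mul (sm _)),
    iteratedDeriv_const_mul_field, iteratedDeriv_const_mul_field, iteratedDeriv_const_mul_field,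
    Finset.sum_range_succ'] at h
  simp only [Nat.choose_zero_right, Nat.cast_one, one_mul, iteratedDeriv_zero, Nat.sub_zero] at h
  unfold jv
  linarith

lemma od_lower_cos (H : JH α β c) (m : ℕ) {σ : ℝ} (hσ : 0 < σ) :
    Od (sS σ) m (fun θ n => ∑ i ∈ Finset.range (m+1),
      (((m+1).choose (i+1) : ℝ) * iteratedDeriv (i+1) Real.cos θ) * jv α β c (m+1-(i+1)) n θ) := by
  apply Od.sum
  intro i hi
  have h1 := (H.od_v hσ (m+1-(i+1))).mono (show ((m+1-(i+1):ℕ):ℤ) ≤ m by omega)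
  refine h1.bmul (fun θ => ((m+1).choose (i+1) : ℝ) * iteratedDeriv (i+1) Real.cos θ) ((m+1).choose (i+1)) ?_
  intro θ _
  rw [abs_mul, Nat.abs_cast]
  exact mul_le_of_le_one_right (by positivity) (Real.abs_iteratedDeriv_cos_le_one _ _)

lemma cm_bound (H : JH α β c) (m : ℕ) {σ : ℝ} (hσ : 0 < σ) : ∃ K, 0 ≤ K ∧ ∀ θ ∈ sS σ, ∀ t, 0 < t → ∀ n : ℕ,
    |cm α β c θ (wt α β c (m+1) t θ) n| ≤ K * (((n:ℝ)+1)^m * ((1+t*(n+1)) * Real.exp (-(t*(n+1)/8)))) := by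
  obtain ⟨L, hL, hl⟩ := H.od_lower_cos m hσ
  obtain ⟨U, hU, hu⟩ := (H.od_b (sS σ)).mul (H.od_v hσ (m+1)).up
  obtain ⟨D, hD, hd⟩ := (H.od_bm (sS σ)).mul (H.od_v hσ (m+1)).down
  refine ⟨L + U + D, by positivity, fun θ hθ t ht n => ?_⟩
  have l1 := hl θ hθ n
  have u1 := hu θ hθ n
  have d1 := hd θ hθ n
  rw [zero_add, zpow_natCast] at u1 d1
  rw [zpow_natCast] at l1
  have e : cm α β c θ (wt α β c (m+1) t θ) n = - (Real.exp (-t * nu α β n) *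
      ∑ i ∈ Finset.range (m+1), (((m+1).choose (i+1) : ℝ) * iteratedDeriv (i+1) Real.cos θ) * jv α β c (m+1-(i+1)) n θ)
      + (Real.exp (-(t * nu α β n)) - Real.exp (-(t * nu α β (n-1)))) * (jbm α β c n * jv α β c (m+1) (n-1) θ)
      + (Real.exp (-(t * nu α β n)) - Real.exp (-(t * nu α β (n+1)))) * (jb α β c n * jv α β c (m+1) (n+1) θ) := by
    unfold cm wt
    simp only [neg_mul]
    linear_combination Real.exp (-(t * nu α β n)) * H.cos_rec (m+1) n θ
  have b0 := H.nu_lower n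
  have b1 := H.nu_lower' n
  have b2 := H.nu_lower (n+1)
  push_cast at b2
  have hn : (0:ℝ) ≤ n := Nat.cast_nonneg n
  have e0 : Real.exp (-t * nu α β n) ≤ Real.exp (-(t*(n+1)/8)) := Real.exp_le_exp.2 (by nlinarith)
  have c0 : t*(n+1)/8 ≤ t * nu α β n := by nlinarith
  have c1 : t*(n+1)/8 ≤ t * nu α β (n-1) := by nlinarith
  have c2 : t*(n+1)/8 ≤ t * nu α β (n+1) := by nlinarith
  have st1 : |t * nu α β n - t * nu α β (n+1)| ≤ t := by
    rw [← mul_sub, abs_mul, abs_of_pos ht, abs_sub_comm]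
    exact mul_le_of_le_one_right ht.le (nu_step n)
  have st2 : |t * nu α β n - t * nu α β (n-1)| ≤ t := by
    rw [← mul_sub, abs_mul, abs_of_pos ht]
    rcases n with _ | n
    · simp; exact ht.le
    · exact mul_le_of_le_one_right ht.le (nu_step n)
  have x1 := (exp_diff_le c0 c1).trans (mul_le_mul_of_nonneg_right st2 (Real.exp_pos _).le)
  have x2 := (exp_diff_le c0 c2).trans (mul_le_mul_of_nonneg_right st1 (Real.exp_pos _).le)
  set E := Real.exp (-(t*(n+1)/8)) with hE
  have hE0 : 0 < E := Real.exp_pos _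
  rw [e]
  have tri : ∀ a b d : ℝ, |-a + b + d| ≤ |a| + |b| + |d| := fun a b d => by
    have := abs_add_three (-a) b d; rwa [abs_neg] at this
  refine (tri _ _ _).trans ?_
  rw [abs_mul (Real.exp (-t * nu α β n)), abs_mul (Real.exp (-(t * nu α β n)) - Real.exp (-(t * nu α β (n-1)))),
    abs_mul (Real.exp (-(t * nu α β n)) - Real.exp (-(t * nu α β (n+1)))), abs_of_pos (Real.exp_pos (-t * nu α β n))]
  have y0 := mul_le_mul e0 l1 (abs_nonneg _) hE0.le
  have y1 := mul_le_mul x1 d1 (abs_nonneg _) (by positivity)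
  have y2 := mul_le_mul x2 u1 (abs_nonneg _) (by positivity)
  refine (add_le_add (add_le_add y0 y1) y2).trans ?_
  rw [pow_succ]
  have hp : (0:ℝ) ≤ ((n:ℝ)+1)^m := by positivity
  have z1 : 0 ≤ L * (((n:ℝ)+1)^m * (t*(n+1) * E)) := by positivity
  have z2 : 0 ≤ U * (((n:ℝ)+1)^m * E) := by positivity
  have z3 : 0 ≤ D * (((n:ℝ)+1)^m * E) := by positivity
  linarith

lemma cm_bound2 (H : JH α β c) (m : ℕ) {σ : ℝ} (hσ : 0 < σ) : ∃ K, 0 ≤ K ∧ ∀ θ ∈ sS σ, ∀ t, 0 < t → ∀ n : ℕ,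
    |cm α β c θ (wt α β c (m+1) t θ) n| ≤ K * (At m t * ((n:ℝ)+1)^(-(3/4:ℝ))) := by
  obtain ⟨K, hK, h⟩ := H.cm_bound m hσ
  obtain ⟨C, hC, h'⟩ := profile_bound m
  refine ⟨K * C, by positivity, fun θ hθ t ht n => (h θ hθ t ht n).trans ?_⟩
  have hn : (0:ℝ) < (n:ℝ)+1 := by positivity
  have h1 := h' (t*(n+1)) (by positivity)
  have h2 := At_mul m n ht
  calc _ ≤ K * (((n:ℝ)+1)^m * (C * At m (t*(n+1)))) := by gcongr
    _ = K * C * (((n:ℝ)+1)^m * At m (t*(n+1))) := by ring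
    _ ≤ _ := by gcongr

lemma cm_summable (H : JH α β c) (m : ℕ) {σ : ℝ} (hσ : 0 < σ) {θ : ℝ} (hθ : θ ∈ sS σ) {t : ℝ} (ht : 0 < t) :
    Summable (fun n => |cm α β c θ (wt α β c (m+1) t θ) n|) := by
  obtain ⟨K, hK, h⟩ := H.cm_bound m hσ
  refine Summable.of_nonneg_of_le (fun _ => abs_nonneg _) (h θ hθ t ht) (Summable.mul_left K ?_)
  have s1 := summable_pe m (show 0 < t/8 by linarith)
  have s2 := (summable_pe (m+1) (show 0 < t/8 by linarith)).mul_left t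
  refine (s1.add s2).congr (fun n => ?_)
  have e : -(t/8) * ((n:ℝ)+1) = -(t*(n+1)/8) := by ring
  rw [e]; ring

lemma F_bound (H : JH α β c) (m : ℕ) {σ : ℝ} (hσ : 0 < σ) {θ : ℝ} (hθ : θ ∈ sS σ) {B κ : ℝ} (hB : 0 ≤ B) (hκ : 0 < κ)
    {ψ : ℝ → ℝ} (T : TF σ B ψ) (hψ : ∀ φ, ψ φ ≠ 0 → κ ≤ |Real.cos θ - Real.cos φ|) :
    ∃ C, 0 ≤ C ∧ ∀ t, 0 < t → ∫ φ, |ψ φ * jF α β c (wt α β c (m+1) t θ) φ| ∂(jacobiMeasure α β) ≤ C * At m t := by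
  obtain ⟨K, hK, h⟩ := H.cm_bound2 m hσ
  set ψ' : ℝ → ℝ := fun φ => ψ φ / (Real.cos θ - Real.cos φ) with hψ'
  have T' : TF σ (B/κ) ψ' := by
    refine ⟨T.m.div (by fun_prop), fun φ => ?_, fun φ hφ => by simp [hψ', T.z φ hφ]⟩
    simp only [hψ', abs_div]
    by_cases h0 : ψ φ = 0
    · rw [h0]; simp; positivity
    · exact div_le_div₀ hB (T.b φ) hκ (hψ φ h0)
  have hZ : Summable (fun n : ℕ => ((n:ℝ)+1)^(-(3/2:ℝ))) := by
    have := (summable_nat_add_iff 1).2 (Real.summable_nat_rpow.2 (show (-(3/2:ℝ)) < -1 by norm_num))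
    refine this.congr (fun n => by push_cast; rfl)
  set Z := ∑' n : ℕ, ((n:ℝ)+1)^(-(3/2:ℝ)) with hZdef
  set I := ∫ φ, ψ' φ^2 ∂(jacobiMeasure α β) with hI
  have hI0 : 0 ≤ I := integral_nonneg (fun _ => sq_nonneg _)
  have hZ0 : 0 ≤ Z := tsum_nonneg (fun n => by positivity)
  refine ⟨I/2 + K^2*Z/2, by positivity, fun t ht => ?_⟩
  have hA := At_pos m ht
  have hQ : ∀ M, ∑ n ∈ Finset.range M, cm α β c θ (wt α β c (m+1) t θ) n ^2 ≤ K^2 * At m t^2 * Z := by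
    intro M
    calc _ ≤ ∑ n ∈ Finset.range M, K^2 * At m t^2 * ((n:ℝ)+1)^(-(3/2:ℝ)) := by
          apply Finset.sum_le_sum
          intro n _
          rw [← sq_abs]
          refine (pow_le_pow_left₀ (abs_nonneg _) (h θ hθ t ht n) 2).trans (le_of_eq ?_)
          rw [mul_pow, mul_pow, ← Real.rpow_natCast (((n:ℝ)+1)^(-(3/4:ℝ))) 2, ← Real.rpow_mul (by positivity)]
          norm_num
          ring
      _ = K^2 * At m t^2 * ∑ n ∈ Finset.range M, ((n:ℝ)+1)^(-(3/2:ℝ)) := by rw [Finset.mul_sum]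
      _ ≤ _ := by
          apply mul_le_mul_of_nonneg_left _ (by positivity)
          exact hZ.sum_le_tsum _ (fun n _ => by positivity)
  have key := H.TF_L2 hσ (by positivity) T' (H.cm_summable m hσ hθ ht) hQ hA
  have e : ∀ φ, |ψ φ * jF α β c (wt α β c (m+1) t θ) φ| = |ψ' φ * jF α β c (cm α β c θ (wt α β c (m+1) t θ)) φ| := by
    intro φ
    by_cases h0 : ψ φ = 0
    · simp [hψ', h0]
    · have hφ : φ ∈ sS σ := by by_contra hc; exact h0 (T.z φ hc)
      rw [← H.comm_jF hσ hφ (H.wt_summable hσ (m+1) hθ ht)]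
      have hne : Real.cos θ - Real.cos φ ≠ 0 := by
        intro h1
        have := hψ φ h0
        rw [h1, abs_zero] at this
        linarith
      congr 1
      simp only [hψ']
      field_simp
  simp_rw [e]
  rw [← hI] at key
  refine key.trans (le_of_eq ?_)
  field_simp

end JH

end

section
open Polynomial Topology

lemma At_int (m : ℕ) : IntegrableOn (fun t : ℝ => t^m * At m t) (Ioi 0) := by
  have h := integrableOn_rpow_mul_exp_neg_mul_rpow (p := 1) (s := -(3/4)) (b := 1/16) (by norm_num) (by norm_num) (by norm_num)
  refine h.congr_fun (fun t ht => ?_) measurableSet_Ioi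
  have ht' : (0:ℝ) < t := ht
  simp only [At]
  rw [Real.rpow_one, ← mul_assoc, ← Real.rpow_natCast, ← Real.rpow_add ht']
  congr 2 <;> ring

lemma At_mono (m : ℕ) {t s : ℝ} (ht : 0 < t) (hs : 0 ≤ s) : At m (t+s) ≤ At m t := by
  unfold At
  have h1 : (t+s) ^ (-((m:ℝ) + 3/4)) ≤ t ^ (-((m:ℝ) + 3/4)) :=
    Real.rpow_le_rpow_of_nonpos ht (by linarith) (by have : (0:ℝ) ≤ m := Nat.cast_nonneg m; linarith)
  have h2 : Real.exp (-((t+s)/16)) ≤ Real.exp (-(t/16)) := Real.exp_le_exp.2 (by linarith)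
  exact mul_le_mul h1 h2 (Real.exp_pos _).le (Real.rpow_pos_of_pos ht _).le

lemma abel_lemma (m : ℕ) (a ν : ℕ → ℝ) {K C : ℝ} (hν : ∀ n : ℕ, ((n:ℝ)+1)/4 ≤ ν n)
    (ha : ∀ n : ℕ, |a n| ≤ K * ((n:ℝ)+1)^(m+1))
    (hg : ∀ t, 0 < t → |∑' n, Real.exp (-t * ν n) * a n| ≤ C * At m t) :
    Tendsto (fun s => ∑' n, Real.exp (-s * ν n) * (a n / ν n^(m+1))) (𝓝[>] 0)
      (𝓝 ((1/Real.Gamma ((m+1:ℕ):ℝ)) * ∫ t in Ioi (0:ℝ), t^m * ∑' n, Real.exp (-t * ν n) * a n)) := by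
  have hν0 : ∀ n, 0 < ν n := fun n => lt_of_lt_of_le (by positivity) (hν n)
  have hK : 0 ≤ K := by have := (abs_nonneg _).trans (ha 0); simpa using this
  have hsum : ∀ t, 0 < t → Summable (fun n => |Real.exp (-t * ν n) * a n|) := by
    intro t ht
    refine Summable.of_nonneg_of_le (fun _ => abs_nonneg _) (fun n => ?_)
      ((summable_pe (m+1) (show 0 < t/4 by linarith)).mul_left K)
    rw [abs_mul, abs_of_pos (Real.exp_pos _)]
    have h1 : Real.exp (-t * ν n) ≤ Real.exp (-(t/4) * (n+1)) := Real.exp_le_exp.2 (by nlinarith [hν n])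
    calc _ ≤ Real.exp (-(t/4) * (n+1)) * (K * ((n:ℝ)+1)^(m+1)) := mul_le_mul h1 (ha n) (abs_nonneg _) (Real.exp_pos _).le
      _ = _ := by ring
  set g : ℝ → ℝ := fun t => ∑' n, Real.exp (-t * ν n) * a n with hgdef
  have hgs : ∀ t, 0 < t → HasSum (fun n => Real.exp (-t * ν n) * a n) (g t) := fun t ht =>
    (Summable.of_abs (hsum t ht)).hasSum
  have hG : 0 < Real.Gamma ((m+1:ℕ):ℝ) := Real.Gamma_pos_of_pos (by positivity)
  have hIntg : ∀ r : ℝ, 0 < r → IntegrableOn (fun t : ℝ => t^m * Real.exp (-r*t)) (Ioi 0) := by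
    intro r hr
    have h := integrableOn_rpow_mul_exp_neg_mul_rpow (p := 1) (s := m) (b := r)
      (by have : (0:ℝ) ≤ m := Nat.cast_nonneg m; linarith) (by norm_num) hr
    refine h.congr_fun (fun t ht => ?_) measurableSet_Ioi
    simp only [Real.rpow_one, Real.rpow_natCast]
  have hval : ∀ r : ℝ, 0 < r → ∫ t in Ioi (0:ℝ), t^m * Real.exp (-r*t) = Real.Gamma ((m+1:ℕ):ℝ) / r^(m+1) := by
    intro r hr
    have h := Real.integral_rpow_mul_exp_neg_mul_Ioi (a := ((m+1:ℕ):ℝ)) (r := r) (by positivity) hr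
    rw [Real.rpow_natCast] at h
    rw [show Real.Gamma ((m+1:ℕ):ℝ) / r^(m+1) = (1/r)^(m+1) * Real.Gamma ((m+1:ℕ):ℝ) by rw [div_pow, one_pow]; ring, ← h]
    apply setIntegral_congr_fun measurableSet_Ioi
    intro t ht
    simp only
    rw [show (((m+1:ℕ):ℝ) - 1) = (m:ℝ) by push_cast; ring, Real.rpow_natCast]
    congr 2; ring
  have key : ∀ s, 0 < s → ∑' n, Real.exp (-s * ν n) * (a n / ν n^(m+1)) =
      (1/Real.Gamma ((m+1:ℕ):ℝ)) * ∫ t in Ioi (0:ℝ), t^m * g (t+s) := by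
    intro s hs
    have e0 : ∀ n t, t^m * (Real.exp (-(t+s) * ν n) * a n) =
        (Real.exp (-s * ν n) * a n) * (t^m * Real.exp (-(ν n)*t)) := by
      intro n t
      have : Real.exp (-(t+s) * ν n) = Real.exp (-s * ν n) * Real.exp (-(ν n)*t) := by
        rw [← Real.exp_add]; congr 1; ring
      rw [this]; ring
    have hF : ∀ n, Integrable (fun t => t^m * (Real.exp (-(t+s) * ν n) * a n)) (volume.restrict (Ioi 0)) := by
      intro n
      simp_rw [e0]
      exact (hIntg (ν n) (hν0 n)).const_mul _
    have hS : Summable (fun n => ∫ t in Ioi (0:ℝ), ‖t^m * (Real.exp (-(t+s) * ν n) * a n)‖) := by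
      have e1 : ∀ n, ∫ t in Ioi (0:ℝ), ‖t^m * (Real.exp (-(t+s) * ν n) * a n)‖ =
          |Real.exp (-s * ν n) * a n| * (Real.Gamma ((m+1:ℕ):ℝ) / ν n^(m+1)) := by
        intro n
        rw [← hval _ (hν0 n), ← integral_const_mul]
        apply setIntegral_congr_fun measurableSet_Ioi
        intro t ht
        have ht' : (0:ℝ) < t := ht
        simp only
        rw [e0, norm_mul, Real.norm_eq_abs, Real.norm_of_nonneg (by positivity)]
      simp_rw [e1]
      refine Summable.of_nonneg_of_le (fun n => by have := hν0 n; positivity) (fun n => ?_)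
        ((hsum s hs).mul_right (Real.Gamma ((m+1:ℕ):ℝ) * 4^(m+1)))
      apply mul_le_mul_of_nonneg_left _ (abs_nonneg _)
      rw [div_le_iff₀ (pow_pos (hν0 n) _), mul_assoc, ← mul_pow]
      have : 1 ≤ 4 * ν n := by have := hν n; have h2 : (0:ℝ) ≤ n := Nat.cast_nonneg n; linarith
      exact le_mul_of_one_le_right hG.le (one_le_pow₀ this)
    have hh := hasSum_integral_of_summable_integral_norm hF hS
    have e2 : ∫ t in Ioi (0:ℝ), t^m * g (t+s) = ∫ t in Ioi (0:ℝ), ∑' n, t^m * (Real.exp (-(t+s) * ν n) * a n) := by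
      apply setIntegral_congr_fun measurableSet_Ioi
      intro t ht
      have ht' : (0:ℝ) < t := ht
      simp only
      rw [tsum_mul_left]
    rw [e2, ← hh.tsum_eq, ← tsum_mul_left]
    apply tsum_congr
    intro n
    simp_rw [e0]
    rw [integral_const_mul, hval _ (hν0 n)]
    field_simp
  have lim : Tendsto (fun s => ∫ t in Ioi (0:ℝ), t^m * g (t+s)) (𝓝[>] 0) (𝓝 (∫ t in Ioi (0:ℝ), t^m * g t)) := by
    apply tendsto_integral_filter_of_dominated_convergence (fun t => C * (t^m * At m t))
    · filter_upwards [self_mem_nhdsWithin] with s hs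
      have hs' : (0:ℝ) < s := hs
      apply aestronglyMeasurable_of_tendsto_ae atTop
        (f := fun M t => t^m * ∑ n ∈ Finset.range M, Real.exp (-(t+s) * ν n) * a n)
      · intro M
        exact (by fun_prop : Continuous (fun t:ℝ => t^m * ∑ n ∈ Finset.range M, Real.exp (-(t+s) * ν n) * a n)).aestronglyMeasurable
      · filter_upwards [ae_restrict_mem measurableSet_Ioi] with t ht
        have ht' : (0:ℝ) < t := ht
        exact ((hgs (t+s) (by linarith)).tendsto_sum_nat).const_mul _
    · filter_upwards [self_mem_nhdsWithin] with s hs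
      have hs' : (0:ℝ) < s := hs
      filter_upwards [ae_restrict_mem measurableSet_Ioi] with t ht
      have ht' : (0:ℝ) < t := ht
      rw [norm_mul, Real.norm_of_nonneg (by positivity)]
      have h1 := hg (t+s) (by linarith)
      have hC : 0 ≤ C := by
        have h2 := (abs_nonneg _).trans h1
        have h3 := At_pos m (show 0 < t+s by linarith)
        by_contra hneg
        rw [not_le] at hneg
        nlinarith
      have h2 := h1.trans (mul_le_mul_of_nonneg_left (At_mono m ht' hs'.le) hC)
      calc _ ≤ t^m * (C * At m t) := mul_le_mul_of_nonneg_left h2 (by positivity)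
        _ = _ := by ring
    · exact (At_int m).const_mul C
    · filter_upwards [ae_restrict_mem measurableSet_Ioi] with t ht
      have ht' : (0:ℝ) < t := ht
      apply Tendsto.const_mul
      apply tendsto_tsum_of_dominated_convergence (hsum t ht')
      · intro n
        have hc : Continuous (fun s : ℝ => Real.exp (-(t+s) * ν n) * a n) := by fun_prop
        have := hc.tendsto 0
        simp only [add_zero] at this
        exact this.mono_left nhdsWithin_le_nhds
      · filter_upwards [self_mem_nhdsWithin] with s hs n
        have hs' : (0:ℝ) < s := hs
        rw [norm_mul, abs_mul]
        apply mul_le_mul_of_nonneg_right _ (abs_nonneg _)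
        rw [Real.norm_eq_abs, Real.abs_exp, Real.abs_exp]
        apply Real.exp_le_exp.2
        nlinarith [hν0 n]
  refine (lim.const_mul (1/Real.Gamma ((m+1:ℕ):ℝ))).congr' ?_
  filter_upwards [self_mem_nhdsWithin] with s hs
  exact (key s hs).symm

/-- coefficients of the regularized Riesz kernel -/
def ks (α β : ℝ) (c : ℕ → ℝ) (N : ℕ) (s θ : ℝ) (n : ℕ) : ℝ :=
  Real.exp (-s * nu α β n) * (jv α β c N n θ / nu α β n^N)

namespace JH
variable {α β : ℝ} {c : ℕ → ℝ}

lemma inner_bdd (H : JH α β c) {σ B : ℝ} (hσ : 0 < σ) (hB : 0 ≤ B) {ψ : ℝ → ℝ} (T : TF σ B ψ) :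
    ∃ K, 0 ≤ K ∧ ∀ n, |jacobiInner α β ψ (nJacobi α β c n)| ≤ K := by
  haveI := jm_finite α β H.hα H.hβ
  obtain ⟨K, hK, h⟩ := H.TF_P hσ
  refine ⟨B*K * (jacobiMeasure α β).real univ, by positivity, fun n => ?_⟩
  unfold jacobiInner
  have h3 := norm_integral_le_of_norm_le_const (μ := jacobiMeasure α β) (f := fun φ => ψ φ * nJacobi α β c n φ)
    (C := B*K) (Eventually.of_forall (fun φ => ?_))
  · exact h3
  · have := h B ψ hB T n φ
    rw [Real.norm_eq_abs]
    linarith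

lemma q_bdd (H : JH α β c) {σ θ : ℝ} (hσ : 0 < σ) (hθ : θ ∈ sS σ) (N : ℕ) :
    ∃ K, 0 ≤ K ∧ ∀ n, |jv α β c N n θ / nu α β n^N| ≤ K := by
  obtain ⟨K, hK, h⟩ := H.od_v hσ N
  refine ⟨K * 4^N, by positivity, fun n => ?_⟩
  have h1 := h θ hθ n
  rw [zpow_natCast] at h1
  have h2 := H.nu_lower n
  have hn : (0:ℝ) < (n:ℝ)+1 := by positivity
  have h3 : 0 < nu α β n := lt_of_lt_of_le (by positivity) h2
  rw [abs_div, abs_of_pos (pow_pos h3 N), div_le_iff₀ (pow_pos h3 N), mul_assoc, ← mul_pow]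
  refine h1.trans ?_
  apply mul_le_mul_of_nonneg_left _ hK
  exact pow_le_pow_left₀ hn.le (by linarith) N

lemma ks_summable (H : JH α β c) {σ θ : ℝ} (hσ : 0 < σ) (hθ : θ ∈ sS σ) (N : ℕ) {s : ℝ} (hs : 0 < s) :
    Summable (fun n => |ks α β c N s θ n|) := by
  obtain ⟨K, hK, h⟩ := H.q_bdd hσ hθ N
  refine Summable.of_nonneg_of_le (fun _ => abs_nonneg _) (fun n => ?_)
      ((summable_pe 0 (show 0 < s/4 by linarith)).mul_right K)
  unfold ks
  rw [abs_mul, Real.abs_exp, pow_zero, one_mul]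
  have h1 : Real.exp (-s * nu α β n) ≤ Real.exp (-(s/4) * (n+1)) := Real.exp_le_exp.2 (by nlinarith [H.nu_lower n])
  exact mul_le_mul h1 (h n) (abs_nonneg _) (Real.exp_pos _).le

lemma fubini (H : JH α β c) (m : ℕ) {σ r θ : ℝ} (hσ : 0 < σ) (hr : 0 < r) (hU : Metric.ball θ r ⊆ sS σ)
    {B κ : ℝ} (hB : 0 ≤ B) (hκ : 0 < κ)
    {ψ : ℝ → ℝ} (T : TF σ B ψ) (hψ : ∀ φ, ψ φ ≠ 0 → κ ≤ |Real.cos θ - Real.cos φ|) :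
    ∫ φ, rieszKer α β c (m+1) θ φ * ψ φ ∂(jacobiMeasure α β) = (1/Real.Gamma ((m+1:ℕ):ℝ)) *
      ∫ t in Ioi (0:ℝ), t^m * ∫ φ, ψ φ * jF α β c (wt α β c (m+1) t θ) φ ∂(jacobiMeasure α β) := by
  haveI := jm_finite α β H.hα H.hβ
  have hθ : θ ∈ sS σ := hU (Metric.mem_ball_self hr)
  obtain ⟨C, hC, hF⟩ := H.F_bound m hσ hθ hB hκ T hψ
  have e1 : ∀ φ, rieszKer α β c (m+1) θ φ * ψ φ = (1/Real.Gamma ((m+1:ℕ):ℝ)) *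
      ∫ t in Ioi (0:ℝ), t^m * (ψ φ * jF α β c (wt α β c (m+1) t θ) φ) := by
    intro φ
    by_cases h0 : ψ φ = 0
    · simp [h0]
    · have hφ : φ ∈ sS σ := by by_contra hc; exact h0 (T.z φ hc)
      unfold rieszKer
      rw [mul_assoc, ← integral_mul_const]
      congr 1
      apply setIntegral_congr_fun measurableSet_Ioi
      intro t ht
      simp only [Nat.add_sub_cancel]
      rw [H.ker_eq hσ hr hU ht hφ m]
      ring
  simp_rw [e1]
  rw [integral_const_mul]
  congr 1
  have hm : AEStronglyMeasurable (fun z : ℝ × ℝ => z.2^m * (ψ z.1 * jF α β c (wt α β c (m+1) z.2 θ) z.1))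
      ((jacobiMeasure α β).prod (volume.restrict (Ioi 0))) := by
    apply aestronglyMeasurable_of_tendsto_ae atTop
      (f := fun M (z : ℝ × ℝ) => z.2^m * ∑ n ∈ Finset.range M, ψ z.1 * (wt α β c (m+1) z.2 θ n * nJacobi α β c n z.1))
    · intro M
      apply Measurable.aestronglyMeasurable
      apply Measurable.mul (by fun_prop)
      apply Finset.measurable_sum
      intro n _
      apply (T.m.comp measurable_fst).mul
      apply Measurable.mul
      · unfold wt; fun_prop
      · exact (nJ_cont α β c n).measurable.comp measurable_fst
    · have : ∀ᵐ z ∂((jacobiMeasure α β).prod (volume.restrict (Ioi (0:ℝ)))), z.2 ∈ Ioi (0:ℝ) :=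
        Measure.quasiMeasurePreserving_snd.ae (ae_restrict_mem measurableSet_Ioi)
      filter_upwards [this] with z hz
      exact ((H.TF_hasSum hσ hB T (H.wt_summable hσ (m+1) hθ hz) z.1).tendsto_sum_nat).const_mul _
  have hI : Integrable (Function.uncurry fun φ t => t^m * (ψ φ * jF α β c (wt α β c (m+1) t θ) φ))
      ((jacobiMeasure α β).prod (volume.restrict (Ioi 0))) := by
    refine (integrable_prod_iff' hm).2 ⟨?_, ?_⟩
    · filter_upwards [ae_restrict_mem measurableSet_Ioi] with t ht
      exact (H.TF_swap hσ hB T (H.wt_summable hσ (m+1) hθ ht)).1.const_mul _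
    · refine ((At_int m).const_mul C).mono' ?_ ?_
      · exact hm.norm.prod_swap.integral_prod_right'
      · filter_upwards [ae_restrict_mem measurableSet_Ioi] with t ht
        have ht' : (0:ℝ) < t := ht
        rw [Real.norm_of_nonneg (integral_nonneg (fun _ => norm_nonneg _))]
        simp only [Function.uncurry, norm_mul, norm_pow]
        simp only [← norm_mul]
        rw [integral_const_mul, Real.norm_of_nonneg ht'.le]
        calc _ ≤ t^m * (C * At m t) := mul_le_mul_of_nonneg_left (hF t ht') (by positivity)
          _ = _ := by ring
  rw [integral_integral_swap hI]
  congr 1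
  funext t
  rw [integral_const_mul]

lemma far (H : JH α β c) (m : ℕ) {σ r θ : ℝ} (hσ : 0 < σ) (hr : 0 < r) (hU : Metric.ball θ r ⊆ sS σ)
    {B κ : ℝ} (hB : 0 ≤ B) (hκ : 0 < κ)
    {ψ : ℝ → ℝ} (T : TF σ B ψ) (hψ : ∀ φ, ψ φ ≠ 0 → κ ≤ |Real.cos θ - Real.cos φ|) :
    Tendsto (fun s => ∫ φ, ψ φ * jF α β c (ks α β c (m+1) s θ) φ ∂(jacobiMeasure α β)) (𝓝[>] 0)
      (𝓝 (∫ φ, rieszKer α β c (m+1) θ φ * ψ φ ∂(jacobiMeasure α β))) := by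
  have hθ : θ ∈ sS σ := hU (Metric.mem_ball_self hr)
  obtain ⟨C, hC, hF⟩ := H.F_bound m hσ hθ hB hκ T hψ
  obtain ⟨K, hK, hin⟩ := H.inner_bdd hσ hB T
  obtain ⟨V, hV, hv⟩ := H.od_v hσ (m+1)
  have eg : ∀ t, 0 < t → ∑' n, Real.exp (-t * nu α β n) * (jv α β c (m+1) n θ * jacobiInner α β ψ (nJacobi α β c n)) =
      ∫ φ, ψ φ * jF α β c (wt α β c (m+1) t θ) φ ∂(jacobiMeasure α β) := by
    intro t ht
    rw [← (H.TF_swap hσ hB T (H.wt_summable hσ (m+1) hθ ht)).2.tsum_eq]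
    apply tsum_congr; intro n; unfold wt; ring
  have A := abel_lemma m (fun n => jv α β c (m+1) n θ * jacobiInner α β ψ (nJacobi α β c n)) (nu α β)
    (K := V*K) (C := C) H.nu_lower ?_ ?_
  · rw [H.fubini m hσ hr hU hB hκ T hψ]
    have e2 : ∫ t in Ioi (0:ℝ), t^m * ∑' n, Real.exp (-t * nu α β n) * (jv α β c (m+1) n θ * jacobiInner α β ψ (nJacobi α β c n))
      = ∫ t in Ioi (0:ℝ), t^m * ∫ φ, ψ φ * jF α β c (wt α β c (m+1) t θ) φ ∂(jacobiMeasure α β) := by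
      apply setIntegral_congr_fun measurableSet_Ioi
      intro t ht
      simp only
      rw [eg t ht]
    rw [e2] at A
    refine A.congr' ?_
    filter_upwards [self_mem_nhdsWithin] with s hs
    rw [← (H.TF_swap hσ hB T (H.ks_summable hσ hθ (m+1) hs)).2.tsum_eq]
    apply tsum_congr; intro n; unfold ks; ring
  · intro n
    rw [abs_mul]
    have h1 := hv θ hθ n
    rw [zpow_natCast] at h1
    calc _ ≤ (V * ((n:ℝ)+1)^(m+1)) * K := mul_le_mul h1 (hin n) (abs_nonneg _) (by positivity)
      _ = _ := by ring
  · intro t ht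
    rw [eg t ht]
    exact (abs_integral_le_integral_abs).trans (hF t ht)

end JH

end

section
open Polynomial Topology

/-- generating function of the Jacobi polynomials -/
def jG (α β : ℝ) (c : ℕ → ℝ) (z : ℂ) (φ : ℝ) : ℂ := ∑' n : ℕ, z^n * (nJacobi α β c n φ : ℂ)

/-- numerator of the generating function -/
def jPhi (α β : ℝ) (c : ℕ → ℝ) (z : ℂ) (φ : ℝ) : ℂ :=
  z⁻¹ * (nJacobi α β c 0 φ : ℂ) + ∑' n : ℕ, z^n * (rho α β c n φ : ℂ)

lemma hasSum_congr_cfun {f g : ℕ → ℂ} {a : ℂ} (h : HasSum f a) (e : ∀ n, f n = g n) : HasSum g a := by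
  rw [show g = f from (funext e).symm]; exact h

lemma norm_pow_sub_le {z w : ℂ} (hz : ‖z‖ ≤ 1) (hw : ‖w‖ ≤ 1) (n : ℕ) : ‖z^n - w^n‖ ≤ n * ‖z - w‖ := by
  induction n with
  | zero => simp
  | succ n ih =>
    have e : z^(n+1) - w^(n+1) = z^n * (z - w) + (z^n - w^n) * w := by ring
    rw [e]
    refine (norm_add_le _ _).trans ?_
    rw [norm_mul, norm_mul, norm_pow]
    have h1 : ‖z‖^n ≤ 1 := pow_le_one₀ (norm_nonneg _) hz
    have h2 : ‖z‖^n * ‖z - w‖ ≤ 1 * ‖z-w‖ := mul_le_mul_of_nonneg_right h1 (norm_nonneg _)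
    have h3 : ‖z^n - w^n‖ * ‖w‖ ≤ (n * ‖z-w‖) * 1 := mul_le_mul ih hw (norm_nonneg _) (by positivity)
    push_cast
    linarith

namespace JH
variable {α β : ℝ} {c : ℕ → ℝ}

lemma rho_lip (H : JH α β c) {σ : ℝ} (hσ : 0 < σ) : ∃ C, 0 ≤ C ∧ ∀ θ r φ, Metric.ball θ r ⊆ sS σ → φ ∈ Metric.ball θ r →
    ∀ n : ℕ, |rho α β c n φ - rho α β c n θ| ≤ C / ((n:ℝ)+1) * |φ - θ| := by
  have hP := H.od_v hσ 1
  have h1 := (H.od_b1 _).mul hP.up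
  have h2 := ((H.od_a _).mul hP).cmul 2
  have h3 := (H.od_g _).mul hP.down
  obtain ⟨C, hC, h⟩ := (h1.sub h2).add h3
  refine ⟨C, hC, fun θ r φ hU hφ n => ?_⟩
  have hr : 0 < r := lt_of_le_of_lt dist_nonneg hφ
  have key := Convex.norm_image_sub_le_of_norm_hasDerivWithin_le (f := fun φ => rho α β c n φ)
    (f' := fun φ => (1 - 2 * jb α β c n) * jv α β c 1 (n+1) φ
    - 2 * (ja α β c n * jv α β c 1 n φ) + jg α β c n * jv α β c 1 (n-1) φ) (C := C / ((n:ℝ)+1))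
    (s := Metric.ball θ r) (x := θ) (y := φ) ?_ ?_ (convex_ball θ r) (Metric.mem_ball_self hr) hφ
  · simpa [Real.norm_eq_abs] using key
  · intro x hx
    have e : (fun φ => rho α β c n φ) = fun θ => (1 - 2 * jb α β c n) * jv α β c 0 (n+1) θ
      - 2 * (ja α β c n * jv α β c 0 n θ) + jg α β c n * jv α β c 0 (n-1) θ := by
      funext y; rw [H.rho_eq, jv_zero, jv_zero, jv_zero]; ring
    rw [e]
    exact ((((jv_hasDeriv α β c 0 (n+1) x).const_mul _).sub
      (((jv_hasDeriv α β c 0 n x).const_mul _).const_mul _)).add ((jv_hasDeriv α β c 0 (n-1) x).const_mul _)).hasDerivWithinAt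
  · intro x hx
    have := h x (hU hx) n
    beta_reduce at this
    rw [show (-2 + ((1:ℕ):ℤ)) = -1 by norm_num, zpow_neg_one] at this
    rw [Real.norm_eq_abs, div_eq_mul_inv]
    exact this

lemma gen_summable (H : JH α β c) {σ φ : ℝ} (hσ : 0 < σ) (hφ : φ ∈ sS σ) {z : ℂ} (hz : ‖z‖ < 1) :
    Summable (fun n : ℕ => z^n * (nJacobi α β c n φ : ℂ)) := by
  obtain ⟨K, hK, hP⟩ := H.od_P hσ
  refine Summable.of_norm_bounded ((summable_geometric_of_lt_one (norm_nonneg z) hz).mul_right K) (fun n => ?_)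
  rw [norm_mul, norm_pow, Complex.norm_real, Real.norm_eq_abs]
  have := hP φ hφ n
  rw [zpow_zero, mul_one] at this
  exact mul_le_mul_of_nonneg_left this (by positivity)

lemma gen_id (H : JH α β c) {σ φ : ℝ} (hσ : 0 < σ) (hφ : φ ∈ sS σ) {z : ℂ} (hz0 : z ≠ 0) (hz : ‖z‖ < 1) :
    jG α β c z φ * (z + z⁻¹ - 2 * Real.cos φ) = jPhi α β c z φ := by
  have hs := H.gen_summable hσ hφ hz
  have hs1 : Summable (fun n : ℕ => z^(n+1) * (nJacobi α β c (n+1) φ : ℂ)) := (summable_nat_add_iff 1).2 hs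
  have A1 : HasSum (fun n : ℕ => z^n * (nJacobi α β c (n+1) φ : ℂ)) (z⁻¹ * (jG α β c z φ - nJacobi α β c 0 φ)) := by
    have h := (hasSum_nat_add_iff' 1).2 hs.hasSum
    simp only [Finset.sum_range_one, pow_zero, one_mul] at h
    refine hasSum_congr_cfun (h.mul_left z⁻¹) (fun n => ?_)
    rw [pow_succ]; field_simp
  have A2 : HasSum (fun n : ℕ => z^n * (Pm α β c n φ : ℂ)) (z * jG α β c z φ) := by
    refine (hasSum_nat_add_iff' 1).1 ?_
    simp only [Finset.sum_range_one, pow_zero, one_mul, Pm, Complex.ofReal_zero, sub_zero]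
    refine hasSum_congr_cfun (hs.hasSum.mul_left z) (fun n => ?_)
    rw [pow_succ]; ring
  have A3 := hs.hasSum.mul_left (2 * (Real.cos φ : ℂ))
  have A4 : HasSum (fun n : ℕ => z^n * (rho α β c n φ : ℂ))
      (z⁻¹ * (jG α β c z φ - nJacobi α β c 0 φ) + z * jG α β c z φ - 2 * (Real.cos φ : ℂ) * jG α β c z φ) := by
    refine hasSum_congr_cfun ((A1.add A2).sub A3) (fun n => ?_)
    simp only [rho, Complex.ofReal_add, Complex.ofReal_sub, Complex.ofReal_mul, Complex.ofReal_ofNat]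
    ring
  unfold jPhi
  rw [A4.tsum_eq]
  ring

lemma phi_diff (H : JH α β c) {σ : ℝ} (hσ : 0 < σ) : ∃ C, 0 ≤ C ∧ ∀ θ r φ s x, Metric.ball θ r ⊆ sS σ → φ ∈ Metric.ball θ r →
    0 < s → s ≤ x → |φ - θ| ≤ x → x ≤ 1 →
    ‖jPhi α β c (Real.exp (-s) * jz θ) φ - etaI α β c θ‖ ≤ C * √x := by
  obtain ⟨L, hL, hl⟩ := H.rho_lip hσ
  obtain ⟨R, hR, hr⟩ := H.od_rho hσ
  obtain ⟨V, hV, hv⟩ := H.od_v hσ 1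
  obtain ⟨P, hP, hp⟩ := H.od_P hσ
  set u : ℕ → ℝ := fun n => 1 / ((n:ℝ)+1)^(3/2:ℝ) with hu
  have hus : Summable u := by
    have : Summable (fun n : ℕ => (1:ℝ)/(n:ℝ)^(3/2:ℝ)) := Real.summable_one_div_nat_rpow.mpr (by norm_num)
    refine ((summable_nat_add_iff 1).mpr this).congr (fun n => ?_)
    simp [hu]
  set D := √(2*R*(R+L)) with hD
  refine ⟨(2*P+V) + D * ∑' n, u n, by positivity, fun θ r φ s x hU hφ hs hsx hhx hx1 => ?_⟩
  have hr0 : 0 < r := lt_of_le_of_lt dist_nonneg hφ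
  have hθ : θ ∈ sS σ := hU (Metric.mem_ball_self hr0)
  have hφ' : φ ∈ sS σ := hU hφ
  have hx0 : 0 < x := lt_of_lt_of_le hs hsx
  have hxs : x ≤ √x := by
    have h1 := Real.sq_sqrt hx0.le
    have h2 : √x ≤ 1 := Real.sqrt_le_one.2 hx1
    nlinarith [Real.sqrt_nonneg x]
  set z : ℂ := Real.exp (-s) * jz θ with hz
  have hes : Real.exp (-s) ≤ 1 := Real.exp_le_one_iff.2 (by linarith)
  have hzn : ‖z‖ ≤ 1 := by
    rw [hz, norm_mul, jz_norm, mul_one, Complex.norm_real, Real.norm_of_nonneg (Real.exp_pos _).le]; exact hes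
  have hzw : ‖z - jz θ‖ ≤ s := by
    have : z - jz θ = ((Real.exp (-s) - 1 : ℝ) : ℂ) * jz θ := by rw [hz]; push_cast; ring
    rw [this, norm_mul, jz_norm, mul_one, Complex.norm_real, Real.norm_eq_abs, abs_sub_comm, abs_of_nonneg (by linarith)]
    linarith [Real.add_one_le_exp (-s)]
  have hP0 : |nJacobi α β c 0 φ - nJacobi α β c 0 θ| ≤ V * |φ - θ| := by
    have key := Convex.norm_image_sub_le_of_norm_hasDerivWithin_le (f := fun φ => jv α β c 0 0 φ)
      (f' := fun φ => jv α β c 1 0 φ) (C := V)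
      (s := Metric.ball θ r) (x := θ) (y := φ) (fun x _ => (jv_hasDeriv α β c 0 0 x).hasDerivWithinAt)
        (fun x hx => by have := hv x (hU hx) 0; simpa using this) (convex_ball θ r) (Metric.mem_ball_self hr0) hφ
    simpa [jv_zero] using key
  -- the first term
  have T1 : ‖z⁻¹ * (nJacobi α β c 0 φ : ℂ) - (jz θ)⁻¹ * (nJacobi α β c 0 θ : ℂ)‖ ≤ (2*P+V) * √x := by
    have e : z⁻¹ * (nJacobi α β c 0 φ : ℂ) - (jz θ)⁻¹ * (nJacobi α β c 0 θ : ℂ) =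
        (jz θ)⁻¹ * (((Real.exp s - 1) * nJacobi α β c 0 φ + (nJacobi α β c 0 φ - nJacobi α β c 0 θ) : ℝ) : ℂ) := by
      rw [hz, mul_inv, ← Complex.ofReal_inv, Real.exp_neg, inv_inv]; push_cast; ring
    rw [e, norm_mul, norm_inv, jz_norm, inv_one, one_mul, Complex.norm_real, Real.norm_eq_abs]
    refine (abs_add_le _ _).trans ?_
    rw [abs_mul]
    have h1 : |Real.exp s - 1| ≤ 2 * s := by
      have := Real.abs_exp_sub_one_le (x := s) (by rw [abs_of_pos hs]; linarith)
      rwa [abs_of_pos hs] at this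
    have h2 := hp φ hφ' 0
    beta_reduce at h2
    rw [zpow_zero, mul_one] at h2
    calc _ ≤ (2*x) * P + V * x := by
          apply add_le_add
          · exact mul_le_mul (h1.trans (by linarith)) h2 (abs_nonneg _) (by positivity)
          · exact hP0.trans (mul_le_mul_of_nonneg_left hhx hV)
      _ = (2*P+V) * x := by ring
      _ ≤ _ := mul_le_mul_of_nonneg_left hxs (by positivity)
  have T2 : ∀ n : ℕ, ‖z^n * (rho α β c n φ : ℂ) - (jz θ)^n * (rho α β c n θ : ℂ)‖ ≤ (D * √x) * u n := by
    intro n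
    set A := ‖z^n * (rho α β c n φ : ℂ) - (jz θ)^n * (rho α β c n θ : ℂ)‖ with hA
    have hn : (0:ℝ) < (n:ℝ)+1 := by positivity
    have r1 := hr φ hφ' n
    have r2 := hr θ hθ n
    beta_reduce at r1 r2
    rw [show ((-2:ℤ)) = -((2:ℕ):ℤ) by norm_num, zpow_neg, zpow_natCast] at r1 r2
    have hzn' : ‖z^n‖ ≤ 1 := by rw [norm_pow]; exact pow_le_one₀ (norm_nonneg _) hzn
    have a1 : A ≤ 2 * R * (((n:ℝ)+1)^2)⁻¹ := by
      refine (norm_sub_le _ _).trans ?_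
      rw [norm_mul, norm_mul, norm_pow (jz θ), jz_norm, one_pow, one_mul, Complex.norm_real, Complex.norm_real,
        Real.norm_eq_abs, Real.norm_eq_abs]
      have := mul_le_mul hzn' r1 (abs_nonneg _) zero_le_one
      linarith
    have a2 : A ≤ (R+L) * ((n:ℝ)+1)⁻¹ * x := by
      have e : z^n * (rho α β c n φ : ℂ) - (jz θ)^n * (rho α β c n θ : ℂ) =
        z^n * ((rho α β c n φ - rho α β c n θ : ℝ) : ℂ) + (z^n - (jz θ)^n) * (rho α β c n θ : ℂ) := by
        push_cast; ring
      rw [hA, e]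
      refine (norm_add_le _ _).trans ?_
      rw [norm_mul, norm_mul, Complex.norm_real, Complex.norm_real, Real.norm_eq_abs, Real.norm_eq_abs]
      have h1 := (hl θ r φ hU hφ n).trans (mul_le_mul_of_nonneg_left hhx (by positivity))
      have h2 := mul_le_mul hzn' h1 (abs_nonneg _) zero_le_one
      have h3 : ‖z^n - (jz θ)^n‖ ≤ ((n:ℝ)+1) * x := by
        refine (norm_pow_sub_le hzn (jz_norm θ).le n).trans ?_
        exact mul_le_mul (by linarith) (hzw.trans hsx) (norm_nonneg _) hn.le
      have h4 := mul_le_mul h3 r2 (abs_nonneg _) (by positivity)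
      have e2 : ((n:ℝ)+1) * x * (R * (((n:ℝ)+1)^2)⁻¹) = R * ((n:ℝ)+1)⁻¹ * x := by field_simp
      rw [e2] at h4
      rw [div_eq_mul_inv] at h2
      linarith
    have hA0 : 0 ≤ A := norm_nonneg _
    have a3 : A^2 ≤ (2 * R * (((n:ℝ)+1)^2)⁻¹) * ((R+L) * ((n:ℝ)+1)⁻¹ * x) := by
      rw [sq]; exact mul_le_mul a1 a2 hA0 (by positivity)
    have a4 : ((D * √x) * u n)^2 = (2 * R * (((n:ℝ)+1)^2)⁻¹) * ((R+L) * ((n:ℝ)+1)⁻¹ * x) := by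
      rw [mul_pow, mul_pow, hD, Real.sq_sqrt (by positivity), Real.sq_sqrt hx0.le]
      have : u n ^ 2 = (((n:ℝ)+1)^3)⁻¹ := by
        simp only [hu]
        rw [div_pow, one_pow, one_div, ← Real.rpow_natCast, ← Real.rpow_mul hn.le]
        norm_num
      rw [this]; field_simp
    have hu0 : 0 ≤ u n := by simp only [hu]; positivity
    exact abs_le_of_sq_le_sq' (by rw [a4]; exact a3) (by positivity) |>.2
  have s1 : Summable (fun n : ℕ => z^n * (rho α β c n φ : ℂ)) := by
    refine Summable.of_norm_bounded (H.rho_summable hσ hφ') (fun n => ?_)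
    rw [norm_mul, norm_pow, Complex.norm_real, Real.norm_eq_abs]
    exact mul_le_of_le_one_left (abs_nonneg _) (pow_le_one₀ (norm_nonneg _) hzn)
  have s2 : Summable (fun n : ℕ => (jz θ)^n * (rho α β c n θ : ℂ)) := by
    refine Summable.of_norm_bounded (H.rho_summable hσ hθ) (fun n => ?_)
    rw [norm_mul, norm_pow, Complex.norm_real, Real.norm_eq_abs, jz_norm, one_pow, one_mul]
  have e : jPhi α β c z φ - etaI α β c θ = (z⁻¹ * (nJacobi α β c 0 φ : ℂ) - (jz θ)⁻¹ * (nJacobi α β c 0 θ : ℂ))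
      + ∑' n : ℕ, (z^n * (rho α β c n φ : ℂ) - (jz θ)^n * (rho α β c n θ : ℂ)) := by
    rw [s1.tsum_sub s2]; unfold jPhi etaI; ring
  rw [e]
  refine (norm_add_le _ _).trans ?_
  have T3 := tsum_of_norm_bounded ((hus.mul_left (D * √x)).hasSum) T2
  rw [tsum_mul_left] at T3
  calc _ ≤ (2*P+V) * √x + (D * √x) * ∑' n, u n := add_le_add T1 T3
    _ = _ := by ring

end JH

end

section
open Polynomial Topology

lemma mm_odd (α β : ℝ) (c : ℕ → ℝ) (k n : ℕ) (θ : ℝ) :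
    mm α β c (2*k+1) n θ = ((((-1:ℝ)^k / Real.sin θ : ℝ) : ℂ) * (Complex.I * (starRingEnd ℂ) (etaI α β c θ)) * (jz θ)^n).im := by
  have hc : (starRingEnd ℂ) (jz θ) = (jz θ)⁻¹ := by
    rw [jz_inv_eq, jz_eq]; simp [-Complex.ofReal_cos, -Complex.ofReal_sin]; ring
  have e : (-Complex.I)^(2*k+1) * ((jz θ)⁻¹^n * etaI α β c θ) =
      (starRingEnd ℂ) ((((-1:ℝ)^k : ℝ) : ℂ) * (Complex.I * (starRingEnd ℂ) (etaI α β c θ)) * (jz θ)^n) := by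
    simp only [map_mul, map_pow, hc, Complex.conj_I, Complex.conj_conj, Complex.conj_ofReal]
    rw [pow_succ, pow_mul, neg_sq, Complex.I_sq]
    push_cast
    ring
  unfold mm
  rw [e, Complex.conj_im, neg_neg]
  rw [show (((-1:ℝ)^k / Real.sin θ : ℝ) : ℂ) * (Complex.I * (starRingEnd ℂ) (etaI α β c θ)) * (jz θ)^n =
    (((Real.sin θ)⁻¹ : ℝ) : ℂ) * ((((-1:ℝ)^k : ℝ) : ℂ) * (Complex.I * (starRingEnd ℂ) (etaI α β c θ)) * (jz θ)^n) by
      push_cast; ring, Complex.im_ofReal_mul]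
  rw [div_eq_inv_mul]

lemma delta_est {θ φ s : ℝ} (hs : 0 < s) (hs1 : s ≤ 1) (hh : |φ - θ| ≤ 1) :
    ‖((Real.exp (-s) : ℂ) * jz θ + ((Real.exp (-s) : ℂ) * jz θ)⁻¹ - 2 * Real.cos φ)
      - 2 * Real.sin θ * (((φ - θ : ℝ) : ℂ) - s * Complex.I)‖ ≤ 2 * ((φ-θ)^2 + s^2) := by
  set h := φ - θ with hh'
  have hφ : φ = θ + h := by rw [hh']; ring
  have e1 : ((Real.exp (-s) : ℂ) * jz θ)⁻¹ = (Real.exp s : ℂ) * (jz θ)⁻¹ := by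
    rw [mul_inv]; congr 1
    rw [← Complex.ofReal_inv, Real.exp_neg, inv_inv]
  have b1 : |Real.exp (-s) - 1 + s| ≤ s^2 := by
    have := Real.abs_exp_sub_one_sub_id_le (x := -s) (by rw [abs_neg, abs_of_pos hs]; exact hs1)
    rw [sub_neg_eq_add] at this
    simpa using this
  have b2 : |Real.exp s - 1 - s| ≤ s^2 := Real.abs_exp_sub_one_sub_id_le (by rw [abs_of_pos hs]; exact hs1)
  have b3 : |Real.cos θ - Real.cos φ - h * Real.sin θ| ≤ h^2 := by
    have e : Real.cos θ - Real.cos φ - h * Real.sin θ = Real.cos θ * (1 - Real.cos h) + Real.sin θ * (Real.sin h - h) := by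
      rw [hφ, Real.cos_add]; ring
    rw [e]
    refine (abs_add_le _ _).trans ?_
    rw [abs_mul, abs_mul]
    have c1 : |1 - Real.cos h| ≤ h^2/2 := by
      rw [abs_of_nonneg (by linarith [Real.cos_le_one h])]
      linarith [Real.one_sub_sq_div_two_le_cos (x := h)]
    have c2 : |Real.sin h - h| ≤ h^2/2 := by
      have := Real.sin_bound hh
      have e2 : Real.sin h - h = (Real.sin h - (h - h^3/6)) - h^3/6 := by ring
      rw [e2]
      refine (abs_sub _ _).trans ?_
      have h3 : |h^3/6| = |h| * h^2/6 := by
        rw [abs_div, abs_pow, pow_succ, sq_abs]; norm_num; ring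
      have h4 : |h|^5 = |h|^3 * h^2 := by rw [← sq_abs h]; ring
      have h5 : |h|^3 ≤ 1 := by exact pow_le_one₀ (abs_nonneg _) hh
      rw [h3]
      rw [h4] at this
      nlinarith [sq_nonneg h, mul_le_mul_of_nonneg_right hh (sq_nonneg h), mul_le_mul_of_nonneg_right h5 (sq_nonneg h)]
    have d1 := mul_le_mul (Real.abs_cos_le_one θ) c1 (abs_nonneg _) zero_le_one
    have d2 := mul_le_mul (Real.abs_sin_le_one θ) c2 (abs_nonneg _) zero_le_one
    linarith
  have e : (((Real.exp (-s) : ℂ) * jz θ + ((Real.exp (-s) : ℂ) * jz θ)⁻¹ - 2 * Real.cos φ)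
      - 2 * Real.sin θ * ((h : ℂ) - s * Complex.I)) =
      ((Real.exp (-s) - 1 + s : ℝ) : ℂ) * jz θ + ((Real.exp s - 1 - s : ℝ) : ℂ) * (jz θ)⁻¹
       + ((2 * (Real.cos θ - Real.cos φ - h * Real.sin θ) : ℝ) : ℂ) := by
    rw [e1, jz_inv_eq, jz_eq]
    push_cast
    ring
  rw [e]
  refine (norm_add₃_le).trans ?_
  rw [norm_mul, norm_mul, norm_inv, jz_norm, Complex.norm_real, Complex.norm_real, Complex.norm_real,
    Real.norm_eq_abs, Real.norm_eq_abs, Real.norm_eq_abs, abs_mul, abs_two]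
  linarith

namespace JH
variable {α β : ℝ} {c : ℕ → ℝ}

lemma M_asym (H : JH α β c) (k : ℕ) {σ θ r : ℝ} (hσ : 0 < σ) (hr : 0 < r) (hU : Metric.ball θ r ⊆ sS σ) :
    ∃ A C, 0 ≤ C ∧ ∀ s φ, 0 < s → s ≤ σ/4 → φ ∈ Metric.ball θ r → 0 < |φ - θ| → |φ - θ| ≤ σ/4 →
      |jF α β c (fun n => Real.exp (-s * n) * mm α β c (2*k+1) n θ) φ - A * ((φ - θ)/((φ-θ)^2 + s^2))| ≤ C / √|φ - θ| := by
  have hθ : θ ∈ sS σ := hU (Metric.mem_ball_self hr)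
  have hsin : σ ≤ Real.sin θ := hθ
  have hsin0 : 0 < Real.sin θ := hσ.trans_le hsin
  have hσ1 : σ ≤ 1 := hsin.trans (Real.sin_le_one θ)
  obtain ⟨Cp, hCp, hp⟩ := H.phi_diff hσ
  set E := etaI α β c θ with hE
  set κ : ℝ := (-1:ℝ)^k with hκ
  have hκ1 : |κ| = 1 := by rw [hκ, abs_pow]; simp
  refine ⟨κ * Complex.normSq E / (2 * Real.sin θ^2), ‖E‖/σ * (Cp/σ + ‖E‖/σ^2), by positivity, ?_⟩
  intro s φ hs hsσ hφ hh0 hhσ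
  have hφ' := hU hφ
  set h := φ - θ with hh
  set y : ℂ := (h:ℂ) - s * Complex.I with hy
  set x := ‖y‖ with hx
  have hyre : y.re = h := by simp [hy]
  have hyim : y.im = -s := by simp [hy]
  have hy2 : x^2 = h^2 + s^2 := by
    rw [hx, ← Complex.normSq_eq_norm_sq, Complex.normSq_apply, hyre, hyim]; ring
  have hx0 : 0 ≤ x := norm_nonneg _
  have hhx : |h| ≤ x := by rw [← hyre]; exact Complex.abs_re_le_norm y
  have hsx : s ≤ x := by
    have := Complex.abs_im_le_norm y
    rwa [hyim, abs_neg, abs_of_pos hs] at this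
  have hxp : 0 < x := hs.trans_le hsx
  have hxσ : x ≤ σ/2 := by
    refine (norm_sub_le _ _).trans ?_
    rw [norm_mul, Complex.norm_I, Complex.norm_real, Complex.norm_real, Real.norm_eq_abs, Real.norm_of_nonneg hs.le]
    linarith
  have hx1 : x ≤ 1 := by linarith
  have hy0 : y ≠ 0 := norm_pos_iff.1 hxp
  set z : ℂ := (Real.exp (-s) : ℂ) * jz θ with hz
  have hz0 : z ≠ 0 := mul_ne_zero (by exact_mod_cast (Real.exp_pos _).ne') (jz_ne θ)
  have hz1 : ‖z‖ < 1 := by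
    rw [hz, norm_mul, jz_norm, mul_one, Complex.norm_real, Real.norm_of_nonneg (Real.exp_pos _).le]
    rw [← Real.exp_zero]; exact Real.exp_lt_exp.2 (by linarith)
  have hgen := H.gen_id hσ hφ' hz0 hz1
  have hpd := hp θ r φ s x hU hφ hs hsx hhx hx1
  have hde := delta_est (θ := θ) (φ := φ) hs (by linarith) (by linarith)
  rw [← hh, ← hy, ← hz, ← hy2] at hde
  set Δ : ℂ := z + z⁻¹ - 2 * Real.cos φ with hΔ
  set D : ℂ := 2 * Real.sin θ * y with hD
  have hDn : ‖D‖ = 2 * Real.sin θ * x := by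
    rw [hD, norm_mul, norm_mul, Complex.norm_real, Real.norm_of_nonneg hsin0.le]; simp [hx]
  have hD0 : D ≠ 0 := by
    rw [← norm_pos_iff, hDn]; positivity
  have hDl : 2 * σ * x ≤ ‖D‖ := by
    rw [hDn]; exact mul_le_mul_of_nonneg_right (by linarith) hx0
  have hΔl : σ * x ≤ ‖Δ‖ := by
    have h1 : ‖D‖ - ‖Δ - D‖ ≤ ‖Δ‖ := by
      have := norm_sub_norm_le D (D - Δ)
      rw [sub_sub_cancel, norm_sub_rev D Δ] at this
      exact this
    nlinarith
  have hΔp : 0 < ‖Δ‖ := lt_of_lt_of_le (by positivity) hΔl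
  have hΔ0 : Δ ≠ 0 := norm_pos_iff.1 hΔp
  have hG : jG α β c z φ = jPhi α β c z φ / Δ := by rw [eq_div_iff hΔ0]; exact hgen
  have hsq : (√x)^2 = x := Real.sq_sqrt hx0
  have hsq0 : 0 < √x := Real.sqrt_pos.2 hxp
  have hsq1 : √x ≤ 1 := Real.sqrt_le_one.2 hx1
  have hdiff : ‖jG α β c z φ - E / D‖ ≤ (Cp/σ + ‖E‖/σ^2) / √x := by
    have e : jG α β c z φ - E / D = (jPhi α β c z φ - E) / Δ + E * ((D - Δ) / (Δ * D)) := by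
      rw [hG]; field_simp; ring
    rw [e]
    refine (norm_add_le _ _).trans ?_
    rw [norm_div, norm_mul, norm_div, norm_mul]
    have i1 : ‖jPhi α β c z φ - E‖ / ‖Δ‖ ≤ (Cp/σ) / √x := by
      rw [div_le_div_iff₀ hΔp hsq0]
      have : Cp / σ * (σ * x) = Cp * x := by field_simp
      calc _ ≤ (Cp * √x) * √x := mul_le_mul_of_nonneg_right hpd hsq0.le
        _ = Cp / σ * (σ * x) := by rw [this, mul_assoc, ← sq, hsq]
        _ ≤ _ := mul_le_mul_of_nonneg_left hΔl (by positivity)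
    have i2 : ‖D - Δ‖ / (‖Δ‖ * ‖D‖) ≤ 1/σ^2 := by
      rw [norm_sub_rev, div_le_div_iff₀ (by positivity) (by positivity)]
      have := mul_le_mul hΔl hDl (by positivity) hΔp.le
      nlinarith [mul_le_mul_of_nonneg_right hde (sq_nonneg σ)]
    have i3 : ‖E‖ * (‖D - Δ‖ / (‖Δ‖ * ‖D‖)) ≤ (‖E‖/σ^2) / √x := by
      have : ‖E‖/σ^2 ≤ (‖E‖/σ^2) / √x := by
        rw [le_div_iff₀ hsq0]; exact mul_le_of_le_one_right (by positivity) hsq1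
      refine le_trans ?_ this
      have := mul_le_mul_of_nonneg_left i2 (norm_nonneg E)
      rw [mul_one_div] at this
      exact this
    rw [add_div]
    exact add_le_add i1 i3
  -- relation with jF
  set Z : ℂ := ((κ / Real.sin θ : ℝ) : ℂ) * (Complex.I * (starRingEnd ℂ) E) with hZ
  have hjF : jF α β c (fun n => Real.exp (-s * n) * mm α β c (2*k+1) n θ) φ = (Z * jG α β c z φ).im := by
    have h1 := ((H.gen_summable hσ hφ' hz1).hasSum.mul_left Z).mapL Complex.imCLM
    unfold jF
    refine Eq.trans ?_ h1.tsum_eq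
    apply tsum_congr
    intro n
    beta_reduce
    rw [mm_odd, ← hE, ← hκ, ← hZ]
    have : Z * (z^n * (nJacobi α β c n φ : ℂ)) = ((Real.exp (-s * n) * nJacobi α β c n φ : ℝ) : ℂ) * (Z * (jz θ)^n) := by
      rw [hz, mul_pow, ← Complex.ofReal_pow, ← Real.exp_nat_mul, show (n:ℝ) * -s = -s * n by ring]
      push_cast; ring
    simp only [Complex.imCLM_apply]
    rw [this, Complex.im_ofReal_mul]
    ring
  have hmain : (Z * (E / D)).im = κ * Complex.normSq E / (2 * Real.sin θ^2) * (h/(h^2+s^2)) := by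
    have e1 : Z * (E / D) = ((κ * Complex.normSq E / (2 * Real.sin θ^2) : ℝ) : ℂ) * (Complex.I * y⁻¹) := by
      have hss : (Real.sin θ : ℂ) ≠ 0 := by exact_mod_cast hsin0.ne'
      have := Complex.mul_conj E
      rw [hZ, hD]
      push_cast [-Complex.ofReal_sin]
      rw [← this]
      field_simp
    rw [e1, Complex.im_ofReal_mul]
    congr 1
    rw [Complex.mul_im, Complex.I_re, Complex.I_im, Complex.inv_re, hyre, Complex.normSq_eq_norm_sq, ← hx, hy2]
    ring
  rw [hjF, ← hmain, ← Complex.sub_im, ← mul_sub]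
  refine (Complex.abs_im_le_norm _).trans ?_
  rw [norm_mul]
  have hZn : ‖Z‖ ≤ ‖E‖/σ := by
    rw [hZ, norm_mul, norm_mul, Complex.norm_I, one_mul, Complex.norm_conj, Complex.norm_real, Real.norm_eq_abs, abs_div, hκ1,
      abs_of_pos hsin0, one_div_mul_eq_div]
    exact div_le_div_of_nonneg_left (norm_nonneg _) hσ hsin
  have hlast : (Cp/σ + ‖E‖/σ^2) / √x ≤ (Cp/σ + ‖E‖/σ^2) / √|h| :=
    div_le_div_of_nonneg_left (by positivity) (Real.sqrt_pos.2 hh0) (Real.sqrt_le_sqrt hhx)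
  calc _ ≤ ‖E‖/σ * ((Cp/σ + ‖E‖/σ^2) / √|h|) := mul_le_mul hZn (hdiff.trans hlast) (norm_nonneg _) (by positivity)
    _ = _ := by ring

end JH

end

section
open Polynomial Topology

lemma fold_integral {F : ℝ → ℝ} {θ ε : ℝ} (hε : 0 < ε) (hF : ContinuousOn F (Icc (θ-ε) (θ+ε))) :
    ∫ φ in (θ-ε)..(θ+ε), F φ = ∫ h in (0:ℝ)..ε, (F (θ+h) + F (θ-h)) := by
  have i1 : IntervalIntegrable F volume (θ-ε) θ := by
    apply ContinuousOn.intervalIntegrable_of_Icc (by linarith)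
    exact hF.mono (Icc_subset_Icc le_rfl (by linarith))
  have i2 : IntervalIntegrable F volume θ (θ+ε) := by
    apply ContinuousOn.intervalIntegrable_of_Icc (by linarith)
    exact hF.mono (Icc_subset_Icc (by linarith) le_rfl)
  rw [← intervalIntegral.integral_add_adjacent_intervals i1 i2]
  have j1 : IntervalIntegrable (fun h => F (θ+h)) volume 0 ε := by
    apply ContinuousOn.intervalIntegrable_of_Icc hε.le
    refine hF.comp (by fun_prop) (fun h hh => ⟨by linarith [hh.1], by linarith [hh.2]⟩)
  have j2 : IntervalIntegrable (fun h => F (θ-h)) volume 0 ε := by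
    apply ContinuousOn.intervalIntegrable_of_Icc hε.le
    refine hF.comp (by fun_prop) (fun h hh => ⟨by linarith [hh.2], by linarith [hh.1]⟩)
  rw [intervalIntegral.integral_add j1 j2, intervalIntegral.integral_comp_add_left F, intervalIntegral.integral_comp_sub_left F]
  simp only [add_zero, sub_zero]
  ring

lemma int_rpow_half {ε : ℝ} (hε : 0 < ε) (C : ℝ) : IntervalIntegrable (fun h : ℝ => C * h^(-(1/2):ℝ)) volume 0 ε ∧
    ∫ h in (0:ℝ)..ε, C * h^(-(1/2):ℝ) = 2 * C * √ε := by
  constructor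
  · exact (intervalIntegral.intervalIntegrable_rpow' (by norm_num)).const_mul C
  · rw [intervalIntegral.integral_const_mul, integral_rpow (Or.inl (by norm_num)), Real.sqrt_eq_rpow]
    norm_num
    ring

lemma near_int_eq (α β : ℝ) {θ ε r : ℝ} (hεr : ε < r) (hU : Metric.ball θ r ⊆ Ioo 0 π) (hε : 0 < ε) (f G : ℝ → ℝ) :
    ∫ φ, (Icc (θ-ε) (θ+ε)).indicator f φ * G φ ∂(jacobiMeasure α β) = ∫ φ in (θ-ε)..(θ+ε), f φ * jw α β φ * G φ := by
  have e : ∀ φ, (Icc (θ-ε) (θ+ε)).indicator f φ * G φ = (Icc (θ-ε) (θ+ε)).indicator (fun φ => f φ * G φ) φ := by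
    intro φ; by_cases h : φ ∈ Icc (θ-ε) (θ+ε) <;> simp [h]
  simp_rw [e]
  rw [integral_indicator measurableSet_Icc, jm_setIntegral _ _ _ measurableSet_Icc, inter_eq_left.2, intervalIntegral.integral_of_le (by linarith),
    integral_Icc_eq_integral_Ioc]
  · apply setIntegral_congr_fun measurableSet_Ioc
    intro φ _
    simp only; ring
  · intro φ hφ
    apply hU
    rw [Metric.mem_ball, Real.dist_eq, abs_lt]
    exact ⟨by linarith [hφ.1], by linarith [hφ.2]⟩

namespace JH
variable {α β : ℝ} {c : ℕ → ℝ}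

lemma jF_cont (H : JH α β c) {σ : ℝ} (hσ : 0 < σ) {d : ℕ → ℝ} (hd : Summable (fun n => |d n|)) :
    ContinuousOn (jF α β c d) (sS σ) := by
  obtain ⟨K, hK, h⟩ := H.od_P hσ
  unfold jF
  refine continuousOn_tsum (u := fun n => |d n| * K) (fun n => ?_) (hd.mul_right K) (fun n φ hφ => ?_)
  · exact (continuous_const.mul (nJ_cont α β c n)).continuousOn
  · have := h φ hφ n
    rw [zpow_zero, mul_one] at this
    rw [norm_mul, Real.norm_eq_abs, Real.norm_eq_abs]
    exact mul_le_mul_of_nonneg_left this (abs_nonneg _)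

lemma exp_summable {s K : ℝ} (hs : 0 < s) {e : ℕ → ℝ} (he : ∀ n, |e n| ≤ K) :
    Summable (fun n : ℕ => |Real.exp (-s * n) * e n|) := by
  refine Summable.of_nonneg_of_le (fun _ => abs_nonneg _) (fun n => ?_)
      ((summable_pe 0 hs).mul_right (Real.exp s * K))
  rw [abs_mul, Real.abs_exp, pow_zero, one_mul, ← mul_assoc, ← Real.exp_add]
  rw [show -s * ((n:ℝ)+1) + s = -s * n by ring]
  exact mul_le_mul_of_nonneg_left (he n) (Real.exp_pos _).le

lemma near_M (H : JH α β c) (k : ℕ) {σ θ r : ℝ} (hσ : 0 < σ) (hr : 0 < r) (hU : Metric.ball θ r ⊆ sS σ)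
    (hU' : Metric.ball θ r ⊆ Ioo 0 π) {f : ℝ → ℝ} (hf : Continuous f) (hf' : DifferentiableAt ℝ f θ) :
    ∃ C ε0, 0 ≤ C ∧ 0 < ε0 ∧ ∀ s ε, 0 < s → s ≤ σ/4 → 0 < ε → ε < ε0 →
      |∫ φ, (Icc (θ-ε) (θ+ε)).indicator f φ * jF α β c (fun n => Real.exp (-s * n) * mm α β c (2*k+1) n θ) φ
        ∂(jacobiMeasure α β)| ≤ C * √ε := by
  obtain ⟨A, C, hC, hM⟩ := H.M_asym k hσ hr hU
  have hθ : θ ∈ sS σ := hU (Metric.mem_ball_self hr)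
  have hθ' : θ ∈ Ioo 0 π := hU' (Metric.mem_ball_self hr)
  obtain ⟨K, hK, hm⟩ := H.od_mm hσ (2*k+1)
  have hmK : ∀ n, |mm α β c (2*k+1) n θ| ≤ K := fun n => by
    have := hm θ hθ n
    rwa [zpow_zero, mul_one] at this
  set g : ℝ → ℝ := fun φ => f φ * jw α β φ with hg
  have hgd : DifferentiableAt ℝ g θ := hf'.mul (jw_hasDeriv α β hθ').differentiableAt
  obtain ⟨L0, hL⟩ := hgd.hasDerivAt.isBigO_sub.bound
  set L := |L0| with hLdef
  rw [Metric.eventually_nhds_iff] at hL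
  obtain ⟨ε1, hε1, hL⟩ := hL
  have hgL : ∀ φ, |φ - θ| < ε1 → |g φ - g θ| ≤ L * |φ - θ| := by
    intro φ hφ
    have := hL (y := φ) (by rw [Real.dist_eq]; exact hφ)
    rw [Real.norm_eq_abs, Real.norm_eq_abs] at this
    exact this.trans (mul_le_mul_of_nonneg_right (le_abs_self _) (abs_nonneg _))
  set Bg := |g θ| + L with hBg
  have hL0 : 0 ≤ L := abs_nonneg _
  have hBg0 : 0 ≤ Bg := by positivity
  refine ⟨2 * (2 * |A| * L + 2 * Bg * C), min (min ε1 r) (min (σ/4) 1), by positivity, by positivity, ?_⟩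
  intro s ε hs hsσ hε hε0
  simp only [lt_min_iff] at hε0
  obtain ⟨⟨hε1', hεr⟩, hεσ, hεone⟩ := hε0
  rw [near_int_eq α β hεr hU' hε]
  set M := jF α β c (fun n => Real.exp (-s * n) * mm α β c (2*k+1) n θ) with hMdef
  have hsub : Icc (θ-ε) (θ+ε) ⊆ Metric.ball θ r := by
    intro φ hφ
    rw [Metric.mem_ball, Real.dist_eq, abs_lt]
    exact ⟨by linarith [hφ.1], by linarith [hφ.2]⟩
  have hcont : ContinuousOn (fun φ => g φ * M φ) (Icc (θ-ε) (θ+ε)) := by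
    apply ContinuousOn.mul
    · exact hf.continuousOn.mul ((jw_cont α β).mono (hsub.trans hU'))
    · exact (H.jF_cont hσ (exp_summable hs hmK)).mono (hsub.trans hU)
  change |∫ φ in (θ-ε)..(θ+ε), g φ * M φ| ≤ _
  rw [fold_integral hε hcont]
  obtain ⟨hi, hv⟩ := int_rpow_half hε (2 * |A| * L + 2 * Bg * C)
  have := intervalIntegral.norm_integral_le_of_norm_le (μ := volume) (f := fun h => g (θ+h) * M (θ+h) + g (θ-h) * M (θ-h))
    hε.le (Eventually.of_forall (fun h hh => ?_)) hi
  · rw [hv, Real.norm_eq_abs] at this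
    exact this.trans (le_of_eq (by ring))
  · obtain ⟨h0, h1⟩ := hh
    have ab1 : |θ + h - θ| = h := by rw [add_sub_cancel_left, abs_of_pos h0]
    have ab2 : |θ - h - θ| = h := by rw [sub_sub_cancel_left, abs_neg, abs_of_pos h0]
    have m1 := hM s (θ+h) hs hsσ (hsub ⟨by linarith, by linarith⟩) (by rw [ab1]; exact h0) (by rw [ab1]; linarith)
    have m2 := hM s (θ-h) hs hsσ (hsub ⟨by linarith, by linarith⟩) (by rw [ab2]; exact h0) (by rw [ab2]; linarith)
    have g1 := hgL (θ+h) (by rw [ab1]; linarith)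
    have g2 := hgL (θ-h) (by rw [ab2]; linarith)
    rw [ab1] at m1 g1
    rw [ab2] at m2 g2
    rw [add_sub_cancel_left] at m1
    rw [sub_sub_cancel_left] at m2
    rw [← hMdef] at m1 m2
    set q := h / (h^2+s^2) with hq
    have e2 : -h / ((-h)^2+s^2) = -q := by rw [hq, neg_sq, neg_div]
    rw [e2] at m2
    have hq0 : 0 ≤ q := by positivity
    have hqh : q * h ≤ 1 := by
      rw [hq, div_mul_eq_mul_div, div_le_one (by positivity)]; nlinarith [sq_nonneg s]
    have B1 : |g (θ+h)| ≤ Bg := by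
      have e : g (θ+h) = g θ + (g (θ+h) - g θ) := by ring
      rw [e]; refine (abs_add_le _ _).trans ?_
      have : L * h ≤ L := mul_le_of_le_one_right hL0 (by linarith)
      rw [hBg]; linarith
    have B2 : |g (θ-h)| ≤ Bg := by
      have e : g (θ-h) = g θ + (g (θ-h) - g θ) := by ring
      rw [e]; refine (abs_add_le _ _).trans ?_
      have : L * h ≤ L := mul_le_of_le_one_right hL0 (by linarith)
      rw [hBg]; linarith
    have hrp : h^(-(1/2):ℝ) = 1/√h := by
      rw [Real.rpow_neg h0.le, Real.sqrt_eq_rpow]; simp only [one_div]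
    have hs1 : 1 ≤ 1/√h := by
      rw [le_div_iff₀ (Real.sqrt_pos.2 h0), one_mul]; exact Real.sqrt_le_one.2 (by linarith)
    rw [Real.norm_eq_abs, hrp]
    have e : g (θ+h) * M (θ+h) + g (θ-h) * M (θ-h) = (A*q) * (g (θ+h) - g θ) + (-(A*q)) * (g (θ-h) - g θ) +
      (g (θ+h) * (M (θ+h) - A*q) + g (θ-h) * (M (θ-h) - A * -q)) := by ring
    rw [e]
    refine (abs_add_le _ _).trans ?_
    have t1 : |(A*q) * (g (θ+h) - g θ)| ≤ |A| * L := by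
      rw [abs_mul, abs_mul, abs_of_nonneg hq0]
      calc _ ≤ |A| * q * (L * h) := mul_le_mul_of_nonneg_left g1 (by positivity)
        _ = |A| * L * (q * h) := by ring
        _ ≤ _ := mul_le_of_le_one_right (by positivity) hqh
    have t2 : |(-(A*q)) * (g (θ-h) - g θ)| ≤ |A| * L := by
      rw [abs_mul, abs_neg, abs_mul, abs_of_nonneg hq0]
      calc _ ≤ |A| * q * (L * h) := mul_le_mul_of_nonneg_left g2 (by positivity)
        _ = |A| * L * (q * h) := by ring
        _ ≤ _ := mul_le_of_le_one_right (by positivity) hqh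
    have t3 : |g (θ+h) * (M (θ+h) - A*q)| ≤ Bg * (C / √h) := by
      rw [abs_mul]; exact mul_le_mul B1 m1 (abs_nonneg _) hBg0
    have t4 : |g (θ-h) * (M (θ-h) - A * -q)| ≤ Bg * (C / √h) := by
      rw [abs_mul]; exact mul_le_mul B2 m2 (abs_nonneg _) hBg0
    have u1 := abs_add_le ((A*q) * (g (θ+h) - g θ)) ((-(A*q)) * (g (θ-h) - g θ))
    have u2 := abs_add_le (g (θ+h) * (M (θ+h) - A*q)) (g (θ-h) * (M (θ-h) - A * -q))
    have u3 : 2 * |A| * L ≤ 2 * |A| * L * (1/√h) := le_mul_of_one_le_right (by positivity) hs1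
    have u4 : Bg * (C / √h) = Bg * C * (1/√h) := by ring
    rw [u4] at t3 t4
    linarith

lemma e_bound (H : JH α β c) (m : ℕ) {σ θ : ℝ} (hσ : 0 < σ) (hθ : θ ∈ sS σ) :
    ∃ C, 0 ≤ C ∧ ∀ n : ℕ, |jv α β c (m+1) n θ / nu α β n^(m+1) - mm α β c (m+1) n θ| ≤ C / ((n:ℝ)+1) := by
  obtain ⟨K, hK, hm⟩ := H.od_mm hσ (m+1)
  obtain ⟨V, hV, hv⟩ := H.asym hσ (m+1)
  set τ := |jacobiTau α β| + 1 with hτ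
  have hτ0 : 0 < τ := by positivity
  refine ⟨V * 4^(m+1) + K * (τ * (m+1) * (1+τ)^m) * 4^(m+1), by positivity, fun n => ?_⟩
  have hmK := hm θ hθ n
  have hvV := hv θ hθ n
  beta_reduce at hmK hvV
  rw [zpow_zero, mul_one] at hmK
  rw [show (((m+1:ℕ):ℤ) - 1) = (m:ℤ) by push_cast; ring, zpow_natCast] at hvV
  have hn : (0:ℝ) < (n:ℝ)+1 := by positivity
  have hl := H.nu_lower n
  set ν := nu α β n with hν
  have hν0 : 0 < ν := lt_of_lt_of_le (by positivity) hl
  have hνn : |(n:ℝ) - ν| ≤ τ := by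
    rw [hν]; unfold nu
    rcases n with _ | n
    · simp only [Nat.cast_zero, zero_sub, abs_neg]
      refine (abs_add_le _ _).trans ?_
      simp [hτ, add_comm]
    · rw [max_eq_left (by omega), sub_add_cancel_left, abs_neg]; rw [hτ]; linarith
  have hpd : |(n:ℝ)^(m+1) - ν^(m+1)| ≤ (τ * (m+1) * (1+τ)^m) * ((n:ℝ)+1)^m := by
    have h1 := abs_pow_sub_pow_le (n:ℝ) ν (m+1)
    have hmax : max |(n:ℝ)| |ν| ≤ (1+τ) * ((n:ℝ)+1) := by
      have hn0 : (0:ℝ) ≤ n := Nat.cast_nonneg n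
      apply max_le
      · rw [abs_of_nonneg hn0]; nlinarith
      · rw [abs_of_pos hν0]
        have := (abs_le.1 hνn).1
        nlinarith
    refine h1.trans ?_
    rw [Nat.add_sub_cancel]
    calc _ ≤ τ * ((m+1:ℕ):ℝ) * ((1+τ) * ((n:ℝ)+1))^m := by gcongr
      _ = _ := by rw [mul_pow]; push_cast; ring
  have e : jv α β c (m+1) n θ / ν^(m+1) - mm α β c (m+1) n θ =
    ((jv α β c (m+1) n θ - (n:ℝ)^(m+1) * mm α β c (m+1) n θ) + mm α β c (m+1) n θ * ((n:ℝ)^(m+1) - ν^(m+1))) / ν^(m+1) := by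
    field_simp; ring
  have hνp : (((n:ℝ)+1)/4)^(m+1) ≤ ν^(m+1) := pow_le_pow_left₀ (by positivity) hl _
  rw [e, abs_div, abs_of_pos (pow_pos hν0 _), div_le_div_iff₀ (pow_pos hν0 _) hn]
  have h5 : |(jv α β c (m+1) n θ - (n:ℝ)^(m+1) * mm α β c (m+1) n θ) + mm α β c (m+1) n θ * ((n:ℝ)^(m+1) - ν^(m+1))| ≤
     (V + K * (τ * (m+1) * (1+τ)^m)) * ((n:ℝ)+1)^m := by
    refine (abs_add_le _ _).trans ?_
    rw [abs_mul]
    have := mul_le_mul hmK hpd (abs_nonneg _) hK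
    linarith
  calc _ ≤ (V + K * (τ * (m+1) * (1+τ)^m)) * ((n:ℝ)+1)^m * ((n:ℝ)+1) := mul_le_mul_of_nonneg_right h5 hn.le
    _ = (V * 4^(m+1) + K * (τ * (m+1) * (1+τ)^m) * 4^(m+1)) * (((n:ℝ)+1)/4)^(m+1) := by
        rw [div_pow, pow_succ ((n:ℝ)+1)]; field_simp
    _ ≤ _ := mul_le_mul_of_nonneg_left hνp (by positivity)

lemma near_E (H : JH α β c) {σ θ r B : ℝ} (hσ : 0 < σ) (hr : 0 < r) (hB : 0 ≤ B)
    (hU' : Metric.ball θ r ⊆ Ioo 0 π) {f : ℝ → ℝ} (T : TF σ B f) (hf : Continuous f) {e : ℕ → ℝ} {K : ℝ}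
    (he : ∀ n : ℕ, |e n| ≤ K / ((n:ℝ)+1)) :
    ∃ C ε0, 0 ≤ C ∧ 0 < ε0 ∧ ∀ s ε, 0 < s → 0 < ε → ε < ε0 →
      |∫ φ, (Icc (θ-ε) (θ+ε)).indicator f φ * jF α β c (fun n => Real.exp (-s * n) * e n) φ
        ∂(jacobiMeasure α β)| ≤ C * √ε := by
  have hK : 0 ≤ K := by have := (abs_nonneg _).trans (he 0); simpa using this
  have heK : ∀ n, |e n| ≤ K := fun n => (he n).trans (div_le_self hK (by have : (0:ℝ) ≤ n := Nat.cast_nonneg n; linarith))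
  have hsubr : Icc (θ-r/2) (θ+r/2) ⊆ Metric.ball θ r := by
    intro φ hφ
    rw [Metric.mem_ball, Real.dist_eq, abs_lt]
    exact ⟨by linarith [hφ.1], by linarith [hφ.2]⟩
  obtain ⟨W, hW⟩ := (isCompact_Icc (a := θ-r/2) (b := θ+r/2)).exists_bound_of_continuousOn
    ((jw_cont α β).mono (hsubr.trans hU'))
  have hW0 : 0 ≤ W := (norm_nonneg _).trans (hW θ ⟨by linarith, by linarith⟩)
  have hsum : Summable (fun n : ℕ => K^2 * (1/((n:ℝ)+1)^2)) := by
    have : Summable (fun n : ℕ => (1:ℝ)/(n:ℝ)^2) := Real.summable_one_div_nat_pow.mpr (by norm_num)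
    refine (((summable_nat_add_iff 1).mpr this).mul_left (K^2)).congr (fun n => ?_)
    push_cast; rfl
  set Q := ∑' n : ℕ, K^2 * (1/((n:ℝ)+1)^2) with hQ
  have hQ0 : 0 ≤ Q := tsum_nonneg (fun n => by positivity)
  refine ⟨B^2*W + Q/2, r/2, by positivity, by positivity, fun s ε hs hε hεr => ?_⟩
  set ψ := (Icc (θ-ε) (θ+ε)).indicator f with hψ
  have Tψ : TF σ B ψ := by
    refine ⟨T.m.indicator measurableSet_Icc, fun φ => ?_, fun φ hφ => ?_⟩
    · by_cases h : φ ∈ Icc (θ-ε) (θ+ε)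
      · rw [hψ, indicator_of_mem h]; exact T.b φ
      · rw [hψ, indicator_of_notMem h]; simpa using hB
    · by_cases h : φ ∈ Icc (θ-ε) (θ+ε)
      · rw [hψ, indicator_of_mem h]; exact T.z φ hφ
      · rw [hψ, indicator_of_notMem h]
  have hL := H.TF_L2 hσ hB Tψ (d := fun n => Real.exp (-s * n) * e n) (exp_summable hs heK) (Q := Q) ?_ (r := 1/√ε)
    (by have := Real.sqrt_pos.2 hε; positivity)
  · refine (abs_integral_le_integral_abs).trans (hL.trans ?_)
    have hi : ∫ φ, ψ φ^2 ∂(jacobiMeasure α β) ≤ B^2 * W * (2*ε) := by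
      have h1 := near_int_eq α β (show ε < r by linarith) hU' hε f ψ
      have e1 : ∫ φ, ψ φ^2 ∂(jacobiMeasure α β) = ∫ φ, (Icc (θ-ε) (θ+ε)).indicator f φ * ψ φ ∂(jacobiMeasure α β) := by
        congr 1; funext φ; rw [sq]
      rw [e1, h1]
      have h2 := intervalIntegral.norm_integral_le_of_norm_le_const (a := θ-ε) (b := θ+ε) (f := fun φ => f φ * jw α β φ * ψ φ)
        (C := B^2*W) ?_
      · rw [show θ + ε - (θ - ε) = 2*ε by ring, abs_of_pos (by linarith)] at h2
        exact (le_abs_self _).trans h2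
      · intro φ hφ
        rw [uIoc_of_le (by linarith)] at hφ
        have h3 := hW φ ⟨by linarith [hφ.1], by linarith [hφ.2]⟩
        rw [norm_mul, norm_mul, Real.norm_eq_abs (f φ), Real.norm_eq_abs (ψ φ)]
        calc _ ≤ B * W * B := by
              have := T.b φ
              have := Tψ.b φ
              gcongr
          _ = _ := by ring
    have hsε := Real.sqrt_pos.2 hε
    have hsq := Real.sq_sqrt hε.le
    calc _ ≤ 1/√ε/2 * (B^2 * W * (2*ε)) + Q / (2 * (1/√ε)) := by
          gcongr
      _ = _ := by
          nth_rewrite 2 [← hsq]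
          field_simp
  · intro M
    refine le_trans (Finset.sum_le_sum (fun n _ => ?_)) (hsum.sum_le_tsum _ (fun n _ => by positivity))
    rw [mul_pow, ← sq_abs (e n)]
    have h1 : Real.exp (-s * n)^2 ≤ 1 := by
      apply pow_le_one₀ (Real.exp_pos _).le
      apply Real.exp_le_one_iff.2
      have : (0:ℝ) ≤ s * n := by positivity
      linarith
    have h2 : |e n|^2 ≤ (K / ((n:ℝ)+1))^2 := pow_le_pow_left₀ (abs_nonneg _) (he n) 2
    calc _ ≤ 1 * (K / ((n:ℝ)+1))^2 := mul_le_mul h1 h2 (by positivity) zero_le_one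
      _ = _ := by rw [div_pow]; ring

end JH

end

section
open Polynomial Topology

lemma TF_indicator {σ B : ℝ} (hB : 0 ≤ B) {f : ℝ → ℝ} (T : TF σ B f) {S : Set ℝ} (hS : MeasurableSet S) :
    TF σ B (S.indicator f) := by
  refine ⟨T.m.indicator hS, fun φ => ?_, fun φ hφ => ?_⟩
  · by_cases h : φ ∈ S
    · rw [indicator_of_mem h]; exact T.b φ
    · rw [indicator_of_notMem h]; simpa using hB
  · by_cases h : φ ∈ S
    · rw [indicator_of_mem h]; exact T.z φ hφ
    · rw [indicator_of_notMem h]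

namespace JH
variable {α β : ℝ} {c : ℕ → ℝ}

lemma ks_eq (H : JH α β c) (m : ℕ) (s θ : ℝ) (n : ℕ) : ks α β c (m+1) s θ n =
    Real.exp (-s * jacobiTau α β) * (Real.exp (-s * n) * mm α β c (m+1) n θ +
      Real.exp (-s * n) * (jv α β c (m+1) n θ / nu α β n^(m+1) - mm α β c (m+1) n θ)) := by
  rw [← mul_add, add_sub_cancel]
  unfold ks
  rcases n with _ | n
  · rw [H.jv_at_zero]; simp
  · rw [← mul_assoc, ← Real.exp_add]
    congr 2
    unfold nu
    rw [max_eq_left (by omega)]; ring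

lemma near (H : JH α β c) (k : ℕ) {σ θ r B : ℝ} (hσ : 0 < σ) (hr : 0 < r) (hB : 0 ≤ B) (hU : Metric.ball θ r ⊆ sS σ)
    (hU' : Metric.ball θ r ⊆ Ioo 0 π) {f : ℝ → ℝ} (T : TF σ B f) (hf : Continuous f) (hf' : DifferentiableAt ℝ f θ) :
    ∃ C ε0, 0 ≤ C ∧ 0 < ε0 ∧ ∀ s ε, 0 < s → s ≤ σ/4 → s ≤ 1 → 0 < ε → ε < ε0 →
      |∫ φ, (Icc (θ-ε) (θ+ε)).indicator f φ * jF α β c (ks α β c (2*k+1) s θ) φ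
        ∂(jacobiMeasure α β)| ≤ C * √ε := by
  have hθ : θ ∈ sS σ := hU (Metric.mem_ball_self hr)
  obtain ⟨K, hK, he⟩ := H.e_bound (2*k) hσ hθ
  obtain ⟨C1, ε1, hC1, hε1, h1⟩ := H.near_M k hσ hr hU hU' hf hf'
  obtain ⟨C2, ε2, hC2, hε2, h2⟩ := H.near_E hσ hr hB hU' T hf he
  obtain ⟨M, hM, hm⟩ := H.od_mm hσ (2*k+1)
  have hmK : ∀ n, |mm α β c (2*k+1) n θ| ≤ M := fun n => by
    have := hm θ hθ n
    rwa [zpow_zero, mul_one] at this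
  refine ⟨Real.exp |jacobiTau α β| * (C1 + C2), min ε1 ε2, by positivity, by positivity, ?_⟩
  intro s ε hs hsσ hs1 hε hε0
  rw [lt_min_iff] at hε0
  have q1 := h1 s ε hs hsσ hε hε0.1
  have q2 := h2 s ε hs hε hε0.2
  have Tψ := TF_indicator hB T (measurableSet_Icc (a := θ-ε) (b := θ+ε))
  have heK : ∀ n : ℕ, |jv α β c (2*k+1) n θ / nu α β n^(2*k+1) - mm α β c (2*k+1) n θ| ≤ K := fun n => (he n).trans
    (div_le_self hK (by have : (0:ℝ) ≤ n := Nat.cast_nonneg n; linarith))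
  have S1 := (H.TF_swap hσ hB Tψ (exp_summable hs hmK)).2
  have S2 := (H.TF_swap hσ hB Tψ (exp_summable hs heK)).2
  have S3 := (H.TF_swap hσ hB Tψ (H.ks_summable hσ hθ (2*k+1) hs)).2
  have S4 := (S1.add S2).mul_left (Real.exp (-s * jacobiTau α β))
  have e := S3.unique (S4.congr_fun' (fun n => by rw [H.ks_eq]; ring))
  rw [e, abs_mul, Real.abs_exp]
  have i1 : Real.exp (-s * jacobiTau α β) ≤ Real.exp |jacobiTau α β| := by
    apply Real.exp_le_exp.2
    calc _ ≤ |(-s) * jacobiTau α β| := le_abs_self _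
      _ = s * |jacobiTau α β| := by rw [abs_mul, abs_neg, abs_of_pos hs]
      _ ≤ _ := mul_le_of_le_one_left (abs_nonneg _) hs1
  have i2 := (abs_add_le _ _).trans (add_le_add q1 q2)
  calc _ ≤ Real.exp |jacobiTau α β| * (C1 * √ε + C2 * √ε) := mul_le_mul i1 i2 (abs_nonneg _) (Real.exp_pos _).le
    _ = _ := by ring

lemma whole (H : JH α β c) (m : ℕ) {σ θ B δ : ℝ} (hσ : 0 < σ) (hB : 0 ≤ B) (hθ : θ ∈ sS σ)
    {f : ℝ → ℝ} (T : TF σ B f) (hf : ContDiff ℝ (⊤:ℕ∞) f) (h0 : 0 < δ) (h1 : δ < π/2)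
    (hs : ∀ φ, φ ∉ Icc δ (π-δ) → f φ = 0) :
    Tendsto (fun s => ∫ φ, f φ * jF α β c (ks α β c (m+1) s θ) φ ∂(jacobiMeasure α β)) (𝓝[>] 0)
      (𝓝 (rieszTransform α β c (m+1) f θ)) := by
  obtain ⟨C, hC, hd⟩ := H.f_decay f hf h0 h1 hs
  obtain ⟨K, hK, hq⟩ := H.q_bdd hσ hθ (m+1)
  have hsum : Summable (fun n : ℕ => K * C * (1/((n:ℝ)+1)^2)) := by
    have : Summable (fun n : ℕ => (1:ℝ)/(n:ℝ)^2) := Real.summable_one_div_nat_pow.mpr (by norm_num)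
    refine (((summable_nat_add_iff 1).mpr this).mul_left (K*C)).congr (fun n => ?_)
    push_cast; rfl
  set a : ℕ → ℝ := fun n => jv α β c (m+1) n θ / nu α β n^(m+1) * jacobiInner α β f (nJacobi α β c n) with ha
  have hab : ∀ n : ℕ, |a n| ≤ K * C * (1/((n:ℝ)+1)^2) := by
    intro n
    simp only [ha]
    rw [abs_mul]
    calc _ ≤ K * (C/((n:ℝ)+1)^2) := mul_le_mul (hq n) (hd n) (abs_nonneg _) hK
      _ = _ := by ring
  have hT : rieszTransform α β c (m+1) f θ = ∑' n, a n := by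
    have hsa : Summable a := Summable.of_norm_bounded hsum hab
    rw [hsa.tsum_eq_zero_add]
    have : a 0 = 0 := by simp only [ha]; rw [H.jv_at_zero]; simp
    rw [this, zero_add]
    unfold rieszTransform
    apply tsum_congr
    intro n
    simp only [ha]
    rw [← H.nu_eq, Real.rpow_neg (by have := H.nu_lower (n+1); exact le_trans (by positivity) this), Real.rpow_natCast]
    unfold jv
    ring
  rw [hT]
  have L : Tendsto (fun s : ℝ => ∑' n, Real.exp (-s * nu α β n) * a n) (𝓝[>] 0) (𝓝 (∑' n, a n)) := by
    apply tendsto_tsum_of_dominated_convergence hsum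
    · intro n
      have hc : Continuous (fun s : ℝ => Real.exp (-s * nu α β n) * a n) := by fun_prop
      have := hc.tendsto 0
      simp only [neg_zero, zero_mul, Real.exp_zero, one_mul] at this
      exact this.mono_left nhdsWithin_le_nhds
    · filter_upwards [self_mem_nhdsWithin] with s hs n
      have hs' : (0:ℝ) < s := hs
      rw [norm_mul, Real.norm_eq_abs, Real.norm_eq_abs, Real.abs_exp]
      refine le_trans (mul_le_of_le_one_left (abs_nonneg _) ?_) (hab n)
      apply Real.exp_le_one_iff.2
      have := H.nu_lower n
      have hν : 0 ≤ nu α β n := le_trans (by positivity) this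
      nlinarith
  refine L.congr' ?_
  filter_upwards [self_mem_nhdsWithin] with s hs
  rw [← (H.TF_swap hσ hB T (H.ks_summable hσ hθ (m+1) hs)).2.tsum_eq]
  apply tsum_congr
  intro n
  simp only [ha, ks]
  ring

lemma main (H : JH α β c) (k : ℕ) {f : ℝ → ℝ} (hf : IsCcSmooth f) {θ : ℝ} (hθ : θ ∈ Ioo 0 π) :
    Tendsto
      (fun ε : ℝ => ∫ φ in {φ | φ ∈ Set.Ioo 0 π ∧ ε < |φ - θ|},
        rieszKer α β c (2*k+1) θ φ * f φ ∂(jacobiMeasure α β)) (𝓝[>] 0)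
      (𝓝 (rieszTransform α β c (2*k+1) f θ)) := by
  obtain ⟨δ0, hδ0, hδ0', hsup0⟩ := cc_support f hf
  obtain ⟨ht0, ht1⟩ := hθ
  set δ := min δ0 (min (θ/2) ((π-θ)/2)) with hδ
  have hδp : 0 < δ := by
    rw [hδ]; exact lt_min hδ0 (lt_min (by linarith) (by linarith))
  have hd1 : δ ≤ δ0 := min_le_left _ _
  have hd2 : δ ≤ θ/2 := (min_le_right _ _).trans (min_le_left _ _)
  have hd3 : δ ≤ (π-θ)/2 := (min_le_right _ _).trans (min_le_right _ _)
  have hδ2 : δ < π/2 := by linarith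
  have hsup : ∀ φ, φ ∉ Icc δ (π-δ) → f φ = 0 := by
    intro φ hφ
    apply hsup0
    intro h
    exact hφ ⟨by linarith [h.1], by linarith [h.2]⟩
  set r := min (θ-δ) (π-δ-θ) with hr
  have hrp : 0 < r := by rw [hr]; exact lt_min (by linarith) (by linarith)
  have hr1 : r ≤ θ-δ := min_le_left _ _
  have hr2 : r ≤ π-δ-θ := min_le_right _ _
  have hball : Metric.ball θ r ⊆ Icc δ (π-δ) := by
    intro φ hφ
    rw [Metric.mem_ball, Real.dist_eq, abs_lt] at hφ
    exact ⟨by linarith [hφ.1], by linarith [hφ.2]⟩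
  set σ := Real.sin δ with hσd
  have hσ : 0 < σ := Real.sin_pos_of_pos_of_lt_pi hδp (by linarith)
  have hU : Metric.ball θ r ⊆ sS σ := fun φ hφ => Icc_sub_sS hδp hδ2 (hball hφ)
  have hU' : Metric.ball θ r ⊆ Ioo 0 π := fun φ hφ => ⟨by linarith [(hball hφ).1], by linarith [(hball hφ).2]⟩
  have hθS : θ ∈ sS σ := hU (Metric.mem_ball_self hrp)
  have hfc : Continuous f := hf.1.continuous
  have hfd : DifferentiableAt ℝ f θ := hf.1.differentiable (by simp) θ
  obtain ⟨B0, hB0⟩ := hf.2.1.exists_bound_of_continuous hfc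
  have hB : 0 ≤ B0 := (norm_nonneg _).trans (hB0 0)
  have T : TF σ B0 f := ⟨hfc.measurable, hB0, fun φ hφ => hsup φ (fun h => hφ (Icc_sub_sS hδp hδ2 h))⟩
  obtain ⟨C, ε0, hC, hε0, hnear⟩ := H.near k hσ hrp hB hU hU' T hfc hfd
  have hwhole := H.whole (2*k) hσ hB hθS T hf.1 hδp hδ2 hsup
  have key : ∀ ε, 0 < ε → ε < ε0 → |(∫ φ in {φ | φ ∈ Set.Ioo 0 π ∧ ε < |φ - θ|},
        rieszKer α β c (2*k+1) θ φ * f φ ∂(jacobiMeasure α β)) - rieszTransform α β c (2*k+1) f θ| ≤ C * √ε := by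
    intro ε hε hεε
    have hS : MeasurableSet (Icc (θ-ε) (θ+ε))ᶜ := measurableSet_Icc.compl
    have T1 := TF_indicator hB T (measurableSet_Icc (a := θ-ε) (b := θ+ε))
    have T2 := TF_indicator hB T hS
    have hmem : ∀ φ, φ ∈ (Icc (θ-ε) (θ+ε))ᶜ ↔ ε < |φ - θ| := by
      intro φ
      rw [mem_compl_iff, ← not_le, abs_le, mem_Icc]
      constructor <;> intro h h' <;> exact h ⟨by linarith [h'.1], by linarith [h'.2]⟩
    have hκ : ∃ κ, 0 < κ ∧ ∀ φ ∈ Icc δ (π-δ) ∩ {φ | ε ≤ |φ - θ|}, κ ≤ |Real.cos θ - Real.cos φ| := by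
      apply IsCompact.exists_forall_le'
      · exact isCompact_Icc.inter_right (isClosed_le (by fun_prop) (by fun_prop))
      · exact (by fun_prop : Continuous fun φ => |Real.cos θ - Real.cos φ|).continuousOn
      · intro φ hφ
        rw [abs_pos]
        intro h0
        have := Real.injOn_cos (show θ ∈ Icc 0 π from ⟨ht0.le, ht1.le⟩) (show φ ∈ Icc 0 π from ⟨by linarith [hφ.1.1], by linarith [hφ.1.2]⟩) (by linarith)
        have h3 : ε ≤ |φ - θ| := hφ.2
        rw [this, sub_self, abs_zero] at h3
        linarith
    obtain ⟨κ, hκ0, hκ⟩ := hκ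
    have hψ : ∀ φ, (Icc (θ-ε) (θ+ε))ᶜ.indicator f φ ≠ 0 → κ ≤ |Real.cos θ - Real.cos φ| := by
      intro φ hφ
      have h1 : φ ∈ (Icc (θ-ε) (θ+ε))ᶜ := by
        by_contra hc; exact hφ (indicator_of_notMem hc _)
      rw [indicator_of_mem h1] at hφ
      apply hκ
      refine ⟨?_, ((hmem φ).1 h1).le⟩
      by_contra hc; exact hφ (hsup φ hc)
    have hfar := H.far (2*k) hσ hrp hU hB hκ0 T2 hψ
    have hconv : (∫ φ in {φ | φ ∈ Set.Ioo 0 π ∧ ε < |φ - θ|},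
        rieszKer α β c (2*k+1) θ φ * f φ ∂(jacobiMeasure α β)) =
        ∫ φ, rieszKer α β c (2*k+1) θ φ * (Icc (θ-ε) (θ+ε))ᶜ.indicator f φ ∂(jacobiMeasure α β) := by
      have hms : MeasurableSet {φ | φ ∈ Set.Ioo 0 π ∧ ε < |φ - θ|} :=
        measurableSet_Ioo.inter (measurableSet_lt (f := fun _ : ℝ => ε) (g := fun φ : ℝ => |φ - θ|) measurable_const (by fun_prop))
      rw [← integral_indicator hms]
      apply integral_congr_ae
      filter_upwards [jm_ae α β] with φ hφ
      by_cases h : ε < |φ - θ|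
      · rw [indicator_of_mem (show φ ∈ {φ | φ ∈ Set.Ioo 0 π ∧ ε < |φ - θ|} from ⟨hφ, h⟩), indicator_of_mem ((hmem φ).2 h)]
      · rw [indicator_of_notMem (show φ ∉ {φ | φ ∈ Set.Ioo 0 π ∧ ε < |φ - θ|} from fun h' => h h'.2),
          indicator_of_notMem (fun h' => h ((hmem φ).1 h')), mul_zero]
    rw [hconv, abs_sub_comm]
    have hlim := (hwhole.sub hfar).abs
    refine le_of_tendsto hlim ?_
    have hev : ∀ᶠ s in 𝓝[>] (0:ℝ), s ∈ Ioo 0 (min (σ/4) 1) := Ioo_mem_nhdsGT (by positivity)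
    filter_upwards [hev] with s hs
    have hs2 := lt_min_iff.1 hs.2
    have hn := hnear s ε hs.1 hs2.1.le hs2.2.le hε hεε
    have hk := H.ks_summable hσ hθS (2*k+1) hs.1
    have I1 := (H.TF_swap hσ hB T hk).1
    have I2 := (H.TF_swap hσ hB T2 hk).1
    rw [← integral_sub I1 I2]
    refine le_trans (le_of_eq ?_) hn
    congr 2
    funext φ
    rw [← sub_mul]
    congr 1
    by_cases h : φ ∈ Icc (θ-ε) (θ+ε)
    · rw [indicator_of_mem h, indicator_of_notMem (show φ ∉ (Icc (θ-ε) (θ+ε))ᶜ from fun h' => h' h), sub_zero]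
    · rw [indicator_of_notMem h, indicator_of_mem (show φ ∈ (Icc (θ-ε) (θ+ε))ᶜ from h), sub_self]
  rw [tendsto_iff_norm_sub_tendsto_zero]
  have hz : Tendsto (fun ε : ℝ => C * √ε) (𝓝[>] 0) (𝓝 0) := by
    have hc : Continuous (fun ε : ℝ => C * √ε) := by fun_prop
    have := hc.tendsto 0
    simp only [Real.sqrt_zero, mul_zero] at this
    exact this.mono_left nhdsWithin_le_nhds
  refine squeeze_zero' (Eventually.of_forall (fun _ => norm_nonneg _)) ?_ hz
  have hev : ∀ᶠ ε in 𝓝[>] (0:ℝ), ε ∈ Ioo 0 ε0 := Ioo_mem_nhdsGT hε0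
  filter_upwards [hev] with ε hε
  exact key ε hε.1 hε.2

end JH

end

/-- For odd `N ≥ 1`, `f ∈ C_c^∞(0,π)` and `θ ∈ (0,π)`, the principal value
`pv ∫₀^π R_N(θ,φ) f(φ) dμ(φ)` exists and equals `R_N f(θ)`. -/
theorem riesz_jacobi_odd_pv_representation
    (α β : ℝ) (hα : -1 < α) (hβ : -1 < β)
    (c : ℕ → ℝ) (hc : JacobiNormalized α β c)
    (N : ℕ) (hN : 1 ≤ N) (hNodd : Odd N)
    (f : ℝ → ℝ) (hf : IsCcSmooth f)
    (θ : ℝ) (hθ : θ ∈ Set.Ioo 0 π) :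
    Filter.Tendsto
      (fun ε : ℝ => ∫ φ in {φ | φ ∈ Set.Ioo 0 π ∧ ε < |φ - θ|},
        rieszKer α β c N θ φ * f φ ∂(jacobiMeasure α β))
      (nhdsWithin 0 (Set.Ioi 0))
      (nhds (rieszTransform α β c N f θ)) := by
  obtain ⟨k, rfl⟩ := hNodd
  exact JH.main ⟨hα, hβ, hc⟩ k hf hθ

end
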